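/- arXiv:2506.20508 — 4 statements merged into one kernel-verified Lean document; each statement's English description precedes it below -/
import Mathlib

section
/- Let P be a simple polygon in ℝ² with segments [x,y] ⊆ P and [u,v] ⊆ P such that segment ℝ x y ∩ segment ℝ u v = ∅ and every point of segment ℝ u v is seen by at least one point of segment ℝ x y. Then there exists a finite set S ⊆ segment ℝ x y such that every point of segment ℝ u v is seen by some point of S. -/
open scoped RealInnerProductSpace symmDiff
open Metric Set MeasureTheory

noncomputable section

abbrev Pt : Type := EuclideanSpace ℝ (Fin 2)

/-- The cyclic successor on `Fin n`. -/
def nxt {n : ℕ} (i : Fin n) : Fin n := ⟨(i.1 + 1) % n, Nat.mod_lt _ i.pos⟩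

/-- The cyclic predecessor on `Fin n`. -/
def prv {n : ℕ} (i : Fin n) : Fin n := ⟨(i.1 + n - 1) % n, Nat.mod_lt _ i.pos⟩

/-- A simple polygon in the plane: at least 3 vertices, injective vertex map,
adjacent edges meet exactly in their common vertex, non-adjacent edges are disjoint. -/
structure SimplePolygon where
  n : ℕ
  hn : 3 ≤ n
  v : Fin n → Pt
  inj : Function.Injective v
  adj : ∀ i : Fin n,
    segment ℝ (v i) (v (nxt i)) ∩ segment ℝ (v (nxt i)) (v (nxt (nxt i))) = {v (nxt i)}
  nonadj : ∀ i j : Fin n, i ≠ j → j ≠ nxt i → i ≠ nxt j →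
    segment ℝ (v i) (v (nxt i)) ∩ segment ℝ (v j) (v (nxt j)) = ∅

namespace SimplePolygon

variable (Q : SimplePolygon)

/-- The `i`-th edge of the polygon. -/
def edge (i : Fin Q.n) : Set Pt := segment ℝ (Q.v i) (Q.v (nxt i))

/-- The boundary of the polygon: the union of its edges. -/
def bdry : Set Pt := ⋃ i, Q.edge i

/-- The polygon body: the boundary together with all points off the boundary whose
connected component in the complement of the boundary is bounded. -/
def body : Set Pt :=
  Q.bdry ∪ {z | z ∉ Q.bdry ∧ Bornology.IsBounded (connectedComponentIn Q.bdryᶜ z)}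

/-- A point `s` sees a point `t` if the open segment between them lies in the
interior of the polygon body. -/
def Sees (s t : Pt) : Prop := openSegment ℝ s t ⊆ interior Q.body

/-- The polygon is locally convex at vertex `v i`. -/
def LocallyConvexAt (i : Fin Q.n) : Prop :=
  ∃ ε > 0, Convex ℝ (Q.body ∩ Metric.ball (Q.v i) ε)

/-- A reflex vertex: the polygon is not locally convex there. -/
def IsReflex (i : Fin Q.n) : Prop := ¬ Q.LocallyConvexAt i

/-- Values `⟪n, s - r⟫ > 0` for distinct reflex vertices `r, s` and unit normal `n` such
that a small piece of the line with normal `n` through each of `r, s` is contained in the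
polygon body (short-width candidates). -/
def SWset : Set ℝ :=
  {d | ∃ i j : Fin Q.n, Q.IsReflex i ∧ Q.IsReflex j ∧ Q.v i ≠ Q.v j ∧
    ∃ nv : Pt, ‖nv‖ = 1 ∧ d = ⟪nv, Q.v j - Q.v i⟫ ∧ 0 < d ∧
      ∀ w ∈ ({Q.v i, Q.v j} : Set Pt), ∃ ε > 0,
        {z : Pt | ⟪nv, z - w⟫ = 0} ∩ Metric.ball w ε ⊆ Q.body}

/-- The short width of the polygon. -/
def SW : ℝ := sInf Q.SWset

/-- Values `⟪n, a - b⟫` for convex vertices `a, b` and unit vector `n` such that the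
whole polygon body lies between the lines through `b` and `a` with normal `n`
(long-width candidates). -/
def LWset : Set ℝ :=
  {d | ∃ i j : Fin Q.n, Q.LocallyConvexAt i ∧ Q.LocallyConvexAt j ∧
    ∃ nv : Pt, ‖nv‖ = 1 ∧ d = ⟪nv, Q.v i - Q.v j⟫ ∧
      ∀ z ∈ Q.body, ⟪nv, Q.v j⟫ ≤ ⟪nv, z⟫ ∧ ⟪nv, z⟫ ≤ ⟪nv, Q.v i⟫}

/-- The long width of the polygon. -/
def LW : ℝ := sSup Q.LWset

/-- General position: no three distinct vertices are collinear. -/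
def GeneralPosition : Prop :=
  ∀ i j k : Fin Q.n, Q.v i ≠ Q.v j → Q.v j ≠ Q.v k → Q.v i ≠ Q.v k →
    ¬ Collinear ℝ ({Q.v i, Q.v j, Q.v k} : Set Pt)

/-- The visibility polygon of a point `p`. -/
def VP (p : Pt) : Set Pt := {z ∈ Q.body | openSegment ℝ p z ⊆ interior Q.body}

/-- Vision stability with constant `γ`. -/
def VisionStable (γ : ℝ) : Prop :=
  ∀ p ∈ Q.body, ∀ q ∈ Q.body,
    volume (Q.VP p ∆ Q.VP q) ≤ ENNReal.ofReal (γ * dist p q)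

/-- The perimeter of the polygon. -/
def perim : ℝ := ∑ i, dist (Q.v i) (Q.v (nxt i))

end SimplePolygon
namespace SimplePolygon

open Filter Topology

/-- A closed bounded set whose points outside the body are interior lies in the body. -/
lemma fill (Q : SimplePolygon) (K : Set Pt) (hc : IsClosed K) (hb : Bornology.IsBounded K)
    (hK : ∀ q ∈ K, q ∉ Q.body → q ∈ interior K) : K ⊆ Q.body := by
  intro w hw
  by_contra hwb
  have hwB : w ∉ Q.bdry := fun h => hwb (Or.inl h)
  have hunb : ¬ Bornology.IsBounded (connectedComponentIn Q.bdryᶜ w) :=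
    fun h => hwb (Or.inr ⟨hwB, h⟩)
  have hC : ∀ p ∈ connectedComponentIn Q.bdryᶜ w, p ∉ Q.body := by
    intro p hp hpb
    rcases hpb with h | ⟨_, h⟩
    · exact connectedComponentIn_subset _ _ hp h
    · rw [← connectedComponentIn_eq hp] at h
      exact hunb h
  have hsub : connectedComponentIn Q.bdryᶜ w ⊆ interior K := by
    refine IsPreconnected.subset_left_of_subset_union isOpen_interior hc.isOpen_compl ?_ ?_ ?_
      isPreconnected_connectedComponentIn
    · exact disjoint_compl_right.mono_left interior_subset
    · intro p hp
      by_cases hpK : p ∈ K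
      · exact Or.inl (hK p hpK (hC p hp))
      · exact Or.inr hpK
    · exact ⟨w, mem_connectedComponentIn hwB, hK w hw hwb⟩
  exact hunb (hb.subset (hsub.trans interior_subset))

/-- planar determinant -/
def det2 (p q : Pt) : ℝ := p 0 * q 1 - p 1 * q 0

lemma coords (a e f : Pt) (h : det2 e f ≠ 0) :
    ∃ X Y : Pt → ℝ, Continuous X ∧ Continuous Y ∧
      (∀ q, q = a + X q • e + Y q • f) ∧
      (∀ x y : ℝ, X (a + x • e + y • f) = x ∧ Y (a + x • e + y • f) = y) := by
  refine ⟨fun q => det2 (q - a) f / det2 e f, fun q => det2 e (q - a) / det2 e f, ?_, ?_, ?_, ?_⟩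
  · unfold det2; fun_prop
  · unfold det2; fun_prop
  · intro q
    ext i
    fin_cases i <;> simp <;> field_simp <;> simp [det2] <;> ring
  · intro x y
    constructor
    · rw [div_eq_iff h]; simp [det2]; ring
    · rw [div_eq_iff h]; simp [det2]; ring

lemma mem_seg (a b : Pt) (q : Pt) (l : ℝ) (h0 : 0 ≤ l) (h1 : l ≤ 1) (h : q = a + l • (b - a)) :
    q ∈ segment ℝ a b := by
  rw [segment_eq_image']
  exact ⟨l, ⟨h0, h1⟩, h.symm⟩

lemma bdd_aux (a e f : Pt) (K : Set Pt)
    (h : ∀ q ∈ K, ∃ x y : ℝ, 0 ≤ x ∧ x ≤ 1 ∧ 0 ≤ y ∧ y ≤ 1 ∧ q = a + x • e + y • f) :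
    Bornology.IsBounded K := by
  rw [isBounded_iff_forall_norm_le]
  refine ⟨‖a‖ + ‖e‖ + ‖f‖, ?_⟩
  intro q hq
  obtain ⟨x, y, hx0, hx1, hy0, hy1, rfl⟩ := h q hq
  have h1 : ‖x • e‖ ≤ ‖e‖ := by
    rw [norm_smul, Real.norm_of_nonneg hx0]
    nlinarith [norm_nonneg e]
  have h2 : ‖y • f‖ ≤ ‖f‖ := by
    rw [norm_smul, Real.norm_of_nonneg hy0]
    nlinarith [norm_nonneg f]
  have := norm_add₃_le (a := a) (b := x • e) (c := y • f)
  linarith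

/-- A nondegenerate triangle whose boundary lies in the body. -/
lemma tri (Q : SimplePolygon) (a b c : Pt) (hdet : det2 (c - a) (b - a) ≠ 0)
    (hab : segment ℝ a b ⊆ Q.body) (hbc : segment ℝ b c ⊆ Q.body)
    (hca : segment ℝ c a ⊆ Q.body) (x y : ℝ) (hx : 0 < x) (hy : 0 < y) (hxy : x + y < 1) :
    a + x • (c - a) + y • (b - a) ∈ interior Q.body := by
  obtain ⟨X, Y, hX, hY, hq, hXY⟩ := coords a (c - a) (b - a) hdet
  have hO : IsOpen {q | 0 < X q ∧ 0 < Y q ∧ X q + Y q < 1} :=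
    (isOpen_lt continuous_const hX).inter
      ((isOpen_lt continuous_const hY).inter (isOpen_lt (hX.add hY) continuous_const))
  have hsub : {q | 0 < X q ∧ 0 < Y q ∧ X q + Y q < 1} ⊆
      {q | 0 ≤ X q ∧ 0 ≤ Y q ∧ X q + Y q ≤ 1} := fun q h => ⟨h.1.le, h.2.1.le, h.2.2.le⟩
  have hK : {q | 0 ≤ X q ∧ 0 ≤ Y q ∧ X q + Y q ≤ 1} ⊆ Q.body := by
    apply Q.fill
    · exact (isClosed_le continuous_const hX).inter
        ((isClosed_le continuous_const hY).inter (isClosed_le (hX.add hY) continuous_const))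
    · apply bdd_aux a (c - a) (b - a)
      rintro q ⟨h1, h2, h3⟩
      exact ⟨X q, Y q, h1, by linarith, h2, by linarith, hq q⟩
    · rintro q ⟨h1, h2, h3⟩ hqb
      apply interior_maximal hsub hO
      refine ⟨lt_of_le_of_ne h1 ?_, lt_of_le_of_ne h2 ?_, lt_of_le_of_ne h3 ?_⟩
      · intro h
        apply hqb; apply hab
        refine mem_seg a b q (Y q) h2 (by linarith) ?_
        conv_lhs => rw [hq q, ← h]
        module
      · intro h
        apply hqb; apply hca
        rw [segment_symm]
        refine mem_seg a c q (X q) h1 (by linarith) ?_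
        conv_lhs => rw [hq q, ← h]
        module
      · intro h
        apply hqb; apply hbc
        refine mem_seg b c q (X q) h1 (by linarith) ?_
        have : Y q = 1 - X q := by linarith
        conv_lhs => rw [hq q, this]
        module
  apply interior_maximal (hsub.trans hK) hO
  obtain ⟨e1, e2⟩ := hXY x y
  simp only [mem_ofPred_eq, e1, e2]
  exact ⟨hx, hy, hxy⟩

/-- A quadrilateral `a b c d` with `b`, `d` strictly on opposite sides of the line `a c`. -/
lemma quad (Q : SimplePolygon) (a b c d : Pt) (hdet : det2 (c - a) (b - a) ≠ 0)
    (x₀ y₀ : ℝ) (hy₀ : y₀ < 0) (hd : d = a + x₀ • (c - a) + y₀ • (b - a))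
    (hab : segment ℝ a b ⊆ Q.body) (hbc : segment ℝ b c ⊆ Q.body)
    (hcd : segment ℝ c d ⊆ Q.body) (hda : segment ℝ d a ⊆ Q.body)
    (x y : ℝ) (hx : 0 < x) (hy : 0 < y) (hxy : x + y < 1) :
    a + x • (c - a) + y • (b - a) ∈ interior Q.body := by
  obtain ⟨X, Y, hX, hY, hq, hXY⟩ := coords a (c - a) (b - a) hdet
  set L : Pt → ℝ := fun q => Y q / y₀ with hLdef
  set M : Pt → ℝ := fun q => X q - L q * x₀ with hMdef
  have hL : Continuous L := hY.div_const _
  have hM : Continuous M := hX.sub (hL.mul continuous_const)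
  have hq' : ∀ q, q = a + M q • (c - a) + L q • (d - a) := by
    intro q
    have : Y q = L q * y₀ := by exact (div_mul_cancel₀ _ hy₀.ne).symm
    conv_lhs => rw [hq q, this]
    rw [hd]
    simp only [hMdef]
    module
  have open3 : ∀ U V : Pt → ℝ, Continuous U → Continuous V →
      IsOpen {q | 0 < U q ∧ 0 < V q ∧ U q + V q < 1} := fun U V hU hV =>
    (isOpen_lt continuous_const hU).inter
      ((isOpen_lt continuous_const hV).inter (isOpen_lt (hU.add hV) continuous_const))
  have closed3 : ∀ U V : Pt → ℝ, Continuous U → Continuous V →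
      IsClosed {q | 0 ≤ U q ∧ 0 ≤ V q ∧ U q + V q ≤ 1} := fun U V hU hV =>
    (isClosed_le continuous_const hU).inter
      ((isClosed_le continuous_const hV).inter (isClosed_le (hU.add hV) continuous_const))
  have sub3 : ∀ U V : Pt → ℝ, {q | 0 < U q ∧ 0 < V q ∧ U q + V q < 1} ⊆
      {q | 0 ≤ U q ∧ 0 ≤ V q ∧ U q + V q ≤ 1} := fun U V q h => ⟨h.1.le, h.2.1.le, h.2.2.le⟩
  set T1 : Set Pt := {q | 0 ≤ X q ∧ 0 ≤ Y q ∧ X q + Y q ≤ 1} with hT1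
  set T2 : Set Pt := {q | 0 ≤ M q ∧ 0 ≤ L q ∧ M q + L q ≤ 1} with hT2
  -- a diagonal point strictly between `a` and `c` is interior
  have hdiag : ∀ q, Y q = 0 → 0 < X q → X q < 1 → q ∈ interior (T1 ∪ T2) := by
    intro q hY0 h1 h2
    have hL0 : L q = 0 := by simp [hLdef, hY0]
    have hM0 : M q = X q := by simp [hMdef, hL0]
    have hO : IsOpen {p | 0 < X p ∧ X p + Y p < 1 ∧ 0 < M p ∧ M p + L p < 1} :=
      (isOpen_lt continuous_const hX).inter
        ((isOpen_lt (hX.add hY) continuous_const).inter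
          ((isOpen_lt continuous_const hM).inter (isOpen_lt (hM.add hL) continuous_const)))
    refine interior_maximal ?_ hO ⟨h1, by linarith, by linarith, by linarith⟩
    rintro p ⟨p1, p2, p3, p4⟩
    rcases le_total 0 (Y p) with h | h
    · exact Or.inl ⟨p1.le, h, p2.le⟩
    · exact Or.inr ⟨p3.le, div_nonneg_of_nonpos h hy₀.le, p4.le⟩
  have hK : T1 ∪ T2 ⊆ Q.body := by
    apply Q.fill
    · exact (closed3 X Y hX hY).union (closed3 M L hM hL)
    · refine Bornology.IsBounded.union ?_ ?_
      · apply bdd_aux a (c - a) (b - a)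
        rintro q ⟨h1, h2, h3⟩
        exact ⟨X q, Y q, h1, by linarith, h2, by linarith, hq q⟩
      · apply bdd_aux a (c - a) (d - a)
        rintro q ⟨h1, h2, h3⟩
        exact ⟨M q, L q, h1, by linarith, h2, by linarith, hq' q⟩
    · rintro q (⟨h1, h2, h3⟩ | ⟨h1, h2, h3⟩) hqb
      · have g1 : 0 < X q := by
          refine lt_of_le_of_ne h1 ?_
          intro h
          apply hqb; apply hab
          refine mem_seg a b q (Y q) h2 (by linarith) ?_
          conv_lhs => rw [hq q, ← h]
          module
        have g3 : X q + Y q < 1 := by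
          refine lt_of_le_of_ne h3 ?_
          intro h
          apply hqb; apply hbc
          refine mem_seg b c q (X q) h1 (by linarith) ?_
          have : Y q = 1 - X q := by linarith
          conv_lhs => rw [hq q, this]
          module
        rcases h2.eq_or_lt with h | h
        · exact hdiag q h.symm g1 (by linarith)
        · exact interior_maximal ((sub3 X Y).trans subset_union_left) (open3 X Y hX hY)
            ⟨g1, h, g3⟩
      · have g1 : 0 < M q := by
          refine lt_of_le_of_ne h1 ?_
          intro h
          apply hqb; apply hda
          rw [segment_symm]
          refine mem_seg a d q (L q) h2 (by linarith) ?_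
          conv_lhs => rw [hq' q, ← h]
          module
        have g3 : M q + L q < 1 := by
          refine lt_of_le_of_ne h3 ?_
          intro h
          apply hqb; apply hcd
          refine mem_seg c d q (L q) h2 (by linarith) ?_
          have : M q = 1 - L q := by linarith
          conv_lhs => rw [hq' q, this]
          module
        rcases h2.eq_or_lt with h | h
        · have hM0 : M q = X q := by simp [hMdef, ← h]
          have hY0 : Y q = 0 := by
            have h' : Y q / y₀ = 0 := h.symm
            rcases div_eq_zero_iff.1 h' with h'' | h''
            · exact h''
            · exact absurd h'' hy₀.ne
          exact hdiag q hY0 (by linarith) (by linarith)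
        · exact interior_maximal ((sub3 M L).trans subset_union_right) (open3 M L hM hL)
            ⟨g1, h, g3⟩
  apply interior_maximal (((sub3 X Y).trans subset_union_left).trans hK) (open3 X Y hX hY)
  obtain ⟨e1, e2⟩ := hXY x y
  simp only [mem_ofPred_eq, e1, e2]
  exact ⟨hx, hy, hxy⟩

lemma sees_iff (Q : SimplePolygon) (s t : Pt) :
    Q.Sees s t ↔ ∀ l : ℝ, 0 < l → l < 1 → s + l • (t - s) ∈ interior Q.body := by
  unfold Sees
  rw [openSegment_eq_image']
  constructor
  · intro h l h0 h1
    exact h ⟨l, ⟨h0, h1⟩, rfl⟩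
  · rintro h _ ⟨l, ⟨h0, h1⟩, rfl⟩
    exact h l h0 h1

lemma cone_bdry (Q : SimplePolygon) (s : Pt) :
    ∃ r > 0, ∀ p ∈ ball s r, p ∈ Q.bdry → segment ℝ s p ⊆ Q.bdry := by
  have h : ∀ᶠ p in 𝓝 s, ∀ i, p ∈ Q.edge i → segment ℝ s p ⊆ Q.edge i := by
    rw [eventually_all]
    intro i
    by_cases hs : s ∈ Q.edge i
    · exact Eventually.of_forall fun p hp => (convex_segment _ _).segment_subset hs hp
    · have hc : IsClosed (Q.edge i) := by
        have : IsCompact (Q.edge i) := by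
          unfold edge
          rw [segment_eq_image']
          exact isCompact_Icc.image (by fun_prop)
        exact this.isClosed
      filter_upwards [hc.isOpen_compl.mem_nhds hs] with p hp hp'
      exact absurd hp' hp
  obtain ⟨r, hr, h⟩ := Metric.eventually_nhds_iff_ball.1 h
  refine ⟨r, hr, fun p hp hpb => ?_⟩
  obtain ⟨i, hi⟩ := mem_iUnion.1 hpb
  exact (h p hp i hi).trans (subset_iUnion _ i)

lemma mem_ball_shrink (s p : Pt) (r l : ℝ) (hp : p ∈ ball s r) (h0 : 0 ≤ l) (h1 : l ≤ 1) :
    s + l • (p - s) ∈ ball s r := by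
  rw [mem_ball_iff_norm] at *
  rw [add_sub_cancel_left, norm_smul, Real.norm_of_nonneg h0]
  nlinarith [norm_nonneg (p - s)]

lemma cone_body (Q : SimplePolygon) (s : Pt) :
    ∃ r > 0, ∀ p ∈ ball s r, p ∈ Q.body → ∀ l : ℝ, 0 < l → l ≤ 1 →
      s + l • (p - s) ∈ Q.body := by
  obtain ⟨r, hr, h⟩ := Q.cone_bdry s
  refine ⟨r, hr, fun p hp hpb l h0 h1 => ?_⟩
  by_cases hq : s + l • (p - s) ∈ Q.bdry
  · exact Or.inl hq
  have hav : segment ℝ (s + l • (p - s)) p ⊆ Q.bdryᶜ := by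
    intro m hm hmb
    rw [segment_eq_image'] at hm
    obtain ⟨k, ⟨hk0, hk1⟩, rfl⟩ := hm
    set μ : ℝ := l + k * (1 - l) with hμ
    have hμl : l ≤ μ := by nlinarith
    have hμ1 : μ ≤ 1 := by nlinarith
    have hμ0 : 0 < μ := by linarith
    have e : s + l • (p - s) + k • (p - (s + l • (p - s))) = s + μ • (p - s) := by
      rw [hμ]; module
    simp only [e] at hmb
    apply hq
    apply h _ (mem_ball_shrink s p r μ hp hμ0.le hμ1) hmb
    refine mem_seg _ _ _ (l / μ) (by positivity) (by rw [div_le_one hμ0]; exact hμl) ?_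
    rw [add_sub_cancel_left, smul_smul, div_mul_cancel₀ _ hμ0.ne']
  have hpB : p ∉ Q.bdry := hav (right_mem_segment _ _ _)
  rcases hpb with hpb | ⟨_, hpb⟩
  · exact absurd hpb hpB
  refine Or.inr ⟨hq, ?_⟩
  have hmem : s + l • (p - s) ∈ connectedComponentIn Q.bdryᶜ p :=
    ((convex_segment _ _).isPreconnected.subset_connectedComponentIn
      (right_mem_segment _ _ _) hav) (left_mem_segment _ _ _)
  rw [← connectedComponentIn_eq hmem]
  exact hpb

lemma cone_interior (Q : SimplePolygon) (s : Pt) :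
    ∃ r > 0, ∀ p ∈ ball s r, p ∈ interior Q.body → ∀ l : ℝ, 0 < l → l ≤ 1 →
      s + l • (p - s) ∈ interior Q.body := by
  obtain ⟨r, hr, h⟩ := Q.cone_body s
  refine ⟨r, hr, fun p hp hpb l h0 h1 => ?_⟩
  have hO : IsOpen ((fun q : Pt => s + l⁻¹ • (q - s)) ⁻¹' (interior Q.body ∩ ball s r)) :=
    (isOpen_interior.inter isOpen_ball).preimage (by fun_prop)
  refine interior_maximal ?_ hO ?_
  · rintro q ⟨hq1, hq2⟩
    have := h _ hq2 (interior_subset hq1) l h0 h1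
    rwa [add_sub_cancel_left, smul_smul, mul_inv_cancel₀ h0.ne', one_smul,
      add_sub_cancel] at this
  · have e : s + l⁻¹ • (s + l • (p - s) - s) = p := by
      rw [add_sub_cancel_left, smul_smul, inv_mul_cancel₀ h0.ne', one_smul, add_sub_cancel]
    simp only [mem_preimage, e]
    exact ⟨hpb, hp⟩

/-- Visibility from `s` is stable near an interior point. -/
lemma sees_nhds (Q : SimplePolygon) (s z : Pt) (hz : z ∈ interior Q.body) (hs : Q.Sees s z) :
    ∀ᶠ p in 𝓝 z, ∀ l : ℝ, 0 < l → l ≤ 1 → s + l • (p - s) ∈ interior Q.body := by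
  rw [sees_iff] at hs
  obtain ⟨r, hr, h⟩ := Q.cone_interior s
  have hη : ∃ η : ℝ, 0 < η ∧ η < 1 ∧ s + η • (z - s) ∈ ball s r := by
    have hc : Tendsto (fun η : ℝ => s + η • (z - s)) (𝓝[>] 0) (𝓝 s) := by
      have : Continuous (fun η : ℝ => s + η • (z - s)) := by fun_prop
      have h := this.tendsto 0
      simp only [zero_smul, add_zero] at h
      exact h.mono_left nhdsWithin_le_nhds
    have h1 := hc.eventually (ball_mem_nhds s hr)
    have h2 : ∀ᶠ η : ℝ in 𝓝[>] 0, η ∈ Ioo (0:ℝ) 1 := Ioo_mem_nhdsGT one_pos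
    obtain ⟨η, a, b⟩ := (h1.and h2).exists
    exact ⟨η, b.1, b.2, a⟩
  obtain ⟨η, hη0, hη1, hηb⟩ := hη
  have hnear : ∀ᶠ p in 𝓝 z, s + η • (p - s) ∈ interior Q.body ∩ ball s r := by
    have hcont : Continuous (fun p : Pt => s + η • (p - s)) := by fun_prop
    exact hcont.continuousAt.eventually
      ((isOpen_interior.inter isOpen_ball).mem_nhds ⟨hs η hη0 hη1, hηb⟩)
  have hfar : ∀ᶠ p in 𝓝 z, ∀ l ∈ Icc η 1, s + l • (p - s) ∈ interior Q.body := by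
    apply isCompact_Icc.eventually_forall_of_forall_eventually
    rintro l ⟨hl0, hl1⟩
    have hcont : Continuous (fun p : Pt × ℝ => s + p.2 • (p.1 - s)) := by fun_prop
    refine hcont.continuousAt.eventually (isOpen_interior.mem_nhds ?_)
    simp only
    rcases hl1.eq_or_lt with e | e
    · rw [e, one_smul, add_sub_cancel]; exact hz
    · exact hs l (by linarith) e
  filter_upwards [hnear, hfar] with p h1 h2 l hl0 hl1
  rcases le_total η l with hl | hl
  · exact h2 l ⟨hl, hl1⟩
  · have := h _ h1.2 h1.1 (l / η) (by positivity) (by rw [div_le_one hη0]; exact hl)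
    rwa [add_sub_cancel_left, smul_smul, div_mul_cancel₀ _ hη0.ne'] at this

lemma Sees.seg {Q : SimplePolygon} {s t : Pt} (h : Q.Sees s t) (hs : s ∈ Q.body)
    (ht : t ∈ Q.body) : segment ℝ s t ⊆ Q.body := by
  rw [← insert_endpoints_openSegment]
  rintro q (rfl | rfl | hq)
  · exact hs
  · exact ht
  · exact interior_subset (h hq)

/-- The local claim. -/
lemma local_claim (Q : SimplePolygon) (t t₀ s s₀ : Pt)
    (htt : segment ℝ t t₀ ⊆ Q.body) (hss : segment ℝ s s₀ ⊆ Q.body)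
    (hdisj : ∀ q ∈ segment ℝ s s₀, q ∉ segment ℝ t t₀)
    (hs : Q.Sees s t) (hs₀ : Q.Sees s₀ t₀) :
    ∃ g, (g = s ∨ g = s₀) ∧ ∃ δ > 0, ∀ ε : ℝ, 0 < ε → ε < δ → Q.Sees g (t + ε • (t₀ - t)) := by
  have bs : s ∈ Q.body := hss (left_mem_segment _ _ _)
  have bs₀ : s₀ ∈ Q.body := hss (right_mem_segment _ _ _)
  have bt : t ∈ Q.body := htt (left_mem_segment _ _ _)
  have bt₀ : t₀ ∈ Q.body := htt (right_mem_segment _ _ _)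
  have hst := hs.seg bs bt
  have hst₀ := hs₀.seg bs₀ bt₀
  -- a point on the ray opposite to `t₀` which sees `t₀`
  have hback : ∀ X : ℝ, X < 0 → s₀ = t + X • (t₀ - t) →
      ∃ g, (g = s ∨ g = s₀) ∧
        ∃ δ > 0, ∀ ε : ℝ, 0 < ε → ε < δ → Q.Sees g (t + ε • (t₀ - t)) := by
    intro X hX e
    refine ⟨s₀, Or.inr rfl, 1, one_pos, fun ε h0 h1 => ?_⟩
    rw [sees_iff] at hs₀ ⊢
    intro l hl0 hl1
    have hd : 0 < 1 - X := by linarith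
    have hf : (ε - X) / (1 - X) < 1 := by rw [div_lt_one hd]; linarith
    have hf0 : 0 < (ε - X) / (1 - X) := div_pos (by linarith) hd
    have := hs₀ (l * ((ε - X) / (1 - X))) (by positivity) (by nlinarith)
    convert this using 1
    have e2 : t₀ - s₀ = (1 - X) • (t₀ - t) := by rw [e]; module
    have e3 : t + ε • (t₀ - t) - s₀ = (ε - X) • (t₀ - t) := by rw [e]; module
    rw [e2, e3, smul_smul, smul_smul]
    congr 2
    field_simp
  by_cases hne : t₀ = t
  · refine ⟨s, Or.inl rfl, 1, one_pos, fun ε _ _ => ?_⟩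
    rw [hne, sub_self, smul_zero, add_zero]; exact hs
  by_cases hdet : det2 (t₀ - t) (s - t) = 0
  · -- `s` on the line through `t, t₀`
    have hcol : ∀ q : Pt, det2 (t₀ - t) (q - t) = 0 → ∃ X : ℝ, q = t + X • (t₀ - t) := by
      intro q hq
      have hn : (t₀ 0 - t 0) * (t₀ 0 - t 0) + (t₀ 1 - t 1) * (t₀ 1 - t 1) ≠ 0 := by
        intro h
        apply hne
        have h0 : t₀ 0 - t 0 = 0 := by nlinarith [mul_self_nonneg (t₀ 0 - t 0), mul_self_nonneg (t₀ 1 - t 1)]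
        have h1 : t₀ 1 - t 1 = 0 := by nlinarith [mul_self_nonneg (t₀ 0 - t 0), mul_self_nonneg (t₀ 1 - t 1)]
        ext i
        fin_cases i
        · simpa using sub_eq_zero.1 h0
        · simpa using sub_eq_zero.1 h1
      simp only [det2, PiLp.sub_apply] at hq
      set X : ℝ := ((q 0 - t 0) * (t₀ 0 - t 0) + (q 1 - t 1) * (t₀ 1 - t 1)) /
        ((t₀ 0 - t 0) * (t₀ 0 - t 0) + (t₀ 1 - t 1) * (t₀ 1 - t 1)) with hXdef
      have hX : X * ((t₀ 0 - t 0) * (t₀ 0 - t 0) + (t₀ 1 - t 1) * (t₀ 1 - t 1)) =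
          ((q 0 - t 0) * (t₀ 0 - t 0) + (q 1 - t 1) * (t₀ 1 - t 1)) := div_mul_cancel₀ _ hn
      have i0 : q 0 = t 0 + X * (t₀ 0 - t 0) := by
        apply mul_right_cancel₀ hn
        linear_combination (-(t₀ 1 - t 1)) * hq - (t₀ 0 - t 0) * hX
      have i1 : q 1 = t 1 + X * (t₀ 1 - t 1) := by
        apply mul_right_cancel₀ hn
        linear_combination (t₀ 0 - t 0) * hq - (t₀ 1 - t 1) * hX
      refine ⟨X, ?_⟩
      ext i
      fin_cases i
      · exact i0
      · exact i1
    obtain ⟨X, hX⟩ := hcol s hdet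
    rcases lt_or_ge X 0 with hX0 | hX0
    · by_cases hdet0 : det2 (t₀ - t) (s₀ - t) = 0
      · obtain ⟨X', hX'⟩ := hcol s₀ hdet0
        rcases lt_or_ge X' 0 with hX0' | hX0'
        · exact hback X' hX0' hX'
        · exfalso
          refine hdisj t ?_ (left_mem_segment _ _ _)
          have hd : 0 < X' - X := by linarith
          refine mem_seg _ _ _ (-X / (X' - X)) (div_nonneg (by linarith) hd.le)
            (by rw [div_le_one hd]; linarith) ?_
          have e2 : s₀ - s = (X' - X) • (t₀ - t) := by rw [hX, hX']; module
          rw [e2, smul_smul, div_mul_cancel₀ _ hd.ne', hX]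
          module
      · refine ⟨s₀, Or.inr rfl, 1, one_pos, fun ε h0 h1 => ?_⟩
        have hd : 0 < 1 - X := by linarith
        have hedge : segment ℝ s t₀ ⊆ Q.body := by
          intro q hq
          rw [segment_eq_image'] at hq
          obtain ⟨k, ⟨hk0, hk1⟩, rfl⟩ := hq
          have e2 : t₀ - s = (1 - X) • (t₀ - t) := by rw [hX]; module
          have e4 : s + k • (t₀ - s) = t + (X + k * (1 - X)) • (t₀ - t) := by
            rw [e2]; conv_lhs => rw [hX]
            module
          simp only [e4]
          rcases le_total 0 (X + k * (1 - X)) with hh | hh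
          · apply htt
            exact mem_seg _ _ _ (X + k * (1 - X)) hh (by nlinarith) rfl
          · apply hst
            rw [segment_symm]
            refine mem_seg _ _ _ ((X + k * (1 - X)) / X) (div_nonneg_of_nonpos hh hX0.le) ?_ ?_
            · rw [div_le_one_of_neg hX0]; nlinarith
            · have e5 : s - t = X • (t₀ - t) := by rw [hX]; module
              rw [e5, smul_smul, div_mul_cancel₀ _ hX0.ne]
        have hdet' : det2 (t₀ - s) (s₀ - s) ≠ 0 := by
          have : det2 (t₀ - s) (s₀ - s) = (1 - X) * det2 (t₀ - t) (s₀ - t) := by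
            rw [hX]; simp [det2]; ring
          rw [this]
          exact mul_ne_zero hd.ne' hdet0
        rw [sees_iff]
        intro l hl0 hl1
        have hf : (ε - X) / (1 - X) < 1 := by rw [div_lt_one hd]; linarith
        have hf0 : 0 < (ε - X) / (1 - X) := div_pos (by linarith) hd
        have := Q.tri s s₀ t₀ hdet' hss hst₀ (by rw [segment_symm]; exact hedge)
          (l * ((ε - X) / (1 - X))) (1 - l) (by positivity) (by linarith) (by nlinarith)
        convert this using 1
        have e2 : t₀ - s = (1 - X) • (t₀ - t) := by rw [hX]; module
        rw [e2, smul_smul, mul_assoc, div_mul_cancel₀ _ hd.ne', hX]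
        module
    · have hX1 : 1 < X := by
        by_contra hX1
        push Not at hX1
        exact hdisj s (left_mem_segment _ _ _) (mem_seg _ _ _ X hX0 hX1 hX)
      refine ⟨s, Or.inl rfl, 1, one_pos, fun ε h0 h1 => ?_⟩
      rw [sees_iff] at hs ⊢
      intro l hl0 hl1
      have hXp : 0 < X := by linarith
      have hf : (X - ε) / X < 1 := by rw [div_lt_one hXp]; linarith
      have hf0 : 0 < (X - ε) / X := div_pos (by linarith) hXp
      have := hs (l * ((X - ε) / X)) (by positivity) (by nlinarith)
      convert this using 1
      have e2 : t - s = (-X) • (t₀ - t) := by rw [hX]; module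
      have e3 : t + ε • (t₀ - t) - s = (-(X - ε)) • (t₀ - t) := by rw [hX]; module
      rw [e2, e3, smul_smul, smul_smul]
      congr 2
      field_simp
  · -- general position
    obtain ⟨Xf, Yf, -, -, hq, -⟩ := coords t (t₀ - t) (s - t) hdet
    have hsc := hq s₀
    generalize Xf s₀ = X at hsc
    generalize Yf s₀ = Y at hsc
    by_cases hc1 : 1 < X + Y
    · refine ⟨s, Or.inl rfl, 1, one_pos, fun ε h0 h1 => ?_⟩
      have hdet' : det2 (s - t₀) (t - t₀) ≠ 0 := by
        have : det2 (s - t₀) (t - t₀) = det2 (t₀ - t) (s - t) := by simp [det2]; ring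
        rwa [this]
      rw [sees_iff]
      intro l hl0 hl1
      have := Q.quad t₀ t s s₀ hdet' Y (1 - X - Y) (by linarith) (by rw [hsc]; module)
        (by rw [segment_symm]; exact htt) (by rw [segment_symm]; exact hst) hss hst₀
        (1 - l) (l * (1 - ε)) (by linarith) (mul_pos hl0 (by linarith)) (by nlinarith)
      convert this using 1
      module
    push Not at hc1
    by_cases hc2 : 0 < X * Y
    · refine ⟨s₀, Or.inr rfl, 1, one_pos, fun ε h0 h1 => ?_⟩
      have hY : Y ≠ 0 := by rintro rfl; simp at hc2
      have hdet' : det2 (s₀ - t) (t₀ - t) ≠ 0 := by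
        have : det2 (s₀ - t) (t₀ - t) = (-Y) * det2 (t₀ - t) (s - t) := by
          rw [hsc]; simp [det2]; ring
        rw [this]
        exact mul_ne_zero (neg_ne_zero.2 hY) hdet
      have hneg : -X / Y < 0 := by
        have : -X / Y = - (X * Y) / (Y * Y) := by field_simp
        rw [this]
        exact div_neg_of_neg_of_pos (by linarith) (mul_self_pos.2 hY)
      rw [sees_iff]
      intro l hl0 hl1
      have := Q.quad t t₀ s₀ s hdet' (1 / Y) (-X / Y) hneg
        (by
          have e5 : s₀ - t = X • (t₀ - t) + Y • (s - t) := by rw [hsc]; module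
          rw [e5]
          have e6 : (1 / Y) * X + (-X / Y) = 0 := by ring
          have e7 : (1 / Y) * Y = 1 := by field_simp
          have : t + (1 / Y) • (X • (t₀ - t) + Y • (s - t)) + (-X / Y) • (t₀ - t)
            = t + ((1 / Y) * X + (-X / Y)) • (t₀ - t) + ((1 / Y) * Y) • (s - t) := by module
          rw [this, e6, e7]; module)
        htt (by rw [segment_symm]; exact hst₀) (by rw [segment_symm]; exact hss) hst
        (1 - l) (l * ε) (by linarith) (mul_pos hl0 h0) (by nlinarith)
      convert this using 1
      module
    push Not at hc2
    rcases lt_or_ge 0 Y with hY | hY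
    · have hX : X ≤ 0 := by
        by_contra h
        push Not at h
        have := mul_pos h hY
        linarith
      have hd : 0 < 1 - X := by linarith
      set ζ : ℝ := Y / (1 - X) with hζ
      have hζ0 : 0 < ζ := by positivity
      have hζ1 : ζ ≤ 1 := by rw [hζ, div_le_one hd]; linarith
      have hYζ : Y = ζ * (1 - X) := by rw [hζ]; field_simp
      set z : Pt := t + ζ • (s - t) with hz
      have hzt : z ∈ segment ℝ t s := mem_seg _ _ _ ζ hζ0.le hζ1 rfl
      have hzs : z ∈ segment ℝ t₀ s₀ := by
        refine mem_seg _ _ _ (1 / (1 - X)) (by positivity)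
          (by rw [div_le_one hd]; linarith) ?_
        have e5 : s₀ - t₀ = (1 - X) • (t + ζ • (s - t) - t₀) := by
          rw [hsc, hYζ]; module
        rw [e5, smul_smul, one_div, inv_mul_cancel₀ hd.ne', one_smul, hz]
        abel
      have hdet' : det2 (z - t) (t₀ - t) ≠ 0 := by
        have : det2 (z - t) (t₀ - t) = (-ζ) * det2 (t₀ - t) (s - t) := by
          rw [hz]; simp [det2]; ring
        rw [this]
        exact mul_ne_zero (neg_ne_zero.2 hζ0.ne') hdet
      have hT := Q.tri t t₀ z hdet' htt
        (((convex_segment _ _).segment_subset (left_mem_segment _ _ _) hzs).trans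
          (by rw [segment_symm]; exact hst₀))
        (((convex_segment _ _).segment_subset hzt (left_mem_segment _ _ _)).trans
          (by rw [segment_symm]; exact hst))
      rcases hζ1.eq_or_lt with h1 | h1
      · have hzs' : z = s := by rw [hz, h1]; module
        refine ⟨s, Or.inl rfl, 1, one_pos, fun ε h0 h1 => ?_⟩
        rw [sees_iff]
        intro l hl0 hl1
        have := hT (1 - l) (l * ε) (by linarith) (mul_pos hl0 h0) (by nlinarith)
        rw [hzs'] at this
        convert this using 1
        module
      · have hzi : z ∈ interior Q.body := by
          have := (Q.sees_iff s t).1 hs (1 - ζ) (by linarith) (by linarith)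
          convert this using 1
          rw [hz]; module
        have hsz : Q.Sees s z := by
          rw [sees_iff] at hs ⊢
          intro l hl0 hl1
          have := hs (l * (1 - ζ)) (mul_pos hl0 (by linarith)) (by nlinarith)
          convert this using 1
          rw [hz]; module
        have hN := Q.sees_nhds s z hzi hsz
        -- the crossing point of the two segments
        have hcont : ContinuousAt
            (fun ε : ℝ => z + (ε * (1 - ζ) / (1 - ε * ζ)) • (t₀ - z)) 0 := by
          have : ContinuousAt (fun ε : ℝ => ε * (1 - ζ) / (1 - ε * ζ)) 0 := by
            apply ContinuousAt.div
            · fun_prop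
            · fun_prop
            · simp
          fun_prop
        have hN' : ∀ᶠ ε : ℝ in 𝓝 0, ∀ l : ℝ, 0 < l → l ≤ 1 →
            s + l • (z + (ε * (1 - ζ) / (1 - ε * ζ)) • (t₀ - z) - s) ∈ interior Q.body := by
          refine hcont.eventually (p := fun p : Pt => ∀ l : ℝ, 0 < l → l ≤ 1 →
            s + l • (p - s) ∈ interior Q.body) ?_
          simpa using hN
        obtain ⟨δ, hδ, hball⟩ := Metric.eventually_nhds_iff_ball.1 hN'
        refine ⟨s, Or.inl rfl, min δ 1, lt_min hδ one_pos, fun ε h0 hε => ?_⟩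
        have hεδ : ε < δ := lt_of_lt_of_le hε (min_le_left _ _)
        have hε1 : ε < 1 := lt_of_lt_of_le hε (min_le_right _ _)
        have hsee := hball ε (by rw [mem_ball, Real.dist_eq, sub_zero, abs_of_pos h0]; exact hεδ)
        have hden : 0 < 1 - ε * ζ := by nlinarith
        set α : ℝ := (1 - ζ) / (1 - ε * ζ) with hα
        have hα0 : 0 < α := div_pos (by linarith) hden
        have hα1 : α < 1 := by rw [hα, div_lt_one hden]; nlinarith
        have hαe : α * (1 - ε * ζ) = 1 - ζ := div_mul_cancel₀ _ hden.ne'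
        have hβ : ε * (1 - ζ) / (1 - ε * ζ) = α * ε := by rw [hα]; ring
        rw [hβ] at hsee
        have hcz : z + (α * ε) • (t₀ - z) - s = α • (t + ε • (t₀ - t) - s) := by
          have : z + (α * ε) • (t₀ - z) - s - α • (t + ε • (t₀ - t) - s)
              = (α * (1 - ε * ζ) - (1 - ζ)) • (s - t) := by
            rw [hz]; module
          rw [hαe, sub_self, zero_smul] at this
          exact sub_eq_zero.1 this
        rw [hcz] at hsee
        rw [sees_iff]
        intro l hl0 hl1
        rcases le_or_gt l α with hl | hl
        · have := hsee (l / α) (by positivity) (by rw [div_le_one hα0]; exact hl)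
          rwa [smul_smul, div_mul_cancel₀ _ hα0.ne'] at this
        · have := hT ((1 - l) / ζ) (l * ε) (div_pos (by linarith) hζ0) (mul_pos hl0 h0)
            (by
              rw [← sub_pos]
              have : 1 - ((1 - l) / ζ + l * ε) = (l * (1 - ε * ζ) - (1 - ζ)) / ζ := by
                field_simp; ring
              rw [this]
              apply div_pos _ hζ0
              have := mul_lt_mul_of_pos_right hl hden
              linarith)
          convert this using 1
          have : z - t = ζ • (s - t) := by rw [hz]; module
          rw [this, smul_smul, div_mul_cancel₀ _ hζ0.ne']
          module
    · have hd : 0 < 1 - Y := by linarith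
      have hX : X < 0 := by
        by_contra hX
        push Not at hX
        refine hdisj (t + (X / (1 - Y)) • (t₀ - t)) ?_ ?_
        · refine mem_seg _ _ _ (1 / (1 - Y)) (by positivity)
            (by rw [div_le_one hd]; linarith) ?_
          have e5 : s₀ - s = X • (t₀ - t) - (1 - Y) • (s - t) := by
            rw [hsc]; module
          rw [e5, smul_sub (1 / (1 - Y)), smul_smul, smul_smul, one_div, inv_mul_cancel₀ hd.ne',
            div_eq_inv_mul]
          module
        · exact mem_seg _ _ _ (X / (1 - Y)) (by positivity)
            (by rw [div_le_one hd]; linarith) rfl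
      have hY0 : Y = 0 := by
        by_contra h
        have := mul_pos_of_neg_of_neg hX (lt_of_le_of_ne hY h)
        linarith
      apply hback X hX
      rw [hsc, hY0]; module

end SimplePolygon

/-- If the source and target segments are disjoint and the target is weakly
visible from the source, a finite guard set on the source covers the target. -/
theorem stmt_1 (Q : SimplePolygon) (hcomp : IsCompact Q.body)
    (x y u v : Pt)
    (hxy : segment ℝ x y ⊆ Q.body) (huv : segment ℝ u v ⊆ Q.body)
    (hdisj : segment ℝ x y ∩ segment ℝ u v = ∅)
    (hweak : ∀ t ∈ segment ℝ u v, ∃ s ∈ segment ℝ x y, Q.Sees s t) :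
    ∃ S : Finset Pt, ↑S ⊆ segment ℝ x y ∧
      ∀ t ∈ segment ℝ u v, ∃ s ∈ S, Q.Sees s t := by
  classical
  have hf : ∀ τ ∈ Icc (0:ℝ) 1, u + τ • (v - u) ∈ segment ℝ u v := fun τ h =>
    SimplePolygon.mem_seg u v _ τ h.1 h.2 rfl
  have key : ∀ τ ∈ Icc (0:ℝ) 1, ∀ w ∈ segment ℝ u v, ∃ g ∈ segment ℝ x y, ∃ δ > 0,
      ∀ ε : ℝ, 0 < ε → ε < δ →
        Q.Sees g ((u + τ • (v - u)) + ε • (w - (u + τ • (v - u)))) := by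
    intro τ hτ w hw
    obtain ⟨s, hs, hst⟩ := hweak _ (hf τ hτ)
    obtain ⟨s₀, hs₀, hst₀⟩ := hweak w hw
    have h1 : segment ℝ s s₀ ⊆ segment ℝ x y := (convex_segment _ _).segment_subset hs hs₀
    have h2 : segment ℝ (u + τ • (v - u)) w ⊆ segment ℝ u v :=
      (convex_segment _ _).segment_subset (hf τ hτ) hw
    obtain ⟨g, hg, h⟩ := Q.local_claim (u + τ • (v - u)) w s s₀ (h2.trans huv) (h1.trans hxy)
      (fun q hq hq' => by
        have : q ∈ segment ℝ x y ∩ segment ℝ u v := ⟨h1 hq, h2 hq'⟩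
        rw [hdisj] at this
        exact this) hst hst₀
    refine ⟨g, ?_, h⟩
    rcases hg with rfl | rfl
    · exact hs
    · exact hs₀
  have hcompact : ∃ S : Finset Pt, ↑S ⊆ segment ℝ x y ∧
      ∀ τ ∈ Icc (0:ℝ) 1, ∃ s ∈ S, Q.Sees s (u + τ • (v - u)) := by
    refine IsCompact.induction_on (isCompact_Icc (a := (0:ℝ)) (b := 1))
      (p := fun A => ∃ S : Finset Pt, ↑S ⊆ segment ℝ x y ∧
        ∀ τ ∈ A, ∃ s ∈ S, Q.Sees s (u + τ • (v - u))) ?_ ?_ ?_ ?_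
    · exact ⟨∅, by simp, by simp⟩
    · rintro A B hAB ⟨S, hS, h⟩
      exact ⟨S, hS, fun τ hτ => h τ (hAB hτ)⟩
    · rintro A B ⟨S, hS, h⟩ ⟨S', hS', h'⟩
      refine ⟨S ∪ S', by simp [hS, hS'], ?_⟩
      rintro τ (hτ | hτ)
      · obtain ⟨s, a, b⟩ := h τ hτ
        exact ⟨s, Finset.mem_union_left _ a, b⟩
      · obtain ⟨s, a, b⟩ := h' τ hτ
        exact ⟨s, Finset.mem_union_right _ a, b⟩
    · intro τ hτ
      obtain ⟨s, hs, hst⟩ := hweak _ (hf τ hτ)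
      obtain ⟨g₁, hg₁, δ₁, hδ₁, h₁⟩ := key τ hτ v (right_mem_segment _ _ _)
      obtain ⟨g₂, hg₂, δ₂, hδ₂, h₂⟩ := key τ hτ u (left_mem_segment _ _ _)
      have hright : ∃ r > 0, ∀ τ' ∈ Icc (0:ℝ) 1, τ < τ' → τ' < τ + r →
          Q.Sees g₁ (u + τ' • (v - u)) := by
        rcases hτ.2.eq_or_lt with e | e
        · exact ⟨1, one_pos, fun τ' h h' _ => absurd h.2 (by rw [e] at h'; linarith)⟩
        · have hd : 0 < 1 - τ := by linarith
          refine ⟨δ₁ * (1 - τ), by positivity, fun τ' h h' h'' => ?_⟩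
          have := h₁ ((τ' - τ) / (1 - τ)) (div_pos (by linarith) hd)
            (by rw [div_lt_iff₀ hd]; linarith)
          have e2 : v - (u + τ • (v - u)) = (1 - τ) • (v - u) := by module
          rw [e2, smul_smul, div_mul_cancel₀ _ hd.ne'] at this
          convert this using 1
          module
      have hleft : ∃ r > 0, ∀ τ' ∈ Icc (0:ℝ) 1, τ' < τ → τ - r < τ' →
          Q.Sees g₂ (u + τ' • (v - u)) := by
        rcases hτ.1.eq_or_lt with e | e
        · exact ⟨1, one_pos, fun τ' h h' _ => absurd h.1 (by rw [← e] at h'; linarith)⟩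
        · refine ⟨δ₂ * τ, by positivity, fun τ' h h' h'' => ?_⟩
          have := h₂ ((τ - τ') / τ) (div_pos (by linarith) e)
            (by rw [div_lt_iff₀ e]; linarith)
          have e2 : u - (u + τ • (v - u)) = τ • (u - v) := by module
          rw [e2, smul_smul, div_mul_cancel₀ _ e.ne'] at this
          convert this using 1
          module
      obtain ⟨r₁, hr₁, k₁⟩ := hright
      obtain ⟨r₂, hr₂, k₂⟩ := hleft
      refine ⟨Icc 0 1 ∩ Ioo (τ - r₂) (τ + r₁), ?_, {s, g₁, g₂}, ?_, ?_⟩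
      · exact inter_mem_nhdsWithin _ (Ioo_mem_nhds (by linarith) (by linarith))
      · intro q hq
        simp only [Finset.coe_insert, Finset.coe_singleton, mem_insert_iff,
          mem_singleton_iff] at hq
        rcases hq with rfl | rfl | rfl <;> assumption
      · rintro τ' ⟨hI, ha, hb⟩
        rcases lt_trichotomy τ' τ with h | h | h
        · exact ⟨g₂, by simp, k₂ τ' hI h ha⟩
        · exact ⟨s, by simp, by rw [h]; exact hst⟩
        · exact ⟨g₁, by simp, k₁ τ' hI h hb⟩
  obtain ⟨S, hS, h⟩ := hcompact
  refine ⟨S, hS, fun t ht => ?_⟩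
  rw [segment_eq_image'] at ht
  obtain ⟨τ, hτ, rfl⟩ := ht
  exact h τ hτ
end
end

section
/- Let P be a simple polygon in ℝ² with segments [x,y] ⊆ P and [u,v] ⊆ P, u ≠ v, and let w > 0. Suppose that every point t of segment ℝ u v lies in some closed subsegment J = segment ℝ a b ⊆ segment ℝ u v with dist a b ≥ min w (dist u v) such that some single point p ∈ segment ℝ x y sees every point of J. Then there exists a finite set S ⊆ segment ℝ x y such that every point of segment ℝ u v is seen by some point of S and the cardinality of S is at most 2·(dist u v)/w + 2. -/
open scoped RealInnerProductSpace symmDiff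
open Metric Set MeasureTheory

noncomputable section

lemma opp_sides (x y z : ℝ) (h1 : ¬ (y ≤ z ∧ z ≤ x)) (h2 : ¬ (x ≤ z ∧ z ≤ y))
    (h3 : ¬ (z ≤ y ∧ y ≤ x)) (h4 : ¬ (x ≤ y ∧ y ≤ z)) :
    (y < x ∧ x < z) ∨ (z < x ∧ x < y) := by
  grind

/-- A finite irredundant-izable cover. -/
lemma cover_min {α : Type*} (T : Finset (α × Set ℝ)) (δ : ℝ)
    (ho : ∀ e ∈ T, e.2.OrdConnected) (hs : ∀ e ∈ T, e.2 ⊆ Icc 0 1)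
    (hv : ∀ e ∈ T, ENNReal.ofReal δ ≤ volume e.2)
    (hc : ∀ s ∈ Icc (0:ℝ) 1, ∃ e ∈ T, s ∈ e.2) :
    ∃ T' ⊆ T, (∀ s ∈ Icc (0:ℝ) 1, ∃ e ∈ T', s ∈ e.2) ∧ (T'.card : ℝ) * δ ≤ 2 := by
  classical
  induction T using Finset.strongInduction with
  | H T ih =>
    by_cases hred : ∃ e ∈ T, ∀ s ∈ Icc (0:ℝ) 1, ∃ e' ∈ T.erase e, s ∈ e'.2
    · obtain ⟨e, he, hcov⟩ := hred
      obtain ⟨T', h1, h2, h3⟩ := ih (T.erase e) (Finset.erase_ssubset he)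
        (fun e' he' => ho e' (Finset.mem_of_mem_erase he'))
        (fun e' he' => hs e' (Finset.mem_of_mem_erase he'))
        (fun e' he' => hv e' (Finset.mem_of_mem_erase he')) hcov
      exact ⟨T', h1.trans (Finset.erase_subset _ _), h2, h3⟩
    · push Not at hred
      refine ⟨T, subset_rfl, hc, ?_⟩
      have hpriv : ∀ e ∈ T, ∃ y ∈ e.2, ∀ e' ∈ T, e' ≠ e → y ∉ e'.2 := by
        intro e he
        obtain ⟨s, hs1, hs2⟩ := hred e he
        obtain ⟨e', he', hse⟩ := hc s hs1
        have : e' = e := by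
          by_contra hne
          exact hs2 e' (Finset.mem_erase.2 ⟨hne, he'⟩) hse
        subst this
        exact ⟨s, hse, fun e'' h'' hne => hs2 e'' (Finset.mem_erase.2 ⟨hne, h''⟩)⟩
      have hmult : ∀ x : ℝ, (T.filter (fun e => x ∈ e.2)).card ≤ 2 := by
        intro x
        by_contra hcon
        push Not at hcon
        obtain ⟨e1, e2, e3, h1, h2, h3, h12, h13, h23⟩ := Finset.two_lt_card_iff.1 hcon
        simp only [Finset.mem_filter] at h1 h2 h3
        obtain ⟨y1, hy1, hp1⟩ := hpriv e1 h1.1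
        obtain ⟨y2, hy2, hp2⟩ := hpriv e2 h2.1
        obtain ⟨y3, hy3, hp3⟩ := hpriv e3 h3.1
        have n12 := hp1 e2 h2.1 h12.symm
        have n13 := hp1 e3 h3.1 h13.symm
        have n21 := hp2 e1 h1.1 h12
        have n23 := hp2 e3 h3.1 h23.symm
        have n31 := hp3 e1 h1.1 h13
        have n32 := hp3 e2 h2.1 h23
        have key : ∀ (e : α × Set ℝ), e ∈ T → x ∈ e.2 → ∀ y ∈ e.2, ∀ z, z ∉ e.2 →
            ¬ (y ≤ z ∧ z ≤ x) ∧ ¬ (x ≤ z ∧ z ≤ y) := by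
          intro e he hx y hy z hz
          exact ⟨fun h => hz ((ho e he).out hy hx h), fun h => hz ((ho e he).out hx hy h)⟩
        have k12 := key e1 h1.1 h1.2 y1 hy1 y2 n21
        have k13 := key e1 h1.1 h1.2 y1 hy1 y3 n31
        have k21 := key e2 h2.1 h2.2 y2 hy2 y1 n12
        have k23 := key e2 h2.1 h2.2 y2 hy2 y3 n32
        have k31 := key e3 h3.1 h3.2 y3 hy3 y1 n13
        have k32 := key e3 h3.1 h3.2 y3 hy3 y2 n23
        have o12 := opp_sides x y1 y2 k12.1 k12.2 k21.1 k21.2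
        have o13 := opp_sides x y1 y3 k13.1 k13.2 k31.1 k31.2
        have o23 := opp_sides x y2 y3 k23.1 k23.2 k32.1 k32.2
        rcases o12 with a | a <;> rcases o13 with b | b <;> rcases o23 with c | c <;>
          linarith [a.1, a.2, b.1, b.2, c.1, c.2]
      have hmeas : ∀ e ∈ T, MeasurableSet e.2 := fun e he => (ho e he).measurableSet
      have hsum : ∑ e ∈ T, volume e.2 ≤ 2 := by
        calc ∑ e ∈ T, volume e.2
            = ∑ e ∈ T, ∫⁻ x, e.2.indicator (fun _ => (1:ENNReal)) x := by
              refine Finset.sum_congr rfl fun e he => ?_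
              rw [lintegral_indicator (hmeas e he)]; simp
          _ = ∫⁻ x, ∑ e ∈ T, e.2.indicator (fun _ => (1:ENNReal)) x := by
              rw [lintegral_finsetSum']
              intro e he
              exact (measurable_const.indicator (hmeas e he)).aemeasurable
          _ ≤ ∫⁻ x, (Icc (0:ℝ) 1).indicator (fun _ => (2:ENNReal)) x := by
              refine lintegral_mono fun x => ?_
              by_cases hx : x ∈ Icc (0:ℝ) 1
              · simp only [indicator_of_mem hx, Set.indicator_apply]
                rw [Finset.sum_ite, Finset.sum_const_zero, add_zero, Finset.sum_const]
                simp only [nsmul_eq_mul, mul_one]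
                exact_mod_cast hmult x
              · rw [Finset.sum_eq_zero]
                · exact zero_le
                · intro e he
                  exact indicator_of_notMem (fun h => hx (hs e he h)) _
          _ = 2 := by
              rw [lintegral_indicator measurableSet_Icc]; simp
      have h2 : (T.card : ENNReal) * ENNReal.ofReal δ ≤ 2 := by
        rw [← nsmul_eq_mul]
        exact (Finset.card_nsmul_le_sum _ _ _ hv).trans hsum
      rcases le_total δ 0 with hδ | hδ
      · nlinarith [(Nat.cast_nonneg T.card : (0:ℝ) ≤ T.card)]
      · have h3 : ENNReal.ofReal ((T.card : ℝ) * δ) ≤ ENNReal.ofReal 2 := by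
          rw [ENNReal.ofReal_mul (Nat.cast_nonneg _)]
          simpa using h2
        exact (ENNReal.ofReal_le_ofReal_iff (by norm_num)).1 h3

lemma cross_core (A B p q : ℝ × ℝ) (c s a : ℝ) (hcs : c < s) (hsa : s < a) (hp : p.2 ≠ 0)
    (hA : A.2 / p.2 ≤ 0) (hB : 1 < B.2 / p.2)
    (hq1 : q ∈ openSegment ℝ A B) (hq2 : q ∈ openSegment ℝ p (s, 0))
    (hρ : A.1 + (0 - A.2) / (B.2 - A.2) * (B.1 - A.1) ≤ c ∨
      a < A.1 + (0 - A.2) / (B.2 - A.2) * (B.1 - A.1)) :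
    ∃ q' ∈ openSegment ℝ A B, q' ∈ openSegment ℝ p (a, 0) := by
  obtain ⟨A1, A2⟩ := A
  obtain ⟨B1, B2⟩ := B
  obtain ⟨P, σ⟩ := p
  simp only at *
  obtain ⟨α, hα⟩ : ∃ α, α = A2 / σ := ⟨_, rfl⟩
  obtain ⟨β, hβ⟩ : ∃ β, β = B2 / σ := ⟨_, rfl⟩
  rw [← hα] at hA
  rw [← hβ] at hB
  have eA : A2 = σ * α := by rw [hα]; field_simp
  have eB : B2 = σ * β := by rw [hβ]; field_simp
  subst eA eB
  have hd : 0 < β - α := by linarith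
  obtain ⟨ρ, hρd⟩ : ∃ ρ, ρ = A1 + (0 - σ * α) / (σ * β - σ * α) * (B1 - A1) := ⟨_, rfl⟩
  rw [← hρd] at hρ
  obtain ⟨κ, hκ⟩ : ∃ κ, κ = (B1 - A1) / (β - α) := ⟨_, rfl⟩
  have e1 : B1 = A1 + κ * (β - α) := by rw [hκ]; field_simp; ring
  have e2 : A1 = ρ + κ * α := by
    have : (σ * β - σ * α) ≠ 0 := by
      rw [← mul_sub]; exact mul_ne_zero hp hd.ne'
    rw [hρd, hκ]
    rw [← mul_sub]
    field_simp
    ring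
  obtain ⟨x1, y1, hx1, hy1, hxy1, rfl⟩ := hq1
  obtain ⟨x2, y2, hx2, hy2, hxy2, heq⟩ := hq2
  simp only [Prod.smul_mk, smul_eq_mul, Prod.mk_add_mk, Prod.mk.injEq, mul_zero, add_zero] at heq
  obtain ⟨h1, h2⟩ := heq
  have h2' : x2 = x1 * α + y1 * β := by
    apply mul_left_cancel₀ hp; linarith
  -- root
  have hx2' : y2 = 1 - x2 := by linarith
  have hxi : x1 * A1 + y1 * B1 = ρ + κ * x2 := by
    rw [e1, e2, h2']
    have : x1 = 1 - y1 := by linarith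
    subst this; ring
  have hroot : ∃ t, 0 < t ∧ t < 1 ∧ ρ + κ * t = t * P + (1 - t) * a := by
    have hline : x2 * P + (1 - x2) * s = ρ + κ * x2 := by rw [← hxi, ← h1, hx2']
    -- g t = ρ - a + (κ - P + a) t
    have hg : (ρ - a) + (κ - P + a) * x2 < 0 := by nlinarith
    rcases hρ with h | h
    · have hs' : 0 < (ρ - a) + (κ - P + a) := by
        have : (s - ρ) * (1 - x2) = x2 * (ρ + κ - P) := by linarith
        have h3 : 0 < (s - ρ) * (1 - x2) := mul_pos (by linarith) (by linarith)
        rw [this] at h3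
        have := (mul_pos_iff_of_pos_left hx2).1 h3
        linarith
      have hk : 0 < κ - P + a := by nlinarith
      refine ⟨(a - ρ) / (κ - P + a), ?_, ?_, ?_⟩
      · exact div_pos (by linarith) hk
      · rw [div_lt_one hk]; linarith
      · field_simp; ring
    · have hk : κ - P + a < 0 := by nlinarith
      have hk' : 0 < -(κ - P + a) := by linarith
      have hk0 : -(κ - P + a) ≠ 0 := hk'.ne'
      refine ⟨(ρ - a) / (-(κ - P + a)), ?_, ?_, ?_⟩
      · exact div_pos (by linarith) hk'
      · rw [div_lt_one hk']; nlinarith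
      · have hk1 : κ - P + a ≠ 0 := hk.ne
        rw [div_neg]; field_simp; ring
  obtain ⟨t, ht0, ht1, ht⟩ := hroot
  refine ⟨(ρ + κ * t, σ * t), ?_, ?_⟩
  · refine ⟨(β - t) / (β - α), (t - α) / (β - α), div_pos (by linarith) hd,
      div_pos (by linarith) hd, by field_simp; ring, ?_⟩
    simp only [Prod.smul_mk, smul_eq_mul, Prod.mk_add_mk, Prod.mk.injEq]
    rw [e1, e2]
    constructor <;> field_simp <;> ring
  · refine ⟨t, 1 - t, ht0, by linarith, by ring, ?_⟩
    simp only [Prod.smul_mk, smul_eq_mul, Prod.mk_add_mk, Prod.mk.injEq]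
    exact ⟨ht.symm, by ring⟩

/-- Position where the line through `A` and `B` meets the horizontal axis. -/
def rhoAt (A B : ℝ × ℝ) : ℝ := A.1 + (0 - A.2) / (B.2 - A.2) * (B.1 - A.1)

lemma rhoAt_comm (A B : ℝ × ℝ) (h : A.2 ≠ B.2) : rhoAt A B = rhoAt B A := by
  unfold rhoAt
  have h1 : B.2 - A.2 ≠ 0 := sub_ne_zero.2 h.symm
  have h2 : A.2 - B.2 ≠ 0 := sub_ne_zero.2 h
  field_simp
  ring

lemma near_line {ι : Type*} (W : Set (ℝ × ℝ)) (A B : ι → ℝ × ℝ)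
    (hfr : frontier W ⊆ ⋃ i, segment ℝ (A i) (B i))
    (hconst : ∀ i, openSegment ℝ (A i) (B i) ⊆ W ∨ Disjoint (openSegment ℝ (A i) (B i)) W)
    (hW : IsOpen W)
    (p : ℝ × ℝ) (hp : p.2 ≠ 0) (c a : ℝ) (hca : c < a)
    (hA : ∀ i, (A i).2 = 0 ∨ |p.2| < |(A i).2|) (hB : ∀ i, (B i).2 = 0 ∨ |p.2| < |(B i).2|)
    (hρ : ∀ i, rhoAt (A i) (B i) ≤ c ∨ a < rhoAt (A i) (B i))
    (hsee : openSegment ℝ p (a, 0) ⊆ W) :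
    ∀ s, c < s → s < a → openSegment ℝ p (s, 0) ⊆ W := by
  have hdich : ∀ y : ℝ, (y = 0 ∨ |p.2| < |y|) → y / p.2 ≤ 0 ∨ 1 < y / p.2 := by
    rintro y (rfl | h)
    · simp
    · by_contra hcon
      push Not at hcon
      have : |y / p.2| ≤ 1 := abs_le.2 ⟨by linarith, hcon.2⟩
      rw [abs_div, div_le_one (abs_pos.2 hp)] at this
      linarith
  intro s hcs hsa
  by_contra hnot
  -- the connected region
  set R : Set (ℝ × ℝ) := ⋃ s ∈ Ioc c a, openSegment ℝ p (s, 0) with hR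
  have hRconn : IsPreconnected R := by
    have : R = (fun x : ℝ × ℝ => (1 - x.1) • p + x.1 • ((x.2, 0) : ℝ × ℝ)) ''
        (Ioo (0:ℝ) 1 ×ˢ Ioc c a) := by
      ext z
      simp only [hR, mem_iUnion, openSegment_eq_image, mem_image, Prod.exists, mem_prod]
      constructor
      · rintro ⟨s, hs, θ, hθ, rfl⟩; exact ⟨θ, s, ⟨hθ, hs⟩, rfl⟩
      · rintro ⟨θ, s, ⟨hθ, hs⟩, rfl⟩; exact ⟨s, hs, θ, hθ, rfl⟩
    rw [this]
    exact (isPreconnected_Ioo.prod isPreconnected_Ioc).image _ (by fun_prop)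
  obtain ⟨z, hz, hzW⟩ := Set.not_subset.1 hnot
  have hmidR : ∃ m ∈ R, m ∈ W := by
    refine ⟨(1/2 : ℝ) • p + (1/2 : ℝ) • ((a, 0) : ℝ × ℝ), ?_, hsee ?_⟩
    · simp only [hR, mem_iUnion]
      exact ⟨a, ⟨hca, le_rfl⟩, 1/2, 1/2, by norm_num, by norm_num, by norm_num, rfl⟩
    · exact ⟨1/2, 1/2, by norm_num, by norm_num, by norm_num, rfl⟩
  obtain ⟨m, hmR, hmW⟩ := hmidR
  have hzR : z ∈ R := by
    simp only [hR, mem_iUnion]; exact ⟨s, ⟨hcs, hsa.le⟩, hz⟩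
  obtain ⟨q, hqR, hqF⟩ : (R ∩ frontier W).Nonempty := by
    by_contra hempty
    rw [Set.not_nonempty_iff_eq_empty] at hempty
    have : R ⊆ W := by
      refine hRconn.subset_of_closure_inter_subset hW ⟨m, hmR, hmW⟩ ?_
      rintro y ⟨hy, hyR⟩
      by_contra hyW
      have : y ∈ R ∩ frontier W := ⟨hyR, by rw [hW.frontier_eq]; exact ⟨hy, hyW⟩⟩
      rw [hempty] at this; exact this
    exact hzW (this hzR)
  have hqW : q ∉ W := by rw [hW.frontier_eq] at hqF; exact hqF.2
  simp only [hR, mem_iUnion] at hqR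
  obtain ⟨s', hs', hqs⟩ := hqR
  have hs'a : s' < a := by
    rcases hs'.2.lt_or_eq with h | h
    · exact h
    · subst h; exact absurd (hsee hqs) hqW
  obtain ⟨i, hi⟩ := mem_iUnion.1 (hfr hqF)
  -- height of q
  have hq2 : ∃ t, 0 < t ∧ t < 1 ∧ q.2 = t * p.2 := by
    obtain ⟨x, y, hx, hy, hxy, rfl⟩ := hqs
    exact ⟨x, hx, by linarith, by simp⟩
  obtain ⟨t, ht0, ht1, hqt⟩ := hq2
  have hqt' : q.2 / p.2 = t := by rw [hqt]; field_simp
  have hdA := hdich _ (hA i)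
  have hdB := hdich _ (hB i)
  have hqA : q ≠ A i := by
    rintro rfl; rw [hqt'] at hdA; rcases hdA with h | h <;> linarith
  have hqB : q ≠ B i := by
    rintro rfl; rw [hqt'] at hdB; rcases hdB with h | h <;> linarith
  have hqo : q ∈ openSegment ℝ (A i) (B i) :=
    mem_openSegment_of_ne_left_right hqA.symm hqB.symm hi
  have hdis : Disjoint (openSegment ℝ (A i) (B i)) W := by
    rcases hconst i with h | h
    · exact absurd (h hqo) hqW
    · exact h
  have hcomb : ∃ x y : ℝ, 0 < x ∧ 0 < y ∧ x + y = 1 ∧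
      x * ((A i).2 / p.2) + y * ((B i).2 / p.2) = t := by
    obtain ⟨x, y, hx, hy, hxy, rfl⟩ := hqo
    refine ⟨x, y, hx, hy, hxy, ?_⟩
    rw [← hqt']; simp; ring
  obtain ⟨x, y, hx, hy, hxy, hxyt⟩ := hcomb
  have fin : ∃ q' ∈ openSegment ℝ (A i) (B i), q' ∈ openSegment ℝ p (a, 0) := by
    rcases hdA with h1 | h1 <;> rcases hdB with h2 | h2
    · nlinarith
    · exact cross_core _ _ p q c s' a hs'.1 hs'a hp h1 h2 hqo hqs (hρ i)
    · have hne : (A i).2 ≠ (B i).2 := by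
        intro h; rw [h] at h1; linarith
      rw [openSegment_symm] at hqo ⊢
      have := hρ i
      rw [rhoAt_comm _ _ hne] at this
      exact cross_core _ _ p q c s' a hs'.1 hs'a hp h2 h1 hqo hqs this
    · nlinarith
  obtain ⟨q', h1, h2⟩ := fin
  exact Set.disjoint_left.1 hdis h1 (hsee h2)

lemma body_closed_under_conn (Q : SimplePolygon) (H : Set Pt) (hH : IsPreconnected H)
    (hHB : H ⊆ Q.bdryᶜ) (hm : (H ∩ Q.body).Nonempty) : H ⊆ Q.body := by
  obtain ⟨z, hz, hzb⟩ := hm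
  intro z' hz'
  rcases hzb with h | h
  · exact absurd h (hHB hz)
  · refine Or.inr ⟨hHB hz', ?_⟩
    have : z' ∈ connectedComponentIn Q.bdryᶜ z := hH.subset_connectedComponentIn hz hHB hz'
    rw [← connectedComponentIn_eq this]
    exact h.2

lemma edge_closed (Q : SimplePolygon) (i : Fin Q.n) : IsClosed (Q.edge i) := by
  unfold SimplePolygon.edge
  rw [segment_eq_image_lineMap]
  exact (isCompact_Icc.image AffineMap.lineMap_continuous).isClosed

lemma bdry_closed (Q : SimplePolygon) : IsClosed Q.bdry :=
  isClosed_iUnion_of_finite (edge_closed Q)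

lemma frontier_sub (Q : SimplePolygon) (hcomp : IsCompact Q.body) :
    frontier (interior Q.body) ⊆ Q.bdry := by
  intro z hz
  have hz2 := frontier_interior_subset hz
  by_contra hzb
  rw [hcomp.isClosed.frontier_eq] at hz2
  rcases hz2.1 with h | h
  · exact hzb h
  · apply hz2.2
    have ho : IsOpen (connectedComponentIn Q.bdryᶜ z) :=
      (bdry_closed Q).isOpen_compl.connectedComponentIn
    refine mem_interior.2 ⟨_, ?_, ho, mem_connectedComponentIn hzb⟩
    refine body_closed_under_conn Q _ isPreconnected_connectedComponentIn
      (connectedComponentIn_subset _ _) ⟨z, mem_connectedComponentIn hzb, Or.inr h⟩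

lemma nxt_ne (Q : SimplePolygon) (i : Fin Q.n) : nxt i ≠ i := by
  intro h
  have h1 : (i.1 + 1) % Q.n = i.1 := congrArg Fin.val h
  have := i.2
  have := Q.hn
  rcases Nat.lt_or_ge (i.1 + 1) Q.n with h2 | h2
  · rw [Nat.mod_eq_of_lt h2] at h1; omega
  · have : i.1 + 1 = Q.n := by omega
    rw [this, Nat.mod_self] at h1; omega

lemma open_edge_notMem (Q : SimplePolygon) (i j : Fin Q.n) (hij : j ≠ i) (q : Pt)
    (hq : q ∈ openSegment ℝ (Q.v i) (Q.v (nxt i))) : q ∉ Q.edge j := by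
  intro hj
  have hne : Q.v i ≠ Q.v (nxt i) := fun h => nxt_ne Q i (Q.inj h).symm
  have hqe : q ∈ segment ℝ (Q.v i) (Q.v (nxt i)) := openSegment_subset_segment _ _ _ hq
  by_cases h1 : j = nxt i
  · subst h1
    have : q ∈ ({Q.v (nxt i)} : Set Pt) := by rw [← Q.adj i]; exact ⟨hqe, hj⟩
    rw [mem_singleton_iff] at this
    subst this
    exact hne (right_mem_openSegment_iff.1 hq)
  · by_cases h2 : i = nxt j
    · subst h2
      have : q ∈ ({Q.v (nxt j)} : Set Pt) := by rw [← Q.adj j]; exact ⟨hj, hqe⟩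
      rw [mem_singleton_iff] at this
      subst this
      exact hne (left_mem_openSegment_iff.1 hq)
    · have : q ∈ (∅ : Set Pt) := by rw [← Q.nonadj i j hij.symm h1 h2]; exact ⟨hqe, hj⟩
      exact this

lemma exists_normal (d : Pt) (hd : d ≠ 0) : ∃ m : Pt, m ≠ 0 ∧ ⟪m, d⟫ = 0 := by
  refine ⟨!₂[-(d 1), d 0], ?_, ?_⟩
  · intro h
    apply hd
    ext k
    have h0 := congrArg (fun z : Pt => z 0) h
    have h1 := congrArg (fun z : Pt => z 1) h
    simp at h0 h1
    fin_cases k <;> simp [h0, h1]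
  · simp [PiLp.inner_apply, Fin.sum_univ_two]; ring

lemma edge_const (Q : SimplePolygon) (hcomp : IsCompact Q.body) (i : Fin Q.n) :
    openSegment ℝ (Q.v i) (Q.v (nxt i)) ⊆ interior Q.body ∨
    Disjoint (openSegment ℝ (Q.v i) (Q.v (nxt i))) (interior Q.body) := by
  by_cases hdis : Disjoint (openSegment ℝ (Q.v i) (Q.v (nxt i))) (interior Q.body)
  · exact Or.inr hdis
  left
  set A := Q.v i with hA
  set B := Q.v (nxt i) with hB
  have hne : A ≠ B := fun h => nxt_ne Q i (Q.inj h).symm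
  obtain ⟨m, hm0, hmd⟩ := exists_normal (B - A) (sub_ne_zero.2 hne.symm)
  have hmm : 0 < ⟪m, m⟫ := real_inner_self_pos.2 hm0
  let f : Pt → ℝ := fun z => ⟪m, z - A⟫
  have hfl : ∀ θ : ℝ, f (AffineMap.lineMap A B θ) = 0 := by
    intro θ
    simp only [f, AffineMap.lineMap_apply, vsub_eq_sub, vadd_eq_add, add_sub_cancel_right,
      inner_smul_right, hmd, mul_zero]
  have hfadd : ∀ z (ε : ℝ), f (z + ε • m) = f z + ε * ⟪m, m⟫ := by
    intro z ε
    simp only [f]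
    rw [add_sub_right_comm, inner_add_right, inner_smul_right]
  have hfc : ∀ z z' (x y : ℝ), x + y = 1 → f (x • z + y • z') = x * f z + y * f z' := by
    intro z z' x y hxy
    simp only [f]
    have : x • z + y • z' - A = x • (z - A) + y • (z' - A) := by
      have : A = (x + y) • A := by rw [hxy, one_smul]
      nth_rewrite 1 [this]
      module
    rw [this, inner_add_right, inner_smul_right, inner_smul_right]
  have hsegf : ∀ z ∈ Q.edge i, f z = 0 := by
    intro z hz
    unfold SimplePolygon.edge at hz
    rw [segment_eq_image_lineMap] at hz
    obtain ⟨θ, -, rfl⟩ := hz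
    exact hfl θ
  rw [openSegment_eq_image_lineMap] at hdis ⊢
  set u : Set ℝ := Ioo 0 1 ∩ (AffineMap.lineMap A B) ⁻¹' interior Q.body with hu
  have hlc : Continuous (AffineMap.lineMap A B : ℝ → Pt) := AffineMap.lineMap_continuous
  have huo : IsOpen u := isOpen_Ioo.inter (isOpen_interior.preimage hlc)
  suffices h : Ioo (0:ℝ) 1 ⊆ u by
    rintro _ ⟨θ, hθ, rfl⟩
    exact (h hθ).2
  refine isPreconnected_Ioo.subset_of_closure_inter_subset huo ?_ ?_
  · obtain ⟨z, ⟨θ, hθ, rfl⟩, hz⟩ := Set.not_disjoint_iff.1 hdis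
    exact ⟨θ, hθ, hθ, hz⟩
  rintro θ ⟨hθc, hθ⟩
  refine ⟨hθ, ?_⟩
  set q : Pt := AffineMap.lineMap A B θ with hq
  have hqo : q ∈ openSegment ℝ A B := by
    rw [openSegment_eq_image_lineMap]; exact ⟨θ, hθ, rfl⟩
  -- other edges
  have hcl : IsClosed (⋃ j : {j : Fin Q.n // j ≠ i}, Q.edge j) :=
    isClosed_iUnion_of_finite fun j => edge_closed Q j
  have hqn : q ∈ (⋃ j : {j : Fin Q.n // j ≠ i}, Q.edge j)ᶜ := by
    simp only [mem_compl_iff, mem_iUnion, not_exists]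
    intro j
    exact open_edge_notMem Q i j j.2 q hqo
  obtain ⟨r, hr, hball⟩ := Metric.isOpen_iff.1 hcl.isOpen_compl q hqn
  have hUB : ∀ z ∈ ball q r, f z ≠ 0 → z ∈ Q.bdryᶜ := by
    intro z hz hfz hzb
    obtain ⟨j, hj⟩ := mem_iUnion.1 hzb
    by_cases hji : j = i
    · subst hji; exact hfz (hsegf z hj)
    · exact hball hz (mem_iUnion.2 ⟨⟨j, hji⟩, hj⟩)
  -- nearby good point
  obtain ⟨θ', hθ'1, hθ'2⟩ : ∃ θ' ∈ u, (AffineMap.lineMap A B θ' : Pt) ∈ ball q r := by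
    have : (AffineMap.lineMap A B : ℝ → Pt) ⁻¹' ball q r ∈ nhds θ :=
      hlc.continuousAt.preimage_mem_nhds (ball_mem_nhds q hr)
    obtain ⟨x, hx1, hx2⟩ := mem_closure_iff_nhds.1 hθc _ this
    exact ⟨x, hx2, hx1⟩
  set q' : Pt := AffineMap.lineMap A B θ' with hq'
  have hnear : ∀ᶠ ε : ℝ in nhds 0, q' + ε • m ∈ ball q r ∩ interior Q.body := by
    have ho : IsOpen (ball q r ∩ interior Q.body) := isOpen_ball.inter isOpen_interior
    have hc : Continuous (fun ε : ℝ => q' + ε • m) := by fun_prop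
    refine hc.continuousAt.preimage_mem_nhds (ho.mem_nhds ?_)
    simp only [zero_smul, add_zero]
    exact ⟨hθ'2, hθ'1.2⟩
  obtain ⟨ε0, hε0, hεb⟩ := Metric.eventually_nhds_iff.1 hnear
  have hside : ∀ τ : ℝ, τ = 1 ∨ τ = -1 → {z | z ∈ ball q r ∧ 0 < τ * f z} ⊆ Q.body := by
    intro τ hτ
    have hconv : Convex ℝ {z | z ∈ ball q r ∧ 0 < τ * f z} := by
      intro z hz z' hz' x y hx hy hxy
      refine ⟨convex_ball q r hz.1 hz'.1 hx hy hxy, ?_⟩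
      rw [hfc _ _ _ _ hxy]
      have h1 := hz.2
      have h2 := hz'.2
      have : τ * (x * f z + y * f z') = x * (τ * f z) + y * (τ * f z') := by ring
      rw [this]
      rcases hx.eq_or_lt with h | h
      · subst h
        have : y = 1 := by linarith
        subst this; linarith
      · have := mul_pos h h1
        have := mul_nonneg hy h2.le
        linarith
    refine body_closed_under_conn Q _ hconv.isPreconnected ?_ ?_
    · rintro z ⟨hz, hfz⟩
      refine hUB z hz ?_
      intro h; rw [h] at hfz; simp at hfz
    · have hb := @hεb (τ * (ε0 / 2)) (by
        rw [Real.dist_eq, sub_zero, abs_mul]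
        have : |τ| = 1 := by rcases hτ with rfl | rfl <;> simp
        rw [this, abs_of_pos (by linarith)]; linarith)
      refine ⟨_, ⟨hb.1, ?_⟩, interior_subset hb.2⟩
      rw [hfadd, hfl, zero_add]
      have : τ * (τ * (ε0 / 2) * ⟪m, m⟫) = (τ * τ) * (ε0 / 2 * ⟪m, m⟫) := by ring
      rw [this]
      have : τ * τ = 1 := by rcases hτ with rfl | rfl <;> simp
      rw [this, one_mul]
      positivity
  have hsub : ball q r ⊆ Q.body := by
    intro z hz
    by_cases hfz : f z = 0
    · have hc : Continuous (fun ε : ℝ => z + ε • m) := by fun_prop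
      have hev : ∀ᶠ ε : ℝ in nhdsWithin 0 (Ioi 0), z + ε • m ∈ Q.body := by
        have h1 : ∀ᶠ ε : ℝ in nhdsWithin 0 (Ioi 0), z + ε • m ∈ ball q r := by
          refine nhdsWithin_le_nhds (hc.continuousAt.preimage_mem_nhds (isOpen_ball.mem_nhds ?_))
          simpa using hz
        filter_upwards [h1, self_mem_nhdsWithin] with ε h2 h3
        refine hside 1 (Or.inl rfl) ⟨h2, ?_⟩
        rw [hfadd, hfz, zero_add, one_mul]
        exact mul_pos h3 hmm
      have hlim : Filter.Tendsto (fun ε : ℝ => z + ε • m) (nhdsWithin 0 (Ioi 0)) (nhds z) := by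
        have := (hc.tendsto 0).mono_left (nhdsWithin_le_nhds (s := Ioi (0:ℝ)))
        simpa using this
      exact hcomp.isClosed.mem_of_tendsto hlim hev
    · rcases lt_or_gt_of_ne hfz with h | h
      · exact hside (-1) (Or.inr rfl) ⟨hz, by linarith⟩
      · exact hside 1 (Or.inl rfl) ⟨hz, by linarith⟩
  exact mem_interior.2 ⟨_, hsub, isOpen_ball, mem_ball_self hr⟩

open Filter Topology in
/-- Limit argument: if the lift of heights is possible, the limit point sees the open interval. -/
lemma limit_sees (W : Set (ℝ × ℝ)) (p : ℕ → ℝ × ℝ) (a b : ℕ → ℝ) (ps : ℝ × ℝ) (c bs : ℝ)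
    (hp : Tendsto p atTop (𝓝 ps)) (ha : Tendsto a atTop (𝓝 c)) (hb : Tendsto b atTop (𝓝 bs))
    (hsee : ∀ n, ∀ s ∈ Icc (a n) (b n), openSegment ℝ (p n) (s, 0) ⊆ W)
    (hcase : ps.2 ≠ 0 ∨ (ps.2 = 0 ∧ ∃ᶠ n in atTop, (p n).2 = 0)) :
    ∀ s ∈ Ioo c bs, openSegment ℝ ps (s, 0) ⊆ W := by
  have hp1 : Tendsto (fun n => (p n).1) atTop (𝓝 ps.1) := (continuous_fst.tendsto _).comp hp
  have hp2 : Tendsto (fun n => (p n).2) atTop (𝓝 ps.2) := (continuous_snd.tendsto _).comp hp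
  rintro s ⟨hcs, hsb⟩ q ⟨x, y, hx, hy, hxy, rfl⟩
  -- a sequence of weights
  obtain ⟨r, hr, hrf⟩ : ∃ r : ℕ → ℝ, Tendsto r atTop (𝓝 x) ∧
      ∃ᶠ n in atTop, x * ps.2 = r n * (p n).2 := by
    rcases hcase with h | ⟨h, hf⟩
    · refine ⟨fun n => x * ps.2 / (p n).2, ?_, ?_⟩
      · have := (tendsto_const_nhds (x := x * ps.2)).div hp2 h
        rwa [mul_div_cancel_right₀ _ h] at this
      · have : ∀ᶠ n in atTop, (p n).2 ≠ 0 := hp2.eventually_ne h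
        refine Eventually.frequently ?_
        filter_upwards [this] with n hn
        field_simp
    · refine ⟨fun _ => x, tendsto_const_nhds, ?_⟩
      refine hf.mono fun n hn => ?_
      rw [hn, h]
  have hs : Tendsto (fun n => (x * ps.1 + y * s - r n * (p n).1) / (1 - r n)) atTop (𝓝 s) := by
    have h1 : Tendsto (fun n => (x * ps.1 + y * s - r n * (p n).1) / (1 - r n)) atTop
        (𝓝 ((x * ps.1 + y * s - x * ps.1) / (1 - x))) :=
      ((tendsto_const_nhds).sub (hr.mul hp1)).div (tendsto_const_nhds.sub hr) (by linarith)
    have h2 : (x * ps.1 + y * s - x * ps.1) / (1 - x) = s := by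
      have : 1 - x = y := by linarith
      rw [this]; field_simp; ring
    rwa [h2] at h1
  have e1 : ∀ᶠ n in atTop, 0 < r n := hr.eventually_const_lt hx
  have e2 : ∀ᶠ n in atTop, r n < 1 := hr.eventually_lt_const (by linarith)
  have e3 := ha.eventually_lt hs hcs
  have e4 := hs.eventually_lt hb hsb
  obtain ⟨n, hn, h1, h2, h3, h4⟩ := (hrf.and_eventually (e1.and (e2.and (e3.and e4)))).exists
  refine hsee n _ ⟨h3.le, h4.le⟩ ⟨r n, 1 - r n, h1, by linarith, by ring, ?_⟩
  have : 1 - r n ≠ 0 := by linarith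
  ext
  · simp; field_simp; ring
  · simp [hn]

open Filter Topology in
lemma right_lemma {ι : Type*} [Finite ι] (W : Set (ℝ × ℝ)) (A B : ι → ℝ × ℝ)
    (hfr : frontier W ⊆ ⋃ i, segment ℝ (A i) (B i))
    (hconst : ∀ i, openSegment ℝ (A i) (B i) ⊆ W ∨ Disjoint (openSegment ℝ (A i) (B i)) W)
    (hW : IsOpen W) (K : Set (ℝ × ℝ)) (hK : IsCompact K) (δ : ℝ) (hδ : 0 < δ)
    (hcov : ∀ t ∈ Icc (0:ℝ) 1, ∃ a b, 0 ≤ a ∧ b ≤ 1 ∧ a ≤ t ∧ t ≤ b ∧ δ ≤ b - a ∧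
      ∃ p ∈ K, ∀ s ∈ Icc a b, openSegment ℝ p (s, 0) ⊆ W)
    (c : ℝ) (hc0 : 0 ≤ c) (hc1 : c < 1) :
    ∃ p ∈ K, ∃ I : Set ℝ, I.OrdConnected ∧ I ⊆ Icc 0 1 ∧ ENNReal.ofReal δ ≤ volume I ∧
      (∀ s ∈ I, openSegment ℝ p (s, 0) ⊆ W) ∧ ∃ d > c, Ioo c d ⊆ I := by
  have htn : ∀ n : ℕ, c + (1 - c) / (n + 1) ∈ Icc (0:ℝ) 1 := by
    intro n
    have h1 : 0 < (1 - c) / (n + 1 : ℝ) := div_pos (by linarith) (by positivity)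
    have h2 : (1 - c) / (n + 1 : ℝ) ≤ 1 - c := by
      apply div_le_self (by linarith)
      have : (0:ℝ) ≤ n := Nat.cast_nonneg n
      linarith
    exact ⟨by linarith, by linarith⟩
  have htc : ∀ n : ℕ, c < c + (1 - c) / (n + 1) := by
    intro n
    have h1 : 0 < (1 - c) / (n + 1 : ℝ) := div_pos (by linarith) (by positivity)
    linarith
  choose a b ha0 hb1 hat htb hab p hpK hsee using fun n : ℕ => hcov _ (htn n)
  by_cases hex : ∃ n, a n ≤ c
  · obtain ⟨n, hn⟩ := hex
    refine ⟨p n, hpK n, Icc (a n) (b n), ordConnected_Icc, Icc_subset_Icc (ha0 n) (hb1 n), ?_,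
      hsee n, b n, (htc n).trans_le (htb n), ?_⟩
    · rw [Real.volume_Icc]; exact ENNReal.ofReal_le_ofReal (hab n)
    · intro s hs; exact ⟨hn.trans hs.1.le, hs.2.le⟩
  push Not at hex
  have hatend : Tendsto a atTop (𝓝 c) := by
    have h1 : Tendsto (fun n : ℕ => c + (1 - c) / ((n : ℝ) + 1)) atTop (𝓝 c) := by
      have h2 := (tendsto_one_div_add_atTop_nhds_zero_nat (𝕜 := ℝ)).const_mul (1 - c)
      have h3 := h2.const_add c
      simp only [mul_zero, add_zero, mul_one_div] at h3
      exact h3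
    exact tendsto_of_tendsto_of_tendsto_of_le_of_le tendsto_const_nhds h1
      (fun n => (hex n).le) hat
  obtain ⟨⟨ps, bs⟩, ⟨hps, hbs⟩, φ, hφ, hlim⟩ :=
    (hK.prod (isCompact_Icc (a := (0:ℝ)) (b := 1))).tendsto_subseq
      (x := fun n => (p n, b n))
      (fun n => ⟨hpK n, (ha0 n).trans ((hat n).trans (htb n)), hb1 n⟩)
  have hlp : Tendsto (fun n => p (φ n)) atTop (𝓝 ps) := (continuous_fst.tendsto _).comp hlim
  have hlb : Tendsto (fun n => b (φ n)) atTop (𝓝 bs) := (continuous_snd.tendsto _).comp hlim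
  have hla : Tendsto (fun n => a (φ n)) atTop (𝓝 c) := hatend.comp hφ.tendsto_atTop
  have hbc : δ ≤ bs - c := ge_of_tendsto' (hlb.sub hla) (fun n => hab _)
  by_cases hcase : ps.2 ≠ 0 ∨ (ps.2 = 0 ∧ ∃ᶠ n in atTop, (p (φ n)).2 = 0)
  · refine ⟨ps, hps, Ioo c bs, ordConnected_Ioo, ?_, ?_,
      limit_sees W _ _ _ ps c bs hlp hla hlb (fun n => hsee (φ n)) hcase, bs, by linarith, subset_rfl⟩
    · intro s hs; exact ⟨hc0.trans hs.1.le, hs.2.le.trans hbs.2⟩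
    · rw [Real.volume_Ioo]; exact ENNReal.ofReal_le_ofReal hbc
  push Not at hcase
  obtain ⟨h0, hne⟩ := hcase
  have hne := hne h0
  have hl2 : Tendsto (fun n => |(p (φ n)).2|) atTop (𝓝 0) := by
    have := ((continuous_snd.tendsto _).comp hlp).abs
    simpa [h0] using this
  have hev : ∀ y : ℝ, ∀ᶠ n in atTop, y = 0 ∨ |(p (φ n)).2| < |y| := by
    intro y
    by_cases hy : y = 0
    · exact Eventually.of_forall fun _ => Or.inl hy
    · filter_upwards [hl2.eventually_lt_const (abs_pos.2 hy)] with n hn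
      exact Or.inr hn
  have hev2 : ∀ ρ : ℝ, ∀ᶠ n in atTop, ρ ≤ c ∨ a (φ n) < ρ := by
    intro ρ
    rcases le_or_gt ρ c with h | h
    · exact Eventually.of_forall fun _ => Or.inl h
    · filter_upwards [hla.eventually_lt_const h] with n hn
      exact Or.inr hn
  have hA := eventually_all.2 fun i => hev (A i).2
  have hB := eventually_all.2 fun i => hev (B i).2
  have hρ := eventually_all.2 fun i => hev2 (rhoAt (A i) (B i))
  have hne' : ∀ᶠ n in atTop, (p (φ n)).2 ≠ 0 := by simpa [Filter.Frequently] using hne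
  obtain ⟨n, h1, h2, h3, h4⟩ := (hA.and (hB.and (hρ.and hne'))).exists
  have hab' : a (φ n) ≤ b (φ n) := (hat _).trans (htb _)
  have hnl := near_line W A B hfr hconst hW (p (φ n)) h4 c (a (φ n)) (hex _) h1 h2 h3
    (hsee _ _ ⟨le_rfl, hab'⟩)
  refine ⟨p (φ n), hpK _, Ioc c (b (φ n)), ordConnected_Ioc, ?_, ?_, ?_, b (φ n),
    (hex _).trans_le hab', Ioo_subset_Ioc_self⟩
  · intro s hs; exact ⟨hc0.trans hs.1.le, hs.2.trans (hb1 _)⟩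
  · rw [Real.volume_Ioc]
    exact ENNReal.ofReal_le_ofReal ((hab _).trans (by linarith [hex (φ n)]))
  · intro s hs
    rcases lt_or_ge s (a (φ n)) with h | h
    · exact hnl s hs.1 h
    · exact hsee _ s ⟨h, hs.2⟩

lemma pt_right (Q : SimplePolygon) (hcomp : IsCompact Q.body) (u v : Pt) (huv : u ≠ v)
    (K : Set Pt) (hK : IsCompact K) (δ : ℝ) (hδ : 0 < δ)
    (hcov : ∀ t ∈ Icc (0:ℝ) 1, ∃ a b, 0 ≤ a ∧ b ≤ 1 ∧ a ≤ t ∧ t ≤ b ∧ δ ≤ b - a ∧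
      ∃ p ∈ K, ∀ s ∈ Icc a b, Q.Sees p (AffineMap.lineMap u v s))
    (c : ℝ) (hc0 : 0 ≤ c) (hc1 : c < 1) :
    ∃ p ∈ K, ∃ I : Set ℝ, I.OrdConnected ∧ I ⊆ Icc 0 1 ∧ ENNReal.ofReal δ ≤ volume I ∧
      (∀ s ∈ I, Q.Sees p (AffineMap.lineMap u v s)) ∧ ∃ d > c, Ioo c d ⊆ I := by
  obtain ⟨m, hm0, hmd⟩ := exists_normal (v - u) (sub_ne_zero.2 huv.symm)
  let L : ℝ × ℝ →ₗ[ℝ] Pt :=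
    (LinearMap.fst ℝ ℝ ℝ).smulRight (v - u) + (LinearMap.snd ℝ ℝ ℝ).smulRight m
  have hLdef : ∀ z, L z = z.1 • (v - u) + z.2 • m := fun z => by simp [L]
  have hinj : Function.Injective L := by
    rw [injective_iff_map_eq_zero]
    intro z hz
    rw [hLdef] at hz
    have h2 : z.2 = 0 := by
      have h := congrArg (fun y => ⟪m, y⟫) hz
      simp only [inner_add_right, inner_smul_right, hmd, mul_zero, zero_add, inner_zero_right] at h
      exact (mul_eq_zero.1 h).resolve_right (real_inner_self_pos.2 hm0).ne'
    have h1 : z.1 = 0 := by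
      rw [h2, zero_smul, add_zero] at hz
      exact (smul_eq_zero.1 hz).resolve_right (sub_ne_zero.2 huv.symm)
    exact Prod.ext h1 h2
  let e : (ℝ × ℝ) ≃ₗ[ℝ] Pt := LinearEquiv.ofInjectiveOfFinrankEq L hinj (by simp)
  have he : ∀ z, e z = z.1 • (v - u) + z.2 • m := fun z => by
    rw [← hLdef]; rfl
  let G : (ℝ × ℝ) ≃ₜ Pt :=
    e.toContinuousLinearEquiv.toHomeomorph.trans (Homeomorph.addLeft u)
  have hG : ∀ z, G z = u + (z.1 • (v - u) + z.2 • m) := fun z => by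
    rw [← he]; rfl
  have hGs : ∀ s : ℝ, G (s, 0) = AffineMap.lineMap u v s := by
    intro s
    rw [hG, AffineMap.lineMap_apply]
    simp [add_comm]
  let g : (ℝ × ℝ) →ᵃ[ℝ] Pt := L.toAffineMap + AffineMap.const ℝ (ℝ × ℝ) u
  have hg : ∀ z, g z = G z := by
    intro z
    rw [hG, ← hLdef]; simp [g, add_comm]
  have hgG : (g : ℝ × ℝ → Pt) = G := funext hg
  have hopen : ∀ p q, G '' openSegment ℝ p q = openSegment ℝ (G p) (G q) := by
    intro p q
    rw [← hgG]; exact image_openSegment ℝ g p q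
  have hseg : ∀ p q, G '' segment ℝ p q = segment ℝ (G p) (G q) := by
    intro p q
    rw [← hgG]; exact image_segment ℝ g p q
  have hsees : ∀ p s, openSegment ℝ p ((s, 0) : ℝ × ℝ) ⊆ G ⁻¹' interior Q.body ↔
      Q.Sees (G p) (AffineMap.lineMap u v s) := by
    intro p s
    unfold SimplePolygon.Sees
    rw [← hGs, ← hopen, image_subset_iff]
  suffices main : ∃ p ∈ G ⁻¹' K, ∃ I : Set ℝ, I.OrdConnected ∧ I ⊆ Icc 0 1 ∧
      ENNReal.ofReal δ ≤ volume I ∧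
      (∀ s ∈ I, openSegment ℝ p ((s, 0) : ℝ × ℝ) ⊆ G ⁻¹' interior Q.body) ∧
      ∃ d > c, Ioo c d ⊆ I by
    obtain ⟨p, hp, I, h1, h2, h3, h4, h5⟩ := main
    exact ⟨G p, hp, I, h1, h2, h3, fun s hs => (hsees p s).1 (h4 s hs), h5⟩
  refine right_lemma (G ⁻¹' interior Q.body)
    (fun i : Fin Q.n => G.symm (Q.v i)) (fun i => G.symm (Q.v (nxt i))) ?_ ?_
    (isOpen_interior.preimage G.continuous) (G ⁻¹' K)
    (by rw [G.isCompact_preimage]; exact hK) δ hδ ?_ c hc0 hc1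
  · rw [← G.preimage_frontier]
    intro z hz
    obtain ⟨i, hi⟩ := mem_iUnion.1 (frontier_sub Q hcomp hz)
    refine mem_iUnion.2 ⟨i, ?_⟩
    unfold SimplePolygon.edge at hi
    have h := hseg (G.symm (Q.v i)) (G.symm (Q.v (nxt i)))
    rw [G.apply_symm_apply, G.apply_symm_apply] at h
    rw [← h] at hi
    obtain ⟨z', hz', hzz⟩ := hi
    exact G.injective hzz ▸ hz'
  · intro i
    have h := hopen (G.symm (Q.v i)) (G.symm (Q.v (nxt i)))
    rw [G.apply_symm_apply, G.apply_symm_apply] at h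
    rcases edge_const Q hcomp i with h' | h'
    · left
      rw [← image_subset_iff, h]; exact h'
    · right
      rw [Set.disjoint_left]
      intro z hz hzW
      refine Set.disjoint_left.1 h' ?_ hzW
      rw [← h]; exact mem_image_of_mem _ hz
  · intro t ht
    obtain ⟨a, b, h1, h2, h3, h4, h5, p, hp, hs⟩ := hcov t ht
    refine ⟨a, b, h1, h2, h3, h4, h5, G.symm p, ?_, fun s hs' => ?_⟩
    · simpa using hp
    · rw [hsees, G.apply_symm_apply]; exact hs s hs'

/-- A guard together with an interval of parameters it sees. -/
def GoodPair (Q : SimplePolygon) (K : Set Pt) (u v : Pt) (δ : ℝ) (e : Pt × Set ℝ) : Prop :=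
  e.1 ∈ K ∧ e.2.OrdConnected ∧ e.2 ⊆ Icc 0 1 ∧ ENNReal.ofReal δ ≤ volume e.2 ∧
    ∀ s ∈ e.2, Q.Sees e.1 (AffineMap.lineMap u v s)

lemma good_right (Q : SimplePolygon) (hcomp : IsCompact Q.body) (u v : Pt) (huv : u ≠ v)
    (K : Set Pt) (hK : IsCompact K) (δ : ℝ) (hδ : 0 < δ)
    (hcov : ∀ t ∈ Icc (0:ℝ) 1, ∃ a b, 0 ≤ a ∧ b ≤ 1 ∧ a ≤ t ∧ t ≤ b ∧ δ ≤ b - a ∧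
      ∃ p ∈ K, ∀ s ∈ Icc a b, Q.Sees p (AffineMap.lineMap u v s))
    (c : ℝ) (hc0 : 0 ≤ c) (hc1 : c ≤ 1) :
    ∃ T : Finset (Pt × Set ℝ), (∀ e ∈ T, GoodPair Q K u v δ e) ∧
      ∃ d > c, ∀ s ∈ Ioo c d ∩ Icc 0 1, ∃ e ∈ T, s ∈ e.2 := by
  rcases hc1.lt_or_eq with h | h
  · obtain ⟨p, hp, I, h1, h2, h3, h4, d, hd, h5⟩ :=
      pt_right Q hcomp u v huv K hK δ hδ hcov c hc0 h
    refine ⟨{(p, I)}, ?_, d, hd, fun s hs => ⟨(p, I), by simp, h5 hs.1⟩⟩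
    intro e he
    rw [Finset.mem_singleton] at he
    subst he
    exact ⟨hp, h1, h2, h3, h4⟩
  · refine ⟨∅, by simp, c + 1, by linarith, fun s hs => ?_⟩
    exact absurd hs.2.2 (by linarith [hs.1.1])

lemma good_left (Q : SimplePolygon) (hcomp : IsCompact Q.body) (u v : Pt) (huv : u ≠ v)
    (K : Set Pt) (hK : IsCompact K) (δ : ℝ) (hδ : 0 < δ)
    (hcov : ∀ t ∈ Icc (0:ℝ) 1, ∃ a b, 0 ≤ a ∧ b ≤ 1 ∧ a ≤ t ∧ t ≤ b ∧ δ ≤ b - a ∧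
      ∃ p ∈ K, ∀ s ∈ Icc a b, Q.Sees p (AffineMap.lineMap u v s))
    (c : ℝ) (hc0 : 0 ≤ c) (hc1 : c ≤ 1) :
    ∃ T : Finset (Pt × Set ℝ), (∀ e ∈ T, GoodPair Q K u v δ e) ∧
      ∃ d < c, ∀ s ∈ Ioo d c ∩ Icc 0 1, ∃ e ∈ T, s ∈ e.2 := by
  classical
  have hrev : ∀ s : ℝ, (AffineMap.lineMap v u (1 - s) : Pt) = AffineMap.lineMap u v s := by
    intro s; rw [AffineMap.lineMap_apply_one_sub]
  obtain ⟨T, hT, d, hd, hcv⟩ := good_right Q hcomp v u huv.symm K hK δ hδ (by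
    intro t ht
    obtain ⟨a, b, h1, h2, h3, h4, h5, p, hp, hs⟩ := hcov (1 - t) ⟨by linarith [ht.2], by linarith [ht.1]⟩
    refine ⟨1 - b, 1 - a, by linarith, by linarith, by linarith, by linarith, by linarith, p, hp, ?_⟩
    intro s hs'
    have := hs (1 - s) ⟨by linarith [hs'.2], by linarith [hs'.1]⟩
    rwa [AffineMap.lineMap_apply_one_sub] at this) (1 - c) (by linarith) (by linarith)
  refine ⟨T.image (fun e => (e.1, (fun s : ℝ => 1 - s) ⁻¹' e.2)), ?_, 1 - d, by linarith, ?_⟩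
  · intro e he
    obtain ⟨e', he', rfl⟩ := Finset.mem_image.1 he
    obtain ⟨h1, h2, h3, h4, h5⟩ := hT e' he'
    refine ⟨h1, ?_, ?_, ?_, ?_⟩
    · constructor
      intro x hx y hy z hz
      exact h2.out hy hx ⟨by linarith [hz.2], by linarith [hz.1]⟩
    · intro s hs
      have := h3 hs
      exact ⟨by linarith [this.2], by linarith [this.1]⟩
    · have := (Measure.measurePreserving_sub_left (volume : Measure ℝ) 1).measure_preimage
        h2.measurableSet.nullMeasurableSet
      simp only
      rw [this]; exact h4
    · intro s hs
      have := h5 _ hs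
      rwa [hrev] at this
  · intro s hs
    obtain ⟨e, he, hse⟩ := hcv (1 - s) ⟨⟨by linarith [hs.1.2], by linarith [hs.1.1]⟩,
      by linarith [hs.2.2], by linarith [hs.2.1]⟩
    exact ⟨_, Finset.mem_image_of_mem _ he, hse⟩

lemma param_cover (Q : SimplePolygon) (hcomp : IsCompact Q.body) (u v : Pt) (huv : u ≠ v)
    (K : Set Pt) (hK : IsCompact K) (δ : ℝ) (hδ : 0 < δ)
    (hcov : ∀ t ∈ Icc (0:ℝ) 1, ∃ a b, 0 ≤ a ∧ b ≤ 1 ∧ a ≤ t ∧ t ≤ b ∧ δ ≤ b - a ∧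
      ∃ p ∈ K, ∀ s ∈ Icc a b, Q.Sees p (AffineMap.lineMap u v s)) :
    ∃ T : Finset (Pt × Set ℝ), (∀ e ∈ T, GoodPair Q K u v δ e) ∧
      ∀ s ∈ Icc (0:ℝ) 1, ∃ e ∈ T, s ∈ e.2 := by
  classical
  refine (isCompact_Icc (a := (0:ℝ)) (b := 1)).induction_on
    (p := fun S => ∃ T : Finset (Pt × Set ℝ), (∀ e ∈ T, GoodPair Q K u v δ e) ∧
      ∀ s ∈ S, ∃ e ∈ T, s ∈ e.2) ?_ ?_ ?_ ?_
  · exact ⟨∅, by simp, by simp⟩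
  · rintro S S' hSS ⟨T, h1, h2⟩
    exact ⟨T, h1, fun s hs => h2 s (hSS hs)⟩
  · rintro S S' ⟨T, h1, h2⟩ ⟨T', h1', h2'⟩
    refine ⟨T ∪ T', ?_, ?_⟩
    · intro e he
      rcases Finset.mem_union.1 he with h | h
      · exact h1 e h
      · exact h1' e h
    · rintro s (hs | hs)
      · obtain ⟨e, he, h⟩ := h2 s hs
        exact ⟨e, Finset.mem_union_left _ he, h⟩
      · obtain ⟨e, he, h⟩ := h2' s hs
        exact ⟨e, Finset.mem_union_right _ he, h⟩
  · intro c hc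
    obtain ⟨T1, hT1, d1, hd1, hc1⟩ := good_right Q hcomp u v huv K hK δ hδ hcov c hc.1 hc.2
    obtain ⟨T2, hT2, d2, hd2, hc2⟩ := good_left Q hcomp u v huv K hK δ hδ hcov c hc.1 hc.2
    obtain ⟨a, b, h1, h2, h3, h4, h5, p, hp, hs⟩ := hcov c hc
    refine ⟨Icc 0 1 ∩ Ioo d2 d1, ?_, T1 ∪ T2 ∪ {(p, Icc a b)}, ?_, ?_⟩
    · exact inter_mem_nhdsWithin _ (Ioo_mem_nhds hd2 hd1)
    · intro e he
      simp only [Finset.mem_union, Finset.mem_singleton] at he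
      rcases he with (h | h) | h
      · exact hT1 e h
      · exact hT2 e h
      · subst h
        refine ⟨hp, ordConnected_Icc, Icc_subset_Icc h1 h2, ?_, hs⟩
        simp only [Real.volume_Icc]; exact ENNReal.ofReal_le_ofReal h5
    · rintro s ⟨hs01, hsd⟩
      rcases lt_trichotomy s c with h | h | h
      · obtain ⟨e, he, hse⟩ := hc2 s ⟨⟨hsd.1, h⟩, hs01⟩
        exact ⟨e, by simp [he], hse⟩
      · subst h
        exact ⟨(p, Icc a b), by simp, h3, h4⟩
      · obtain ⟨e, he, hse⟩ := hc1 s ⟨⟨h, hsd.2⟩, hs01⟩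
        exact ⟨e, by simp [he], hse⟩

/-- If every target point lies in a closed subsegment of length at least
`min w (dist u v)` entirely seen by a single source point, then a finite guard set of
size at most `2·(dist u v)/w + 2` exists. -/
theorem stmt_2 (Q : SimplePolygon) (hcomp : IsCompact Q.body)
    (x y u v : Pt) (huv : u ≠ v) (w : ℝ) (hw : 0 < w)
    (hxy : segment ℝ x y ⊆ Q.body) (huvP : segment ℝ u v ⊆ Q.body)
    (hcov : ∀ t ∈ segment ℝ u v, ∃ a b : Pt,
      a ∈ segment ℝ u v ∧ b ∈ segment ℝ u v ∧ t ∈ segment ℝ a b ∧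
      min w (dist u v) ≤ dist a b ∧
      ∃ p ∈ segment ℝ x y, ∀ z ∈ segment ℝ a b, Q.Sees p z) :
    ∃ S : Finset Pt, ↑S ⊆ segment ℝ x y ∧
      (∀ t ∈ segment ℝ u v, ∃ s ∈ S, Q.Sees s t) ∧
      (S.card : ℝ) ≤ 2 * dist u v / w + 2 := by
  classical
  have hL : 0 < dist u v := dist_pos.2 huv
  set D := dist u v with hD
  have hmin : 0 < min w D := lt_min hw hL
  set δ := min w D / D with hδ
  have hδ0 : 0 < δ := div_pos hmin hL
  have hK : IsCompact (segment ℝ x y) := by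
    rw [segment_eq_image_lineMap]
    exact isCompact_Icc.image AffineMap.lineMap_continuous
  have hcov' : ∀ t ∈ Icc (0:ℝ) 1, ∃ a b, 0 ≤ a ∧ b ≤ 1 ∧ a ≤ t ∧ t ≤ b ∧ δ ≤ b - a ∧
      ∃ p ∈ segment ℝ x y, ∀ s ∈ Icc a b, Q.Sees p (AffineMap.lineMap u v s) := by
    intro t ht
    obtain ⟨a, b, ha, hb, htab, hd, p, hp, hs⟩ := hcov (AffineMap.lineMap u v t) (by
      rw [segment_eq_image_lineMap]; exact mem_image_of_mem _ ht)
    rw [segment_eq_image_lineMap] at ha hb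
    obtain ⟨α, hα, rfl⟩ := ha
    obtain ⟨β, hβ, rfl⟩ := hb
    have hinj : Function.Injective (AffineMap.lineMap u v : ℝ → Pt) :=
      AffineMap.lineMap_injective ℝ huv
    have himg : ∀ α β : ℝ, segment ℝ (AffineMap.lineMap u v α : Pt) (AffineMap.lineMap u v β) =
        (AffineMap.lineMap u v : ℝ → Pt) '' segment ℝ α β := fun α β =>
      (image_segment ℝ (AffineMap.lineMap u v : ℝ →ᵃ[ℝ] Pt) α β).symm
    rw [himg] at htab hs
    have htα : t ∈ segment ℝ α β := by
      obtain ⟨t', ht', h⟩ := htab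
      exact hinj h ▸ ht'
    rw [dist_lineMap_lineMap, Real.dist_eq] at hd
    have hd' : δ ≤ |α - β| := by rw [hδ, div_le_iff₀ hL]; exact hd
    rw [segment_eq_uIcc] at htα hs
    refine ⟨min α β, max α β, le_min hα.1 hβ.1, max_le hα.2 hβ.2, htα.1, htα.2, ?_, p, hp, ?_⟩
    · rw [max_sub_min_eq_abs']; exact hd'
    · intro s hs'
      exact hs _ (mem_image_of_mem _ hs')
  obtain ⟨T, hT, hTc⟩ := param_cover Q hcomp u v huv _ hK δ hδ0 hcov'
  obtain ⟨T', hT'T, hT'c, hcard⟩ := cover_min T δ (fun e he => (hT e he).2.1)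
    (fun e he => (hT e he).2.2.1) (fun e he => (hT e he).2.2.2.1) hTc
  refine ⟨T'.image Prod.fst, ?_, ?_, ?_⟩
  · intro p hp
    obtain ⟨e, he, rfl⟩ := Finset.mem_image.1 (Finset.mem_coe.1 hp)
    exact (hT e (hT'T he)).1
  · intro t ht
    rw [segment_eq_image_lineMap] at ht
    obtain ⟨s, hs, rfl⟩ := ht
    obtain ⟨e, he, hse⟩ := hT'c s hs
    exact ⟨e.1, Finset.mem_image_of_mem _ he, (hT e (hT'T he)).2.2.2.2 s hse⟩
  · have h1 : ((T'.image Prod.fst).card : ℝ) ≤ T'.card := by exact_mod_cast Finset.card_image_le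
    refine h1.trans ?_
    have h2 : (T'.card : ℝ) ≤ 2 / δ := by rwa [le_div_iff₀ hδ0]
    refine h2.trans ?_
    rcases le_total w D with h | h
    · rw [hδ, min_eq_left h, div_div_eq_mul_div]; linarith
    · rw [hδ, min_eq_right h, div_self hL.ne']
      have : 0 ≤ 2 * D / w := by positivity
      linarith
end
end

section
/- Let P be a simple polygon in ℝ² and let u, v ∈ P with segment ℝ u v ⊆ P. Then dist u v ≤ LW(P). -/
open scoped RealInnerProductSpace symmDiff
open Metric Set MeasureTheory

noncomputable section

/-- The plane as the complex numbers. -/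
def toC : Pt ≃ₗᵢ[ℝ] ℂ := Complex.orthonormalBasisOneI.repr.symm

/-- Angle under which the segment from `a` to `b` is seen from `z`. -/
def ang (a b z : Pt) : ℝ := (toC (b - z) / toC (a - z)).arg

lemma ratio_slit {a b z : Pt} (h : z ∉ segment ℝ a b) :
    toC (b - z) / toC (a - z) ∈ Complex.slitPlane := by
  by_contra hs
  apply h
  rw [Complex.mem_slitPlane_iff] at hs
  push Not at hs
  obtain ⟨h1, h2⟩ := hs
  by_cases ha : a = z
  · subst ha; exact left_mem_segment ℝ a b
  have hne : toC (a - z) ≠ 0 := by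
    simpa [sub_eq_zero] using ha
  set r := toC (b - z) / toC (a - z) with hr
  have hr' : r = (r.re : ℂ) := by
    apply Complex.ext <;> simp [h2]
  have h3 : toC (b - z) = r.re • toC (a - z) := by
    rw [Complex.real_smul, ← hr', hr]; field_simp
  rw [← map_smul] at h3
  have h4 : b - z = r.re • (a - z) := toC.injective h3
  have hpos : 0 < 1 - r.re := by linarith
  refine ⟨-r.re / (1 - r.re), 1 / (1 - r.re), by apply div_nonneg <;> linarith, by positivity, ?_, ?_⟩
  · field_simp; ring
  · have h5 : b = z + r.re • (a - z) := by rw [← h4]; abel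
    rw [h5]
    match_scalars
    · field_simp; ring
    · field_simp; ring

lemma continuousAt_ratio {a b z : Pt} (h : z ≠ a) :
    ContinuousAt (fun z => toC (b - z) / toC (a - z)) z := by
  apply ContinuousAt.div
  · exact (toC.continuous.comp (continuous_const.sub continuous_id)).continuousAt
  · exact (toC.continuous.comp (continuous_const.sub continuous_id)).continuousAt
  · simpa [sub_eq_zero] using h.symm

lemma continuousAt_ang {a b z : Pt} (h : z ∉ segment ℝ a b) : ContinuousAt (ang a b) z := by
  have hza : z ≠ a := by
    rintro rfl; exact h (left_mem_segment ℝ _ _)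
  exact ContinuousAt.comp (f := fun z => toC (b - z) / toC (a - z)) (g := Complex.arg)
    (Complex.continuousAt_arg (ratio_slit h)) (continuousAt_ratio hza)

lemma ang_tendsto (a b : Pt) : Filter.Tendsto (ang a b) (Bornology.cobounded Pt) (nhds 0) := by
  have h1 : Filter.Tendsto (fun z : Pt => toC (a - z)) (Bornology.cobounded Pt)
      (Bornology.cobounded ℂ) :=
    (toC.antilipschitz.tendsto_cobounded).comp (tendsto_const_sub_cobounded a)
  have h2 := (Filter.tendsto_inv₀_cobounded.comp h1).const_mul (toC (b - a))
  have h3 := h2.const_add 1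
  simp only [mul_zero, add_zero] at h3
  have h4 := (Complex.continuousAt_arg (x := 1) (by simp)).tendsto.comp h3
  simp only [Complex.arg_one] at h4
  refine h4.congr' ?_
  have : ∀ᶠ z in Bornology.cobounded Pt, toC (a - z) ≠ 0 :=
    h1.eventually (Bornology.isBounded_def.mp (Bornology.isBounded_singleton (x := (0:ℂ))))
  filter_upwards [this] with z hz
  simp only [Function.comp, ang]
  congr 1
  have : toC (b - z) = toC (b - a) + toC (a - z) := by rw [← map_add]; congr 1; abel
  rw [this]; field_simp; ring

/-- Jump of the angle across the segment, positively oriented case. -/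
lemma ang_jump {w a b : Pt} {δ : ℝ} (h0 : 0 < δ) (h1 : δ < 1) (ha : a ≠ 0)
    (hb : 0 < (toC b / toC a).im) :
    Filter.Tendsto (fun τ : ℝ => ang w (w + a) (w + δ • a + τ • b)) (nhdsWithin 0 (Ioi 0))
      (nhds Real.pi) ∧
    Filter.Tendsto (fun τ : ℝ => ang w (w + a) (w + δ • a + τ • b)) (nhdsWithin 0 (Iio 0))
      (nhds (-Real.pi)) := by
  set β := toC b / toC a with hβ
  have hane : toC a ≠ 0 := by simpa using ha
  have hD : ∀ τ : ℝ, (-(δ:ℂ) - τ * β) ≠ 0 := by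
    intro τ h
    have him := congrArg Complex.im h
    have hre := congrArg Complex.re h
    simp at him hre
    rcases him with h | h
    · subst h; simp at hre; linarith
    · linarith
  have hrat : ∀ τ : ℝ, ang w (w + a) (w + δ • a + τ • b) =
      ((((1 - δ : ℝ) : ℂ) - τ * β) / (-(δ:ℂ) - τ * β)).arg := by
    intro τ
    unfold ang
    congr 1
    have e1 : w + a - (w + δ • a + τ • b) = (1 - δ) • a - τ • b := by module
    have e2 : w - (w + δ • a + τ • b) = (-δ) • a - τ • b := by module
    have hβ' : toC b = β * toC a := by rw [hβ]; field_simp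
    rw [e1, e2, map_sub, map_sub, map_smul, map_smul, map_smul, hβ']
    simp only [Complex.real_smul]
    rw [show ((1 - δ : ℝ) : ℂ) * toC a - τ * (β * toC a) = (((1 - δ : ℝ) : ℂ) - τ * β) * toC a by ring,
      show ((-δ : ℝ) : ℂ) * toC a - τ * (β * toC a) = (-(δ:ℂ) - τ * β) * toC a by push_cast; ring]
    rw [mul_div_mul_right _ _ hane]
  simp only [hrat]
  set f : ℝ → ℂ := fun τ => (((1 - δ : ℝ) : ℂ) - τ * β) / (-(δ:ℂ) - τ * β) with hf
  have hcont : ContinuousAt f 0 := by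
    apply ContinuousAt.div
    · fun_prop
    · fun_prop
    · exact hD 0
  have hf0 : f 0 = (((1 - δ) / (-δ) : ℝ) : ℂ) := by simp [hf]
  have hf0re : (f 0).re < 0 := by
    rw [hf0, Complex.ofReal_re]; apply div_neg_of_pos_of_neg <;> linarith
  have hf0im : (f 0).im = 0 := by rw [hf0, Complex.ofReal_im]
  have him : ∀ τ : ℝ, (f τ).im = τ * β.im / Complex.normSq (-(δ:ℂ) - τ * β) := by
    intro τ
    simp only [hf, Complex.div_im]
    have := Complex.normSq_pos.mpr (hD τ)
    field_simp
    simp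
    ring
  constructor
  · refine (Complex.tendsto_arg_nhdsWithin_im_nonneg_of_re_neg_of_im_zero hf0re hf0im).comp
      (tendsto_nhdsWithin_iff.mpr ⟨hcont.tendsto.mono_left nhdsWithin_le_nhds, ?_⟩)
    filter_upwards [self_mem_nhdsWithin] with τ hτ
    have hτ' : 0 < τ := hτ
    have := Complex.normSq_pos.mpr (hD τ)
    show 0 ≤ (f τ).im
    rw [him]; positivity
  · refine (Complex.tendsto_arg_nhdsWithin_im_neg_of_re_neg_of_im_zero hf0re hf0im).comp
      (tendsto_nhdsWithin_iff.mpr ⟨hcont.tendsto.mono_left nhdsWithin_le_nhds, ?_⟩)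
    filter_upwards [self_mem_nhdsWithin] with τ hτ
    have hτ' : τ < 0 := hτ
    have := Complex.normSq_pos.mpr (hD τ)
    show (f τ).im < 0
    rw [him]
    exact div_neg_of_neg_of_pos (mul_neg_of_neg_of_pos hτ' hb) this

lemma nxt_inj {n : ℕ} : Function.Injective (nxt : Fin n → Fin n) := by
  intro i j h
  have h' := congrArg Fin.val h
  simp only [nxt] at h'
  have hi := i.2
  have hj := j.2
  apply Fin.ext
  have := Nat.ModEq.add_right_cancel' 1 (show i.1 + 1 ≡ j.1 + 1 [MOD n] from h')
  rwa [Nat.ModEq, Nat.mod_eq_of_lt hi, Nat.mod_eq_of_lt hj] at this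

lemma nxt_bij {n : ℕ} : Function.Bijective (nxt : Fin n → Fin n) :=
  Finite.injective_iff_bijective.mp nxt_inj

lemma nxt_ne_s11 {n : ℕ} (hn : 3 ≤ n) (i : Fin n) : nxt i ≠ i := by
  intro h
  have h' := congrArg Fin.val h
  simp only [nxt] at h'
  have hi := i.2
  rcases Nat.lt_or_ge (i.1 + 1) n with h1 | h1
  · rw [Nat.mod_eq_of_lt h1] at h'; omega
  · rw [show i.1 + 1 = n by omega, Nat.mod_self] at h'; omega

namespace SimplePolygon

variable (Q : SimplePolygon)

/-- Total angle of the polygon seen from `z`. -/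
def wind (z : Pt) : ℝ := ∑ i, ang (Q.v i) (Q.v (nxt i)) z

lemma not_mem_edge {z : Pt} (hz : z ∉ Q.bdry) (i : Fin Q.n) :
    z ∉ segment ℝ (Q.v i) (Q.v (nxt i)) := by
  intro h; exact hz (mem_iUnion.mpr ⟨i, h⟩)

lemma wind_continuousOn : ContinuousOn Q.wind Q.bdryᶜ := by
  intro z hz
  apply ContinuousAt.continuousWithinAt
  unfold wind
  exact tendsto_finsetSum _ fun i _ => continuousAt_ang (Q.not_mem_edge hz i)

lemma wind_int {z : Pt} (hz : z ∉ Q.bdry) : ∃ k : ℤ, k • (2 * Real.pi) = Q.wind z := by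
  rw [← Real.Angle.coe_eq_zero_iff]
  have hne : ∀ i, toC (Q.v i - z) ≠ 0 := by
    intro i h
    have : Q.v i = z := by simpa [sub_eq_zero] using h
    exact Q.not_mem_edge hz i (this ▸ left_mem_segment ℝ _ _)
  have : ((Q.wind z : ℝ) : Real.Angle) = ∑ i, ((ang (Q.v i) (Q.v (nxt i)) z : ℝ) : Real.Angle) :=
    map_sum Real.Angle.coeHom _ _
  rw [this]
  have h2 : ∀ i, ((ang (Q.v i) (Q.v (nxt i)) z : ℝ) : Real.Angle) =
      ((toC (Q.v (nxt i) - z)).arg : Real.Angle) - ((toC (Q.v i - z)).arg : Real.Angle) :=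
    fun i => Complex.arg_div_coe_angle (hne _) (hne _)
  simp only [h2, Finset.sum_sub_distrib]
  rw [sub_eq_zero]
  exact nxt_bij.sum_comp (fun i => ((toC (Q.v i - z)).arg : Real.Angle))

lemma wind_tendsto : Filter.Tendsto Q.wind (Bornology.cobounded Pt) (nhds 0) := by
  have := tendsto_finsetSum (Finset.univ : Finset (Fin Q.n))
    fun i _ => ang_tendsto (Q.v i) (Q.v (nxt i))
  simp only [Finset.sum_const_zero] at this
  exact this

lemma wind_eq_zero_of_small {z : Pt} (hz : z ∉ Q.bdry) (h : |Q.wind z| < Real.pi) :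
    Q.wind z = 0 := by
  obtain ⟨k, hk⟩ := Q.wind_int hz
  rw [← hk] at h ⊢
  have hp := Real.pi_pos
  rw [zsmul_eq_mul, abs_lt] at h
  have h1 : (k:ℝ) < 1 := by nlinarith
  have h2 : (-1:ℝ) < k := by nlinarith
  have : k = 0 := by
    have h1' : k < 1 := by exact_mod_cast h1
    have h2' : -1 < k := by exact_mod_cast h2
    omega
  simp [this]

lemma wind_zero_of_unbounded {z : Pt} (hz : z ∉ Q.bdry)
    (h : ¬ Bornology.IsBounded (connectedComponentIn Q.bdryᶜ z)) : Q.wind z = 0 := by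
  have hev : ∀ᶠ y in Bornology.cobounded Pt, |Q.wind y| < Real.pi := by
    have := Q.wind_tendsto.abs
    rw [abs_zero] at this
    exact this.eventually_lt_const Real.pi_pos
  obtain ⟨y, hyC, hy⟩ : ∃ y ∈ connectedComponentIn Q.bdryᶜ z, |Q.wind y| < Real.pi := by
    by_contra hcon
    push Not at hcon
    apply h
    rw [Bornology.isBounded_def]
    filter_upwards [hev] with y hy hyC
    exact absurd hy (not_lt.mpr (hcon y hyC))
  have hsub := connectedComponentIn_subset Q.bdryᶜ z
  have hy0 := Q.wind_eq_zero_of_small (hsub hyC) hy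
  by_contra hz0
  have hpre : IsPreconnected (Q.wind '' connectedComponentIn Q.bdryᶜ z) :=
    isPreconnected_connectedComponentIn.image _ (Q.wind_continuousOn.mono hsub)
  have hord := hpre.ordConnected
  have hzm := mem_image_of_mem Q.wind (mem_connectedComponentIn (F := Q.bdryᶜ) hz)
  have hym := mem_image_of_mem Q.wind hyC
  rw [hy0] at hym
  have hp := Real.pi_pos
  have hbig : Real.pi ≤ |Q.wind z| := by
    by_contra hlt
    exact hz0 (Q.wind_eq_zero_of_small hz (not_le.mp hlt))
  obtain ⟨x, hxC, hx1, hx2⟩ : ∃ x ∈ connectedComponentIn Q.bdryᶜ z, Q.wind x ≠ 0 ∧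
      |Q.wind x| < Real.pi := by
    rcases le_abs.mp hbig with h1 | h1
    · obtain ⟨x, hxC, hx⟩ := hord.out hym hzm (show Real.pi / 2 ∈ _ from ⟨by linarith, by linarith⟩)
      refine ⟨x, hxC, by rw [hx]; positivity, ?_⟩
      rw [hx, abs_lt]; constructor <;> linarith
    · obtain ⟨x, hxC, hx⟩ := hord.out hzm hym (show -(Real.pi / 2) ∈ _ from ⟨by linarith, by linarith⟩)
      refine ⟨x, hxC, by rw [hx]; linarith, ?_⟩
      rw [hx, abs_lt]; constructor <;> linarith
  exact hx1 (Q.wind_eq_zero_of_small (hsub hxC) hx2)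

/-- The total angle cannot vanish on both sides of an edge. -/
lemma wind_jump_aux (i : Fin Q.n) {a b : Pt} {δ : ℝ} (h0 : 0 < δ) (h1 : δ < 1)
    (hai : Q.v (nxt i) = Q.v i + a) (ha : a ≠ 0) (hb : 0 < (toC b / toC a).im)
    (hoth : ∀ j, j ≠ i → Q.v i + δ • a ∉ segment ℝ (Q.v j) (Q.v (nxt j)))
    (hp : ∀ᶠ τ in nhdsWithin (0:ℝ) (Ioi 0), Q.wind (Q.v i + δ • a + τ • b) = 0)
    (hm : ∀ᶠ τ in nhdsWithin (0:ℝ) (Iio 0), Q.wind (Q.v i + δ • a + τ • b) = 0) : False := by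
  obtain ⟨J1, J2⟩ := ang_jump (w := Q.v i) h0 h1 ha hb
  rw [← hai] at J1 J2
  set c : ℝ → Pt := fun τ => Q.v i + δ • a + τ • b with hc
  have hc0 : c 0 = Q.v i + δ • a := by simp [hc]
  have hcc : Filter.Tendsto c (nhds 0) (nhds (Q.v i + δ • a)) := by
    rw [← hc0]; apply Continuous.tendsto; fun_prop
  have hR : Filter.Tendsto (fun τ => ∑ j ∈ Finset.univ.erase i, ang (Q.v j) (Q.v (nxt j)) (c τ))
      (nhds 0) (nhds (∑ j ∈ Finset.univ.erase i, ang (Q.v j) (Q.v (nxt j)) (Q.v i + δ • a))) := by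
    apply tendsto_finsetSum
    intro j hj
    exact (continuousAt_ang (hoth j (Finset.ne_of_mem_erase hj))).tendsto.comp hcc
  set R := ∑ j ∈ Finset.univ.erase i, ang (Q.v j) (Q.v (nxt j)) (Q.v i + δ • a)
  have hw : ∀ τ, Q.wind (c τ) = ang (Q.v i) (Q.v (nxt i)) (c τ) +
      ∑ j ∈ Finset.univ.erase i, ang (Q.v j) (Q.v (nxt j)) (c τ) := fun τ =>
    (Finset.add_sum_erase _ _ (Finset.mem_univ i)).symm
  have T1 := J1.add (hR.mono_left nhdsWithin_le_nhds)
  have T2 := J2.add (hR.mono_left nhdsWithin_le_nhds)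
  have E1 : Real.pi + R = 0 := by
    refine tendsto_nhds_unique T1 (tendsto_const_nhds.congr' ?_)
    filter_upwards [hp] with τ hτ
    rw [← hτ]; exact hw τ
  have E2 : -Real.pi + R = 0 := by
    refine tendsto_nhds_unique T2 (tendsto_const_nhds.congr' ?_)
    filter_upwards [hm] with τ hτ
    rw [← hτ]; exact hw τ
  have := Real.pi_pos
  linarith

lemma wind_jump (i : Fin Q.n) {a b : Pt} {δ : ℝ} (h0 : 0 < δ) (h1 : δ < 1)
    (hai : Q.v (nxt i) = Q.v i + a) (hab : LinearIndependent ℝ ![a, b])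
    (hoth : ∀ j, j ≠ i → Q.v i + δ • a ∉ segment ℝ (Q.v j) (Q.v (nxt j)))
    (hp : ∀ᶠ τ in nhdsWithin (0:ℝ) (Ioi 0), Q.wind (Q.v i + δ • a + τ • b) = 0)
    (hm : ∀ᶠ τ in nhdsWithin (0:ℝ) (Iio 0), Q.wind (Q.v i + δ • a + τ • b) = 0) : False := by
  have ha : a ≠ 0 := by simpa using hab.ne_zero 0
  have hane : toC a ≠ 0 := by simpa using ha
  have him : (toC b / toC a).im ≠ 0 := by
    intro h
    have hr : toC b / toC a = ((toC b / toC a).re : ℂ) := by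
      apply Complex.ext <;> simp [h]
    rw [div_eq_iff hane, ← Complex.real_smul, ← map_smul] at hr
    have hr' := toC.injective hr
    rw [LinearIndependent.pair_iff] at hab
    have := hab (toC b / toC a).re (-1) (by rw [← hr']; simp)
    norm_num at this
  rcases lt_or_gt_of_ne him with h | h
  · refine Q.wind_jump_aux i (b := -b) h0 h1 hai ha ?_ hoth ?_ ?_
    · rw [map_neg, neg_div, Complex.neg_im]; linarith
    · have : Filter.Tendsto (fun τ : ℝ => -τ) (nhdsWithin 0 (Ioi 0)) (nhdsWithin 0 (Iio 0)) := by
        simpa using tendsto_neg_nhdsGT (a := (0:ℝ))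
      simpa using this.eventually hm
    · have : Filter.Tendsto (fun τ : ℝ => -τ) (nhdsWithin 0 (Iio 0)) (nhdsWithin 0 (Ioi 0)) := by
        simpa using tendsto_neg_nhdsLT (a := (0:ℝ))
      simpa using this.eventually hp
  · exact Q.wind_jump_aux i h0 h1 hai ha h hoth hp hm

end SimplePolygon

namespace SimplePolygon

variable (Q : SimplePolygon)

lemma edge_inner_le {n : Pt} {c : ℝ} (h : ∀ j, ⟪n, Q.v j⟫ ≤ c) {z : Pt} (hz : z ∈ Q.bdry) :
    ⟪n, z⟫ ≤ c := by
  obtain ⟨i, hi⟩ := mem_iUnion.mp hz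
  obtain ⟨s, t, hs, ht, hst, rfl⟩ := hi
  rw [inner_add_right, inner_smul_right, inner_smul_right]
  have h1 := h i
  have h2 := h (nxt i)
  calc s * ⟪n, Q.v i⟫ + t * ⟪n, Q.v (nxt i)⟫ ≤ s * c + t * c := by gcongr
    _ = c := by rw [← add_mul, hst, one_mul]

lemma convex_upper (n : Pt) (c : ℝ) : Convex ℝ {y : Pt | c < ⟪n, y⟫} :=
  convex_halfSpace_gt (f := fun y => ⟪n, y⟫)
    ⟨fun x y => inner_add_right _ _ _, fun a x => inner_smul_right _ _ _⟩ c

lemma upper_unbounded {n : Pt} (hn : n ≠ 0) {c : ℝ} {y : Pt} (hy : c < ⟪n, y⟫) :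
    ¬ Bornology.IsBounded {y : Pt | c < ⟪n, y⟫} := by
  intro hb
  obtain ⟨C, hC⟩ := hb.exists_norm_le
  have hn2 : 0 < ‖n‖ ^ 2 := by positivity
  set t := (|‖n‖ * C - ⟪n, y⟫| + 1) / ‖n‖ ^ 2 with ht
  have ht0 : 0 ≤ t := by positivity
  have hin : ⟪n, y + t • n⟫ = ⟪n, y⟫ + (|‖n‖ * C - ⟪n, y⟫| + 1) := by
    rw [inner_add_right, inner_smul_right, real_inner_self_eq_norm_sq, ht]
    field_simp
  have h1 : y + t • n ∈ {y : Pt | c < ⟪n, y⟫} := by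
    show c < ⟪n, y + t • n⟫
    rw [hin]; have := abs_nonneg (‖n‖ * C - ⟪n, y⟫); linarith
  have h2 := hC _ h1
  have h3 := real_inner_le_norm n (y + t • n)
  rw [hin] at h3
  have h4 := le_abs_self (‖n‖ * C - ⟪n, y⟫)
  have h5 : ‖n‖ * ‖y + t • n‖ ≤ ‖n‖ * C := by gcongr
  linarith

lemma not_body_of_meets {n : Pt} (hn : n ≠ 0) {c : ℝ} (h : ∀ j, ⟪n, Q.v j⟫ ≤ c)
    {S : Set Pt} (hS : IsPreconnected S) (hSB : S ⊆ Q.bdryᶜ) {z y : Pt} (hz : z ∈ S) (hy : y ∈ S)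
    (hyc : c < ⟪n, y⟫) : z ∉ Q.body := by
  have hU : {y : Pt | c < ⟪n, y⟫} ⊆ Q.bdryᶜ := fun x hx hxB =>
    absurd (Q.edge_inner_le h hxB) (not_le.mpr hx)
  rintro (hzB | ⟨-, hb⟩)
  · exact hSB hz hzB
  · have hpre := hS.union y hy hyc (convex_upper n c).isPreconnected
    have hsub := hpre.subset_connectedComponentIn (Or.inl hz) (union_subset hSB hU)
    exact upper_unbounded hn hyc (hb.subset (subset_union_right.trans hsub))

lemma body_inner_le {n : Pt} (hn : n ≠ 0) {c : ℝ} (h : ∀ j, ⟪n, Q.v j⟫ ≤ c) {z : Pt}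
    (hz : z ∈ Q.body) : ⟪n, z⟫ ≤ c := by
  by_contra hc
  push Not at hc
  refine Q.not_body_of_meets hn h (S := {z}) isPreconnected_singleton ?_ rfl rfl hc hz
  rintro x rfl hx
  exact absurd (Q.edge_inner_le h hx) (not_le.mpr hc)

lemma exists_extreme {n : Pt} (hn : n ≠ 0) : ∃ i, (∀ j, ⟪n, Q.v j⟫ ≤ ⟪n, Q.v i⟫) ∧
    ∃ n' : Pt, ∀ j, j ≠ i → ⟪n', Q.v j⟫ < ⟪n', Q.v i⟫ := by
  have : Nonempty (Fin Q.n) := ⟨⟨0, by have := Q.hn; omega⟩⟩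
  obtain ⟨i0, -, hi0⟩ := Finset.exists_max_image Finset.univ (fun j => ⟪n, Q.v j⟫)
    Finset.univ_nonempty
  set m : Pt := !₂[-n 1, n 0] with hm
  have hm0 : ∀ x : Pt, ⟪n, x⟫ = 0 → ⟪m, x⟫ = 0 → x = 0 := by
    intro x h1 h2
    simp [hm, PiLp.inner_apply, Fin.sum_univ_two] at h1 h2
    have hpos : n 0 ^ 2 + n 1 ^ 2 ≠ 0 := by
      intro h
      apply hn
      ext k
      fin_cases k
      · simp; nlinarith [sq_nonneg (n 0), sq_nonneg (n 1)]
      · simp; nlinarith [sq_nonneg (n 0), sq_nonneg (n 1)]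
    have e0 : (n 0 ^ 2 + n 1 ^ 2) * x 0 = 0 := by linear_combination n 0 * h1 - n 1 * h2
    have e1 : (n 0 ^ 2 + n 1 ^ 2) * x 1 = 0 := by linear_combination n 1 * h1 + n 0 * h2
    ext k
    fin_cases k
    · simpa [hpos] using e0
    · simpa [hpos] using e1
  obtain ⟨i, hi, him⟩ := Finset.exists_max_image
    (Finset.univ.filter fun j => ⟪n, Q.v j⟫ = ⟪n, Q.v i0⟫) (fun j => ⟪m, Q.v j⟫)
    ⟨i0, by simp⟩
  simp only [Finset.mem_filter, Finset.mem_univ, true_and] at hi him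
  have himax : ∀ j, ⟪n, Q.v j⟫ ≤ ⟪n, Q.v i⟫ := fun j => by
    rw [hi]; exact hi0 j (Finset.mem_univ j)
  refine ⟨i, himax, ?_⟩
  have hev : ∀ᶠ η in nhdsWithin (0:ℝ) (Ioi 0), ∀ j, j ≠ i →
      ⟪n + η • m, Q.v j⟫ < ⟪n + η • m, Q.v i⟫ := by
    rw [Filter.eventually_all]
    intro j
    by_cases hji : j = i
    · simp [hji]
    rcases lt_or_eq_of_le (himax j) with h | h
    · have hc1 : Continuous fun η : ℝ => ⟪n + η • m, Q.v j⟫ := by fun_prop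
      have hc2 : Continuous fun η : ℝ => ⟪n + η • m, Q.v i⟫ := by fun_prop
      have : ∀ᶠ η in nhds (0:ℝ), ⟪n + η • m, Q.v j⟫ < ⟪n + η • m, Q.v i⟫ :=
        hc1.continuousAt.eventually_lt hc2.continuousAt (by simpa using h)
      filter_upwards [nhdsWithin_le_nhds this] with η hη _ using hη
    · filter_upwards [self_mem_nhdsWithin] with η hη _
      have hη' : 0 < η := hη
      have hle := him j (h.trans hi)
      have hlt : ⟪m, Q.v j⟫ < ⟪m, Q.v i⟫ := by
        refine lt_of_le_of_ne hle fun heq => hji (Q.inj ?_)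
        rw [← sub_eq_zero]
        apply hm0
        · rw [inner_sub_right, h, sub_self]
        · rw [inner_sub_right, heq, sub_self]
      simp only [inner_add_left, real_inner_smul_left]
      rw [h]
      have := mul_lt_mul_of_pos_left hlt hη'
      linarith
  obtain ⟨η, hη⟩ := hev.exists
  exact ⟨_, hη⟩

lemma locallyConvex_of_extreme {n : Pt} {i : Fin Q.n}
    (hext : ∀ j, j ≠ i → ⟪n, Q.v j⟫ < ⟪n, Q.v i⟫) : Q.LocallyConvexAt i := by
  obtain ⟨k, hk⟩ := nxt_bij.surjective i
  have hni : nxt i ≠ i := nxt_ne_s11 Q.hn i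
  have hki : k ≠ i := by
    rintro rfl; exact hni hk
  have hn0 : n ≠ 0 := by
    rintro rfl
    simpa using hext _ hni
  have hle : ∀ j, ⟪n, Q.v j⟫ ≤ ⟪n, Q.v i⟫ := fun j => by
    by_cases h : j = i
    · rw [h]
    · exact (hext j h).le
  set w := Q.v i with hw
  set a := Q.v (nxt i) - w with ha
  set b := Q.v k - w with hb
  have hna : ⟪n, a⟫ < 0 := by rw [ha, inner_sub_right]; linarith [hext _ hni]
  have hnb : ⟪n, b⟫ < 0 := by rw [hb, inner_sub_right]; linarith [hext _ hki]
  have hva : Q.v (nxt i) = w + a := by rw [ha]; abel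
  have hvb : Q.v k = w + b := by rw [hb]; abel
  have hadj := Q.adj k
  rw [hk, ← hw, hva, hvb] at hadj
  -- linear independence of the two edge directions
  have hpar : ∀ r : ℝ, 0 < r → b ≠ r • a := by
    intro r hr hbr
    have ha0 : a ≠ 0 := by rintro h; rw [h] at hna; simp at hna
    have hmem : w + (min r 1) • a ∈ segment ℝ (w + b) w ∩ segment ℝ w (w + a) := by
      have hpos : 0 < min r 1 := lt_min hr one_pos
      constructor
      · refine ⟨min r 1 / r, 1 - min r 1 / r, by positivity, ?_, by ring, ?_⟩
        · rw [sub_nonneg, div_le_one hr]; exact min_le_left _ _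
        · rw [hbr]; clear_value a; match_scalars <;> field_simp <;> ring
      · refine ⟨1 - min r 1, min r 1, ?_, hpos.le, by ring, ?_⟩
        · rw [sub_nonneg]; exact min_le_right _ _
        · module
    rw [hadj] at hmem
    have h2 : (min r 1) • a = 0 := by simpa using hmem
    rcases smul_eq_zero.mp h2 with h | h
    · exact absurd h (lt_min hr one_pos).ne'
    · exact ha0 h
  have hli : LinearIndependent ℝ ![a, b] := by
    rw [LinearIndependent.pair_iff]
    intro s t hst
    have hinn : s * ⟪n, a⟫ + t * ⟪n, b⟫ = 0 := by
      rw [← inner_smul_right, ← inner_smul_right, ← inner_add_right, hst, inner_zero_right]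
    by_cases ht : t = 0
    · subst ht
      simp [hna.ne] at hinn
      exact ⟨hinn, rfl⟩
    · exfalso
      have hbr : b = (-s / t) • a := by
        have : t • b = (-s) • a := by
          rw [neg_smul, eq_neg_iff_add_eq_zero, add_comm]; exact hst
        rw [div_eq_inv_mul, mul_smul, ← this, smul_smul, inv_mul_cancel₀ ht, one_smul]
      refine hpar (-s / t) ?_ hbr
      have h3 : ⟪n, b⟫ = (-s / t) * ⟪n, a⟫ := by
        conv_lhs => rw [hbr]
        rw [inner_smul_right]
      by_contra hneg
      push Not at hneg
      nlinarith
  -- coordinates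
  obtain ⟨s, t, hsa, hsb, hta, htb, hdec⟩ : ∃ s t : Pt →L[ℝ] ℝ, s a = 1 ∧ s b = 0 ∧ t a = 0 ∧
      t b = 1 ∧ ∀ x, x = s x • a + t x • b := by
    let B := basisOfLinearIndependentOfCardEqFinrank hli (by simp)
    have hB0 : B 0 = a := by simp [B]
    have hB1 : B 1 = b := by simp [B]
    refine ⟨(B.coord 0).toContinuousLinearMap, (B.coord 1).toContinuousLinearMap, ?_, ?_, ?_, ?_, ?_⟩
    · rw [← hB0]; simp
    · rw [← hB1]; simp
    · rw [← hB0]; simp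
    · rw [← hB1]; simp
    · intro x
      have := B.sum_repr x
      rw [Fin.sum_univ_two, hB0, hB1] at this
      simpa using this.symm
  have ha0 : 0 < ‖a‖ := by
    rw [norm_pos_iff]; rintro h; rw [h] at hna; simp at hna
  have hb0 : 0 < ‖b‖ := by
    rw [norm_pos_iff]; rintro h; rw [h] at hnb; simp at hnb
  -- other edges stay away
  have hfar : ∀ j, j ≠ i → j ≠ k → w ∉ segment ℝ (Q.v j) (Q.v (nxt j)) := by
    intro j hji hjk hmem
    by_cases hj : j = nxt i
    · subst hj
      have h1 : w ∈ segment ℝ (Q.v i) (Q.v (nxt i)) ∩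
          segment ℝ (Q.v (nxt i)) (Q.v (nxt (nxt i))) := ⟨left_mem_segment ℝ _ _, hmem⟩
      rw [Q.adj i] at h1
      exact hni (Q.inj h1).symm
    · have h1 : w ∈ segment ℝ (Q.v i) (Q.v (nxt i)) ∩
          segment ℝ (Q.v j) (Q.v (nxt j)) := ⟨left_mem_segment ℝ _ _, hmem⟩
      rw [Q.nonadj i j (Ne.symm hji) hj ?_] at h1
      · exact h1
      · intro h
        exact hjk (nxt_inj (h.symm.trans hk.symm))
  have hevfar : ∀ᶠ x in nhds w, ∀ j, j ≠ i → j ≠ k → x ∉ segment ℝ (Q.v j) (Q.v (nxt j)) := by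
    rw [Filter.eventually_all]
    intro j
    by_cases h1 : j = i
    · simp [h1]
    by_cases h2 : j = k
    · simp [h2]
    have hcl : IsClosed (segment ℝ (Q.v j) (Q.v (nxt j))) := by
      rw [← convexHull_pair]
      exact (Set.toFinite _).isClosed_convexHull ℝ
    filter_upwards [hcl.isOpen_compl.mem_nhds (hfar j h1 h2)] with x hx _ _ using hx
  obtain ⟨ε0, hε0, hball0⟩ := Metric.eventually_nhds_iff_ball.mp hevfar
  set ε := min ε0 (min ‖a‖ ‖b‖) with hε
  have hεpos : 0 < ε := lt_min hε0 (lt_min ha0 hb0)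
  have hball : ∀ x ∈ ball w ε, ∀ j, j ≠ i → j ≠ k → x ∉ segment ℝ (Q.v j) (Q.v (nxt j)) :=
    fun x hx => hball0 x (ball_subset_ball (min_le_left _ _) hx)
  -- the two edges in coordinates
  have hei : ∀ x ∈ segment ℝ (Q.v i) (Q.v (nxt i)), 0 ≤ s (x - w) ∧ t (x - w) = 0 := by
    rintro x ⟨p, q, hp, hq, hpq, rfl⟩
    have : p • Q.v i + q • Q.v (nxt i) - w = q • a := by
      rw [hva, ← hw, show p = 1 - q by linarith]; module
    rw [this]; simp [hsa, hta, hq]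
  have hek : ∀ x ∈ segment ℝ (Q.v k) (Q.v (nxt k)), s (x - w) = 0 ∧ 0 ≤ t (x - w) := by
    rintro x ⟨p, q, hp, hq, hpq, rfl⟩
    have : p • Q.v k + q • Q.v (nxt k) - w = p • b := by
      rw [hk, hvb, ← hw, show q = 1 - p by linarith]; module
    rw [this]; simp [hsb, htb, hp]
  have hB : ∀ x ∈ ball w ε, x ∈ Q.bdry →
      (0 ≤ s (x - w) ∧ t (x - w) = 0) ∨ (s (x - w) = 0 ∧ 0 ≤ t (x - w)) := by
    intro x hx hxB
    obtain ⟨j, hj⟩ := mem_iUnion.mp hxB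
    by_cases h1 : j = i
    · subst h1; exact Or.inl (hei x hj)
    by_cases h2 : j = k
    · subst h2; exact Or.inr (hek x hj)
    exact absurd hj (hball x hx j h1 h2)
  have hconvlt : ∀ f : Pt →L[ℝ] ℝ, Convex ℝ {x : Pt | f (x - w) < 0} := by
    intro f
    have : {x : Pt | f (x - w) < 0} = {x | f x < f w} := by ext x; simp [sub_neg]
    rw [this]; exact convex_halfSpace_lt f.toLinearMap.isLinear _
  have hconvgt : ∀ f : Pt →L[ℝ] ℝ, Convex ℝ {x : Pt | 0 < f (x - w)} := by
    intro f
    have : {x : Pt | 0 < f (x - w)} = {x | f w < f x} := by ext x; simp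
    rw [this]; exact convex_halfSpace_gt f.toLinearMap.isLinear _
  have hconvge : ∀ f : Pt →L[ℝ] ℝ, Convex ℝ {x : Pt | 0 ≤ f (x - w)} := by
    intro f
    have : {x : Pt | 0 ≤ f (x - w)} = {x | f w ≤ f x} := by ext x; simp
    rw [this]; exact convex_halfSpace_ge f.toLinearMap.isLinear _
  -- outside the cone
  have hout : ∀ (f : Pt →L[ℝ] ℝ) (c : Pt), f c = 1 → ⟪n, c⟫ < 0 →
      (∀ x ∈ ball w ε, x ∈ Q.bdry → 0 ≤ f (x - w)) →
      ∀ x ∈ ball w ε, f (x - w) < 0 → x ∉ Q.body := by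
    intro f c hfc hnc hfB x hx hfx
    have hc0 : 0 < ‖c‖ := by
      rw [norm_pos_iff]; rintro h; rw [h] at hnc; simp at hnc
    set r := ε / (2 * ‖c‖) with hr
    have hrpos : 0 < r := by positivity
    refine Q.not_body_of_meets hn0 hle (S := ball w ε ∩ {x | f (x - w) < 0})
      (y := w - r • c) ((convex_ball w ε).inter (hconvlt f)).isPreconnected ?_ ⟨hx, hfx⟩ ⟨?_, ?_⟩ ?_
    · rintro y ⟨hy1, hy2⟩ hyB
      exact absurd (hfB y hy1 hyB) (not_le.mpr hy2)
    · rw [mem_ball, dist_eq_norm, sub_sub_cancel_left, norm_neg, norm_smul, Real.norm_of_nonneg hrpos.le,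
        hr]
      field_simp
      linarith
    · show f (w - r • c - w) < 0
      rw [sub_sub_cancel_left, map_neg, map_smul, hfc]; simpa using hrpos
    · rw [inner_sub_right, inner_smul_right]; nlinarith
  have houts := hout s a hsa hna (fun x hx hxB => by
    rcases hB x hx hxB with h | h
    · exact h.1
    · exact h.1.ge)
  have houtt := hout t b htb hnb (fun x hx hxB => by
    rcases hB x hx hxB with h | h
    · exact h.2.ge
    · exact h.2)
  -- the open sector
  set S := ball w ε ∩ ({x | 0 < s (x - w)} ∩ {x | 0 < t (x - w)}) with hS
  have hSpre : IsPreconnected S :=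
    ((convex_ball w ε).inter ((hconvgt s).inter (hconvgt t))).isPreconnected
  have hSB : S ⊆ Q.bdryᶜ := by
    rintro x ⟨hx, hx1, hx2⟩ hxB
    rcases hB x hx hxB with h | h
    · exact hx2.ne' h.2
    · exact hx1.ne' h.1
  have hin : ∀ x ∈ S, x ∈ Q.body := by
    intro x hx
    refine Or.inr ⟨hSB hx, ?_⟩
    by_contra hunb
    have hS0 : ∀ y ∈ S, Q.wind y = 0 := by
      intro y hy
      apply Q.wind_zero_of_unbounded (hSB hy)
      rw [← connectedComponentIn_eq (hSpre.subset_connectedComponentIn hx hSB hy)]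
      exact hunb
    have hO0 : ∀ y ∈ ball w ε, t (y - w) < 0 → Q.wind y = 0 := by
      intro y hy hty
      have hyb := houtt y hy hty
      have hyB : y ∉ Q.bdry := fun h => hyb (Or.inl h)
      apply Q.wind_zero_of_unbounded hyB
      exact fun h => hyb (Or.inr ⟨hyB, h⟩)
    set δ := ε / (2 * ‖a‖) with hδ
    have hδ0 : 0 < δ := by positivity
    have hεa : ε ≤ ‖a‖ := (min_le_right _ _).trans (min_le_left _ _)
    have hδ1 : δ < 1 := by
      rw [hδ, div_lt_one (by positivity)]; linarith
    have hpball : w + δ • a ∈ ball w ε := by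
      rw [mem_ball, dist_eq_norm, add_sub_cancel_left, norm_smul, Real.norm_of_nonneg hδ0.le, hδ]
      field_simp
      linarith
    have hevb : ∀ᶠ τ in nhds (0:ℝ), w + δ • a + τ • b ∈ ball w ε := by
      have hcont : Continuous fun τ : ℝ => w + δ • a + τ • b := by fun_prop
      exact hcont.continuousAt.eventually_mem (isOpen_ball.mem_nhds (by simpa using hpball))
    have hs' : ∀ τ : ℝ, s (w + δ • a + τ • b - w) = δ := by
      intro τ
      rw [show w + δ • a + τ • b - w = δ • a + τ • b by abel]
      simp [hsa, hsb]
    have ht' : ∀ τ : ℝ, t (w + δ • a + τ • b - w) = τ := by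
      intro τ
      rw [show w + δ • a + τ • b - w = δ • a + τ • b by abel]
      simp [hta, htb]
    refine Q.wind_jump i hδ0 hδ1 hva hli ?_ ?_ ?_
    · intro j hji
      by_cases hjk : j = k
      · subst hjk
        intro h
        have h1 := (hek _ h).1
        have h2 := hs' 0
        rw [zero_smul, add_zero] at h2
        exact hδ0.ne' (h2.symm.trans h1)
      · exact hball _ hpball j hji hjk
    · filter_upwards [nhdsWithin_le_nhds hevb, self_mem_nhdsWithin] with τ h1 h2
      refine hS0 _ ⟨h1, ?_, ?_⟩
      · show 0 < s _
        rw [hs']; exact hδ0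
      · show 0 < t _
        rw [ht']; exact h2
    · filter_upwards [nhdsWithin_le_nhds hevb, self_mem_nhdsWithin] with τ h1 h2
      refine hO0 _ h1 ?_
      rw [ht']; exact h2
  -- conclusion
  refine ⟨ε, hεpos, ?_⟩
  have heq : Q.body ∩ ball w ε =
      ({x | 0 ≤ s (x - w)} ∩ {x | 0 ≤ t (x - w)}) ∩ ball w ε := by
    ext x
    constructor
    · rintro ⟨hx, hxb⟩
      refine ⟨⟨?_, ?_⟩, hxb⟩
      · by_contra h; exact houts x hxb (not_le.mp h) hx
      · by_contra h; exact houtt x hxb (not_le.mp h) hx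
    · rintro ⟨⟨h1, h2⟩, hxb⟩
      refine ⟨?_, hxb⟩
      have h1' : 0 ≤ s (x - w) := h1
      have h2' : 0 ≤ t (x - w) := h2
      have hd := hdec (x - w)
      have hnorm : ‖x - w‖ < ε := by rwa [mem_ball, dist_eq_norm] at hxb
      rcases h1'.eq_or_lt with h3 | h3
      · left
        rw [← h3, zero_smul, zero_add] at hd
        have hlt : t (x - w) ≤ 1 := by
          have hεb : ε ≤ ‖b‖ := (min_le_right _ _).trans (min_le_right _ _)
          have h5 : ‖x - w‖ = t (x - w) * ‖b‖ := by
            conv_lhs => rw [hd]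
            rw [norm_smul, Real.norm_of_nonneg h2']
          by_contra hgt
          push Not at hgt
          nlinarith
        refine mem_iUnion.mpr ⟨k, t (x - w), 1 - t (x - w), h2', by linarith, by ring, ?_⟩
        rw [hk, hvb, ← hw]
        calc t (x - w) • (w + b) + (1 - t (x - w)) • w = w + t (x - w) • b := by module
          _ = x := by rw [← hd]; abel
      rcases h2'.eq_or_lt with h4 | h4
      · left
        rw [← h4, zero_smul, add_zero] at hd
        have hlt : s (x - w) ≤ 1 := by
          have hεa : ε ≤ ‖a‖ := (min_le_right _ _).trans (min_le_left _ _)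
          have h5 : ‖x - w‖ = s (x - w) * ‖a‖ := by
            conv_lhs => rw [hd]
            rw [norm_smul, Real.norm_of_nonneg h1']
          by_contra hgt
          push Not at hgt
          nlinarith
        refine mem_iUnion.mpr ⟨i, 1 - s (x - w), s (x - w), by linarith, h1', by ring, ?_⟩
        rw [hva, ← hw]
        calc (1 - s (x - w)) • w + s (x - w) • (w + a) = w + s (x - w) • a := by module
          _ = x := by rw [← hd]; abel
      · exact hin x ⟨hxb, h3, h4⟩
  rw [heq]
  exact ((hconvge s).inter (hconvge t)).inter (convex_ball w ε)

lemma exists_convex_max {n : Pt} (hn : n ≠ 0) : ∃ i, Q.LocallyConvexAt i ∧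
    ∀ z ∈ Q.body, ⟪n, z⟫ ≤ ⟪n, Q.v i⟫ := by
  obtain ⟨i, hi, n', hn'⟩ := Q.exists_extreme hn
  exact ⟨i, Q.locallyConvex_of_extreme hn', fun z hz => Q.body_inner_le hn hi hz⟩

lemma vertex_mem_body (i : Fin Q.n) : Q.v i ∈ Q.body :=
  Or.inl (mem_iUnion.mpr ⟨i, left_mem_segment ℝ _ _⟩)

lemma inner_le_LW (hcomp : IsCompact Q.body) {n : Pt} (hn : ‖n‖ = 1) {u v : Pt}
    (hu : u ∈ Q.body) (hv : v ∈ Q.body) : ⟪n, u - v⟫ ≤ Q.LW := by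
  have hn0 : n ≠ 0 := by rintro rfl; simp at hn
  obtain ⟨i, hi, hi'⟩ := Q.exists_convex_max hn0
  obtain ⟨j, hj, hj'⟩ := Q.exists_convex_max (neg_ne_zero.mpr hn0)
  simp only [inner_neg_left, neg_le_neg_iff] at hj'
  have hbdd : BddAbove Q.LWset := by
    refine ⟨Metric.diam Q.body, ?_⟩
    rintro d ⟨i, j, -, -, m, hm, rfl, -⟩
    calc ⟪m, Q.v i - Q.v j⟫ ≤ ‖m‖ * ‖Q.v i - Q.v j‖ := real_inner_le_norm _ _
      _ = dist (Q.v i) (Q.v j) := by rw [hm, one_mul, dist_eq_norm]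
      _ ≤ _ := Metric.dist_le_diam_of_mem hcomp.isBounded (Q.vertex_mem_body i) (Q.vertex_mem_body j)
  refine le_trans ?_ (le_csSup hbdd ⟨i, j, hi, hj, n, hn, rfl, fun z hz => ⟨hj' z hz, hi' z hz⟩⟩)
  rw [inner_sub_right, inner_sub_right]
  linarith [hi' u hu, hj' v hv]

end SimplePolygon

/-- The distance between the endpoints of any segment contained in the
polygon body is at most the long width `LW`. -/
theorem stmt_11 (Q : SimplePolygon) (hcomp : IsCompact Q.body)
    (u v : Pt) (hu : u ∈ Q.body) (hv : v ∈ Q.body)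
    (hseg : segment ℝ u v ⊆ Q.body) :
    dist u v ≤ Q.LW := by
  by_cases huv : u = v
  · subst huv
    have h := Q.inner_le_LW hcomp (n := !₂[1, 0]) (by simp [EuclideanSpace.norm_eq]) hu hu
    simpa using h
  · have hpos : 0 < ‖u - v‖ := norm_pos_iff.mpr (sub_ne_zero.mpr huv)
    have h := Q.inner_le_LW hcomp (n := ‖u - v‖⁻¹ • (u - v))
      (by rw [norm_smul, norm_inv, norm_norm, inv_mul_cancel₀ hpos.ne']) hu hv
    rw [real_inner_smul_left, real_inner_self_eq_norm_sq, sq, inv_mul_cancel_left₀ hpos.ne'] at h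
    rwa [dist_eq_norm]
end
end

section
/- Let P be a simple polygon in ℝ². Then every reflex vertex of P lies in the topological interior of the convex hull convexHull ℝ P. In particular, no reflex vertex is an extreme point of convexHull ℝ P. -/
open scoped RealInnerProductSpace symmDiff
open Metric Set MeasureTheory

noncomputable section

namespace SimplePolygon

lemma nxt_injective {n : ℕ} : Function.Injective (nxt : Fin n → Fin n) := by
  intro a b h
  have h1 : (a.1 + 1) % n = (b.1 + 1) % n := congrArg Fin.val h
  have ha := a.2
  have hb := b.2
  apply Fin.ext
  rcases Nat.lt_or_ge (a.1 + 1) n with h2 | h2 <;> rcases Nat.lt_or_ge (b.1 + 1) n with h3 | h3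
  · rw [Nat.mod_eq_of_lt h2, Nat.mod_eq_of_lt h3] at h1; omega
  · have : b.1 + 1 = n := by omega
    rw [Nat.mod_eq_of_lt h2, this, Nat.mod_self] at h1; omega
  · have : a.1 + 1 = n := by omega
    rw [Nat.mod_eq_of_lt h3, this, Nat.mod_self] at h1; omega
  · omega

lemma nxt_ne {n : ℕ} (hn : 3 ≤ n) (a : Fin n) : nxt a ≠ a := by
  intro h
  have h1 : (a.1 + 1) % n = a.1 := congrArg Fin.val h
  have ha := a.2
  rcases Nat.lt_or_ge (a.1 + 1) n with h2 | h2
  · rw [Nat.mod_eq_of_lt h2] at h1; omega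
  · have : a.1 + 1 = n := by omega
    rw [this, Nat.mod_self] at h1; omega

lemma nxt_bijective {n : ℕ} : Function.Bijective (nxt : Fin n → Fin n) :=
  Finite.injective_iff_bijective.mp nxt_injective

/-- Identification of the plane with the complex numbers. -/
def toC (p : Pt) : ℂ := ⟨p 0, p 1⟩

lemma toC_continuous : Continuous toC := by
  have : toC = fun p : Pt => ((p 0 : ℝ) : ℂ) + ((p 1 : ℝ) : ℂ) * Complex.I := by
    funext p
    apply Complex.ext <;> simp [toC]
  rw [this]
  fun_prop

lemma pt_ext {p q : Pt} (h0 : p 0 = q 0) (h1 : p 1 = q 1) : p = q := by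
  ext j
  fin_cases j
  · exact h0
  · exact h1

lemma toC_inj {p q : Pt} (h : toC p = toC q) : p = q :=
  pt_ext (congrArg Complex.re h) (congrArg Complex.im h)

/-- The ratio whose argument is the angle under which `x y` is seen from `z`. -/
def rat (x y z : Pt) : ℂ := (toC y - toC z) / (toC x - toC z)

lemma mem_segment_of_rat {x y z : Pt} (h : rat x y z ∉ Complex.slitPlane) :
    z ∈ segment ℝ x y := by
  by_cases hx : toC x = toC z
  · rw [toC_inj hx]; exact left_mem_segment ℝ _ _
  have hx' : toC x - toC z ≠ 0 := sub_ne_zero.mpr hx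
  rw [Complex.mem_slitPlane_iff] at h
  push Not at h
  obtain ⟨h1, h2⟩ := h
  set t : ℝ := -(rat x y z).re with ht
  have hr : rat x y z = ((-t : ℝ) : ℂ) := by
    apply Complex.ext <;> simp [ht, h2]
  have he : toC y - toC z = ((-t : ℝ) : ℂ) * (toC x - toC z) := by
    rw [← hr, rat, div_mul_cancel₀ _ hx']
  have e0 := congrArg Complex.re he
  have e1 := congrArg Complex.im he
  simp [toC] at e0 e1
  have ht0 : 0 ≤ t := by linarith
  refine ⟨t / (1 + t), 1 / (1 + t), by positivity, by positivity, by field_simp; ring, ?_⟩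
  apply pt_ext
  · simp; field_simp; linarith
  · simp; field_simp; linarith

/-- Total angle (winding number times `2 π`). -/
def W (Q : SimplePolygon) (z : Pt) : ℝ :=
  ∑ k, Complex.arg (rat (Q.v k) (Q.v (nxt k)) z)

lemma rat_continuousAt {x y z : Pt} (h : z ∉ segment ℝ x y) :
    ContinuousAt (fun z => Complex.arg (rat x y z)) z := by
  have hx : toC x - toC z ≠ 0 := by
    intro h0
    apply h
    rw [toC_inj (sub_eq_zero.mp h0)]; exact left_mem_segment ℝ _ _
  have hs : rat x y z ∈ Complex.slitPlane := by
    by_contra h1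
    exact h (mem_segment_of_rat h1)
  have hc : ContinuousAt (fun z => rat x y z) z := by
    unfold rat
    have := toC_continuous.continuousAt (x := z)
    exact (continuousAt_const.sub this).div (continuousAt_const.sub this) hx
  exact ContinuousAt.comp (f := fun z => rat x y z) (Complex.continuousAt_arg hs) hc

lemma notMem_edge {Q : SimplePolygon} {z : Pt} (h : z ∉ Q.bdry) (k : Fin Q.n) :
    z ∉ segment ℝ (Q.v k) (Q.v (nxt k)) := fun h1 => h (mem_iUnion.mpr ⟨k, h1⟩)

lemma W_continuousAt {Q : SimplePolygon} {z : Pt} (h : z ∉ Q.bdry) : ContinuousAt Q.W z := by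
  unfold W
  exact tendsto_finsetSum _ fun k _ => rat_continuousAt (notMem_edge h k)

lemma W_int {Q : SimplePolygon} {z : Pt} (h : z ∉ Q.bdry) : ∃ m : ℤ, Q.W z = 2 * Real.pi * m := by
  have hne : ∀ k, toC (Q.v k) - toC z ≠ 0 := by
    intro k h0
    apply notMem_edge h k
    rw [toC_inj (sub_eq_zero.mp h0)]; exact left_mem_segment ℝ _ _
  have h1 : ((Q.W z : ℝ) : Real.Angle) = ((0 : ℝ) : Real.Angle) := by
    have : ((Q.W z : ℝ) : Real.Angle)
        = ∑ k, ((Complex.arg (rat (Q.v k) (Q.v (nxt k)) z) : ℝ) : Real.Angle) := by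
      unfold W
      exact map_sum Real.Angle.coeHom _ _
    rw [this]
    have : ∀ k, ((Complex.arg (rat (Q.v k) (Q.v (nxt k)) z) : ℝ) : Real.Angle)
        = ((Complex.arg (toC (Q.v (nxt k)) - toC z) : ℝ) : Real.Angle)
          - ((Complex.arg (toC (Q.v k) - toC z) : ℝ) : Real.Angle) := fun k =>
      Complex.arg_div_coe_angle (hne _) (hne _)
    simp_rw [this]
    rw [Finset.sum_sub_distrib, nxt_bijective.sum_comp
      (fun k => ((Complex.arg (toC (Q.v k) - toC z) : ℝ) : Real.Angle))]
    simp
  obtain ⟨m, hm⟩ := Real.Angle.angle_eq_iff_two_pi_dvd_sub.mp h1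
  exact ⟨m, by simpa using hm⟩

lemma W_const_lt {Q : SimplePolygon} {S : Set Pt} (hS : IsPreconnected S) (hd : S ⊆ Q.bdryᶜ)
    {x y : Pt} (hx : x ∈ S) (hy : y ∈ S) : ¬ Q.W x < Q.W y := by
  intro hlt
  have hc : ContinuousOn Q.W S := fun z hz => (W_continuousAt (hd hz)).continuousWithinAt
  obtain ⟨m, hm⟩ := W_int (hd hx)
  obtain ⟨n, hn⟩ := W_int (hd hy)
  have hpi := Real.pi_pos
  have hmn : m < n := by
    rw [hm, hn] at hlt
    have := lt_of_mul_lt_mul_left hlt (by positivity)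
    exact_mod_cast this
  have hmn' : (m : ℝ) + 1 ≤ n := by exact_mod_cast hmn
  have hmem : 2 * Real.pi * m + Real.pi ∈ Icc (Q.W x) (Q.W y) := by
    rw [hm, hn]
    constructor <;> nlinarith
  obtain ⟨z, hz, hz1⟩ := hS.intermediate_value hx hy hc hmem
  obtain ⟨k, hk⟩ := W_int (hd hz)
  rw [hk] at hz1
  have h2 : (2 * k : ℝ) = 2 * m + 1 := by
    apply mul_left_cancel₀ hpi.ne'
    linarith
  have h3 : 2 * k = 2 * m + 1 := by exact_mod_cast h2
  omega

lemma W_const {Q : SimplePolygon} {S : Set Pt} (hS : IsPreconnected S) (hd : S ⊆ Q.bdryᶜ)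
    {x y : Pt} (hx : x ∈ S) (hy : y ∈ S) : Q.W x = Q.W y :=
  le_antisymm (not_lt.mp (W_const_lt hS hd hy hx)) (not_lt.mp (W_const_lt hS hd hx hy))

lemma tendsto_toC : Filter.Tendsto toC (Bornology.cobounded Pt) (Bornology.cobounded ℂ) := by
  rw [← tendsto_norm_atTop_iff_cobounded]
  have : (fun p => ‖toC p‖) = fun p : Pt => ‖p‖ := by
    funext p
    rw [EuclideanSpace.norm_eq, Complex.norm_eq_sqrt_sq_add_sq]
    simp [toC]
  rw [this]
  exact tendsto_norm_cobounded_atTop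

lemma W_tendsto (Q : SimplePolygon) : Filter.Tendsto Q.W (Bornology.cobounded Pt) (nhds 0) := by
  have key : ∀ x y : Pt, Filter.Tendsto (fun z => Complex.arg (rat x y z))
      (Bornology.cobounded Pt) (nhds 0) := by
    intro x y
    have h1 : Filter.Tendsto (fun z => rat x y z) (Bornology.cobounded Pt) (nhds 1) := by
      have h2 : Filter.Tendsto (fun w : ℂ => 1 + (toC y - toC x) * (toC x - w)⁻¹)
          (Bornology.cobounded ℂ) (nhds 1) := by
        have h3 : Filter.Tendsto (fun w : ℂ => toC x - w)
            (Bornology.cobounded ℂ) (Bornology.cobounded ℂ) :=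
          tendsto_const_sub_cobounded (toC x)
        have := (tendsto_const_nhds (x := toC y - toC x)).mul (Filter.tendsto_inv₀_cobounded.comp h3)
        simpa using (tendsto_const_nhds (x := (1 : ℂ))).add this
      refine (h2.comp tendsto_toC).congr' ?_
      have hev : ∀ᶠ z : Pt in Bornology.cobounded Pt, z ≠ x := by
        have : Bornology.IsBounded ({x} : Set Pt) := Bornology.isBounded_singleton
        filter_upwards [this] with z hz
        simpa using hz
      filter_upwards [hev] with z hz
      have : toC x - toC z ≠ 0 := fun h0 => hz (toC_inj (sub_eq_zero.mp h0)).symm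
      simp only [Function.comp, rat]
      field_simp
      ring
    have h4 := (Complex.continuousAt_arg Complex.one_mem_slitPlane).tendsto.comp h1
    simpa [Function.comp_def] using h4
  unfold W
  simpa using tendsto_finsetSum (Finset.univ) fun k _ => key (Q.v k) (Q.v (nxt k))

lemma W_eq_zero_of_unbounded {Q : SimplePolygon} {z : Pt} (hz : z ∉ Q.bdry)
    (hu : ¬ Bornology.IsBounded (connectedComponentIn Q.bdryᶜ z)) : Q.W z = 0 := by
  have hpi := Real.pi_pos
  have hev : ∀ᶠ w in Bornology.cobounded Pt, |Q.W w| < Real.pi := by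
    have := (W_tendsto Q).abs
    rw [abs_zero] at this
    exact this.eventually (gt_mem_nhds hpi)
  have hex : ∃ w ∈ connectedComponentIn Q.bdryᶜ z, |Q.W w| < Real.pi := by
    by_contra hno
    push Not at hno
    apply hu
    rw [Bornology.isBounded_def]
    filter_upwards [hev] with w hw hmem
    exact absurd hw (not_lt.mpr (hno w hmem))
  obtain ⟨w, hw, hlt⟩ := hex
  have hsub := connectedComponentIn_subset Q.bdryᶜ z
  rw [W_const isPreconnected_connectedComponentIn hsub (mem_connectedComponentIn hz) hw]
  obtain ⟨m, hm⟩ := W_int (hsub hw)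
  rw [hm] at hlt ⊢
  rw [abs_lt] at hlt
  have h1 : (m : ℝ) < 1 := by nlinarith
  have h2 : (-1 : ℝ) < m := by nlinarith
  have h1' : m < 1 := by exact_mod_cast h1
  have h2' : -1 < m := by exact_mod_cast h2
  have : m = 0 := by omega
  simp [this]

lemma W_eq_zero_of_notMem {Q : SimplePolygon} {z : Pt} (hz : z ∉ Q.body) : Q.W z = 0 := by
  have h1 : z ∉ Q.bdry := fun h => hz (Or.inl h)
  exact W_eq_zero_of_unbounded h1 fun h => hz (Or.inr ⟨h1, h⟩)

/-- Rotation by a right angle. -/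
def rot (a : Pt) : Pt := !₂[-a 1, a 0]

lemma jump (Q : SimplePolygon) (k : Fin Q.n) (s : ℝ) (hs0 : 0 < s) (hs1 : s < 1) (m : Pt)
    (hm : m = Q.v k + s • (Q.v (nxt k) - Q.v k))
    (ho : ∀ j, j ≠ k → m ∉ Q.edge j)
    (hp : ∀ᶠ δ : ℝ in nhdsWithin 0 (Ioi 0), Q.W (m + δ • rot (Q.v (nxt k) - Q.v k)) = 0)
    (hq : ∀ᶠ δ : ℝ in nhdsWithin 0 (Iio 0), Q.W (m + δ • rot (Q.v (nxt k) - Q.v k)) = 0) :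
    False := by
  set x := Q.v k with hx
  set y := Q.v (nxt k) with hy
  have hxy : x ≠ y := fun h => nxt_ne Q.hn k (Q.inj h.symm)
  have hne : toC y - toC x ≠ 0 := fun h => hxy (toC_inj (sub_eq_zero.mp h)).symm
  set R : ℝ → ℂ := fun δ => ⟨-((1 - s) * s - δ ^ 2) / (s ^ 2 + δ ^ 2), δ / (s ^ 2 + δ ^ 2)⟩ with hR
  have hrat : ∀ δ : ℝ, rat x y (m + δ • rot (y - x)) = R δ := by
    intro δ
    have hpos : s ^ 2 + δ ^ 2 ≠ 0 := by positivity
    have hA : toC y - toC (m + δ • rot (y - x)) = (toC y - toC x) * ⟨1 - s, -δ⟩ := by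
      rw [hm]
      apply Complex.ext <;> simp [toC, rot] <;> ring
    have hB : toC x - toC (m + δ • rot (y - x)) = (toC y - toC x) * ⟨-s, -δ⟩ := by
      rw [hm]
      apply Complex.ext <;> simp [toC, rot] <;> ring
    have hsd : (⟨-s, -δ⟩ : ℂ) ≠ 0 := by
      intro h
      have := congrArg Complex.re h
      simp at this
      linarith
    unfold rat
    rw [hA, hB, mul_div_mul_left _ _ hne, div_eq_iff hsd]
    apply Complex.ext
    · simp [hR]; field_simp; ring
    · simp [hR]; field_simp; ring
  have hR0 : R 0 = ⟨-((1 - s) * s) / s ^ 2, 0⟩ := by simp [hR]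
  have hre : (R 0).re < 0 := by
    rw [hR0]
    have : 0 < (1 - s) * s := mul_pos (by linarith) hs0
    simp only
    exact div_neg_of_neg_of_pos (by linarith) (by positivity)
  have him : (R 0).im = 0 := by rw [hR0]
  have hRc : Continuous R := by
    have : R = fun δ : ℝ => ((-((1 - s) * s - δ ^ 2) / (s ^ 2 + δ ^ 2) : ℝ) : ℂ)
        + ((δ / (s ^ 2 + δ ^ 2) : ℝ) : ℂ) * Complex.I := by
      funext δ
      apply Complex.ext <;> simp [hR, -Complex.ofReal_div, -Complex.ofReal_mul, -Complex.ofReal_neg]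
    rw [this]
    have hpos : ∀ δ : ℝ, s ^ 2 + δ ^ 2 ≠ 0 := fun δ => by positivity
    have h1 : Continuous fun δ : ℝ => -((1 - s) * s - δ ^ 2) / (s ^ 2 + δ ^ 2) :=
      Continuous.div (by fun_prop) (by fun_prop) hpos
    have h2 : Continuous fun δ : ℝ => δ / (s ^ 2 + δ ^ 2) :=
      Continuous.div (by fun_prop) (by fun_prop) hpos
    exact (Complex.continuous_ofReal.comp h1).add
      ((Complex.continuous_ofReal.comp h2).mul continuous_const)
  set S : Pt → ℝ := fun z => ∑ j ∈ Finset.univ.erase k,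
    Complex.arg (rat (Q.v j) (Q.v (nxt j)) z) with hS
  have hWS : ∀ z, Q.W z = Complex.arg (rat x y z) + S z := by
    intro z
    rw [hS, hx, hy]
    exact (Finset.add_sum_erase _ (fun j => Complex.arg (rat (Q.v j) (Q.v (nxt j)) z))
      (Finset.mem_univ k)).symm
  have hSc : ContinuousAt S m := by
    refine tendsto_finsetSum _ fun j hj => rat_continuousAt (ho j ?_)
    simpa using hj
  have hpath : Continuous fun δ : ℝ => m + δ • rot (y - x) := by fun_prop
  have hSt : Filter.Tendsto (fun δ : ℝ => S (m + δ • rot (y - x))) (nhds 0) (nhds (S m)) := by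
    have h1 : Filter.Tendsto (fun δ : ℝ => m + δ • rot (y - x)) (nhds 0) (nhds m) := by
      simpa using hpath.tendsto 0
    exact hSc.tendsto.comp h1
  have l1 : Filter.Tendsto (fun δ => Complex.arg (R δ)) (nhdsWithin 0 (Ioi 0)) (nhds Real.pi) := by
    refine (Complex.tendsto_arg_nhdsWithin_im_nonneg_of_re_neg_of_im_zero hre him).comp ?_
    refine tendsto_nhdsWithin_iff.mpr ⟨(hRc.tendsto 0).mono_left nhdsWithin_le_nhds, ?_⟩
    filter_upwards [self_mem_nhdsWithin] with δ hδ
    have : 0 < δ := hδ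
    change 0 ≤ δ / (s ^ 2 + δ ^ 2)
    positivity
  have l2 : Filter.Tendsto (fun δ => Complex.arg (R δ)) (nhdsWithin 0 (Iio 0))
      (nhds (-Real.pi)) := by
    refine (Complex.tendsto_arg_nhdsWithin_im_neg_of_re_neg_of_im_zero hre him).comp ?_
    refine tendsto_nhdsWithin_iff.mpr ⟨(hRc.tendsto 0).mono_left nhdsWithin_le_nhds, ?_⟩
    filter_upwards [self_mem_nhdsWithin] with δ hδ
    have : δ < 0 := hδ
    change δ / (s ^ 2 + δ ^ 2) < 0
    exact div_neg_of_neg_of_pos this (by positivity)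
  have e1 : Real.pi + S m = 0 := by
    refine tendsto_nhds_unique (l1.add (hSt.mono_left nhdsWithin_le_nhds)) ?_
    refine tendsto_const_nhds.congr' ?_
    filter_upwards [hp] with δ hδ
    rw [← hδ, hWS, hrat]
  have e2 : -Real.pi + S m = 0 := by
    refine tendsto_nhds_unique (l2.add (hSt.mono_left nhdsWithin_le_nhds)) ?_
    refine tendsto_const_nhds.congr' ?_
    filter_upwards [hq] with δ hδ
    rw [← hδ, hWS, hrat]
  have := Real.pi_pos
  linarith

lemma jump' (Q : SimplePolygon) (k : Fin Q.n) (V A : Pt)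
    (hk : (Q.v k = V ∧ Q.v (nxt k) = A) ∨ (Q.v k = A ∧ Q.v (nxt k) = V))
    (s : ℝ) (hs0 : 0 < s) (hs1 : s < 1)
    (ho : ∀ j, j ≠ k → V + s • (A - V) ∉ Q.edge j)
    (hp : ∀ᶠ δ : ℝ in nhdsWithin 0 (Ioi 0), Q.W (V + s • (A - V) + δ • rot (A - V)) = 0)
    (hq : ∀ᶠ δ : ℝ in nhdsWithin 0 (Iio 0), Q.W (V + s • (A - V) + δ • rot (A - V)) = 0) :
    False := by
  rcases hk with ⟨h1, h2⟩ | ⟨h1, h2⟩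
  · refine jump Q k s hs0 hs1 _ (by rw [h1, h2]) ho ?_ ?_
    · rw [h1, h2]; exact hp
    · rw [h1, h2]; exact hq
  · have hrot : ∀ δ : ℝ, δ • rot (V - A) = (-δ) • rot (A - V) := by
      intro δ
      apply pt_ext <;> simp [rot] <;> ring
    refine jump Q k (1 - s) (by linarith) (by linarith) (V + s • (A - V)) ?_ ho ?_ ?_
    · rw [h1, h2]
      apply pt_ext <;> simp <;> ring
    · rw [h1, h2]
      have ht : Filter.Tendsto (fun δ : ℝ => -δ) (nhdsWithin 0 (Ioi 0)) (nhdsWithin 0 (Iio 0)) := by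
        have := tendsto_neg_nhdsGT (a := (0 : ℝ))
        simpa using this
      filter_upwards [ht.eventually hq] with δ hδ
      rw [hrot]; exact hδ
    · rw [h1, h2]
      have ht : Filter.Tendsto (fun δ : ℝ => -δ) (nhdsWithin 0 (Iio 0)) (nhdsWithin 0 (Ioi 0)) := by
        have := tendsto_neg_nhdsLT (a := (0 : ℝ))
        simpa using this
      filter_upwards [ht.eventually hp] with δ hδ
      rw [hrot]; exact hδ

/-- An affine functional vanishing at `V`, in coordinates. -/
def crs (p q : ℝ) (V z : Pt) : ℝ := p * (z 1 - V 1) - q * (z 0 - V 0)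

lemma crs_comb (p q : ℝ) (V x y : Pt) (s t : ℝ) (h : s + t = 1) :
    crs p q V (s • x + t • y) = s * crs p q V x + t * crs p q V y := by
  have : t = 1 - s := by linarith
  subst this
  simp [crs]; ring

lemma convex_crs_pos (p q : ℝ) (V : Pt) : Convex ℝ {z | 0 < crs p q V z} := by
  intro x hx y hy s t hs ht hst
  simp only [mem_setOf_eq] at *
  rw [crs_comb _ _ _ _ _ _ _ hst]
  rcases hs.eq_or_lt with h | h
  · have : t = 1 := by linarith
    subst this; subst h; linarith
  · have := mul_pos h hx
    have := mul_nonneg ht hy.le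
    linarith

lemma convex_crs_nonneg (p q : ℝ) (V : Pt) : Convex ℝ {z | 0 ≤ crs p q V z} := by
  intro x hx y hy s t hs ht hst
  simp only [mem_setOf_eq] at *
  rw [crs_comb _ _ _ _ _ _ _ hst]
  have := mul_nonneg hs hx
  have := mul_nonneg ht hy
  linarith

lemma exw (a0 a1 f0 f1 : ℝ) (ha : 0 < a0 ^ 2 + a1 ^ 2) (hf : 0 < f0 ^ 2 + f1 ^ 2)
    (h : f0 * a0 + f1 * a1 < 0 ∨ 0 < f0 * a1 - f1 * a0) :
    ∃ x y, a0 * y - a1 * x < 0 ∧ 0 < f0 * x + f1 * y := by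
  by_cases hg : 0 < f0 * a1 - f1 * a0
  · exact ⟨f0, f1, by linarith, by nlinarith⟩
  · have h1 : f0 * a0 + f1 * a1 < 0 := by tauto
    obtain ⟨N, hN⟩ : ∃ N : ℝ, N * -(f0 * a0 + f1 * a1) = 1 - (f0 * a1 - f1 * a0) :=
      ⟨(1 - (f0 * a1 - f1 * a0)) / -(f0 * a0 + f1 * a1), div_mul_cancel₀ _ (by linarith)⟩
    exact ⟨-N * a0 + a1, -N * a1 - a0, by nlinarith, by nlinarith⟩

lemma mem_seg_s12 {V A z : Pt} {s : ℝ} (hs : 0 ≤ s) (h0 : z 0 - V 0 = s * (A 0 - V 0))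
    (h1 : z 1 - V 1 = s * (A 1 - V 1)) (hd : dist z V < dist A V) : z ∈ segment ℝ V A := by
  have hz : z = V + s • (A - V) := by
    apply pt_ext <;> simp <;> linarith
  have hs1 : s ≤ 1 := by
    rw [hz, dist_eq_norm, dist_eq_norm, add_sub_cancel_left, norm_smul, Real.norm_eq_abs,
      abs_of_nonneg hs] at hd
    by_contra hc
    push Not at hc
    nlinarith [norm_nonneg (A - V)]
  rw [segment_eq_image']
  exact ⟨s, ⟨hs, hs1⟩, hz.symm⟩

lemma notMem_body_of (Q : SimplePolygon) (V : Pt) (ε : ℝ) (hε : 0 < ε) (p q f0 f1 : ℝ)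
    (hsup : ∀ z ∈ Q.body, f0 * (z 0 - V 0) + f1 * (z 1 - V 1) ≤ 0)
    (hd : ∀ z ∈ ball V ε, 0 < crs p q V z → z ∉ Q.bdry)
    (hw : ∃ x y, 0 < p * y - q * x ∧ 0 < f0 * x + f1 * y)
    (z : Pt) (hz : z ∈ ball V ε) (hz1 : 0 < crs p q V z) : z ∉ Q.body := by
  intro hzb
  obtain ⟨x, y, h1, h2⟩ := hw
  have hc : Continuous fun t : ℝ => V + t • (!₂[x, y] : Pt) := by fun_prop
  have hev : ∀ᶠ t : ℝ in nhdsWithin 0 (Ioi 0), V + t • (!₂[x, y] : Pt) ∈ ball V ε := by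
    apply nhdsWithin_le_nhds
    apply hc.tendsto 0
    apply isOpen_ball.mem_nhds
    simpa using hε
  obtain ⟨t, ht, ht0⟩ := (hev.and self_mem_nhdsWithin).exists
  have ht0 : 0 < t := ht0
  set w := V + t • (!₂[x, y] : Pt) with hwdef
  have w0 : w 0 - V 0 = t * x := by simp [hwdef]
  have w1 : w 1 - V 1 = t * y := by simp [hwdef]
  have hwL : 0 < crs p q V w := by
    unfold crs
    rw [w0, w1]
    have := mul_pos ht0 h1
    linarith
  have hwnb : w ∉ Q.body := by
    intro h
    have := hsup w h
    rw [w0, w1] at this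
    have := mul_pos ht0 h2
    linarith
  have hpc : IsPreconnected (ball V ε ∩ {z | 0 < crs p q V z}) :=
    ((convex_ball V ε).inter (convex_crs_pos p q V)).isPreconnected
  have hsub : ball V ε ∩ {z | 0 < crs p q V z} ⊆ Q.bdryᶜ := fun u hu => hd u hu.1 hu.2
  have hwc := hpc.subset_connectedComponentIn ⟨hz, hz1⟩ hsub ⟨ht, hwL⟩
  rcases hzb with hzb | hzb
  · exact hd z hz hz1 hzb
  · apply hwnb
    refine Or.inr ⟨hd w ht hwL, ?_⟩
    rw [← connectedComponentIn_eq hwc]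
    exact hzb.2

lemma sq_pos_of_ne {A V : Pt} (h : A ≠ V) : 0 < (A 0 - V 0) ^ 2 + (A 1 - V 1) ^ 2 := by
  by_contra hc
  apply h
  apply pt_ext <;> nlinarith [sq_nonneg (A 0 - V 0), sq_nonneg (A 1 - V 1)]

lemma core (Q : SimplePolygon) (V A B : Pt) (k1 k2 : Fin Q.n)
    (hk1 : (Q.v k1 = V ∧ Q.v (nxt k1) = A) ∨ (Q.v k1 = A ∧ Q.v (nxt k1) = V))
    (h2 : Q.edge k2 = segment ℝ V B)
    (hint : Q.edge k1 ∩ Q.edge k2 = {V}) (hA : A ≠ V) (hB : B ≠ V)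
    (ε : ℝ) (hε : 0 < ε)
    (hoth : ∀ k, k ≠ k1 → k ≠ k2 → ∀ z ∈ ball V ε, z ∉ Q.edge k)
    (hεA : ε ≤ dist A V) (hεB : ε ≤ dist B V)
    (f0 f1 : ℝ) (hf : 0 < f0 ^ 2 + f1 ^ 2)
    (hsup : ∀ z ∈ Q.body, f0 * (z 0 - V 0) + f1 * (z 1 - V 1) ≤ 0)
    (hor : 0 < (A 0 - V 0) * (B 1 - V 1) - (A 1 - V 1) * (B 0 - V 0) ∨
      ∃ t > 0, B 0 - V 0 = -t * (A 0 - V 0) ∧ B 1 - V 1 = -t * (A 1 - V 1) ∧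
        0 < f0 * (A 1 - V 1) - f1 * (A 0 - V 0)) :
    Convex ℝ (Q.body ∩ ball V ε) := by
  have h1 : Q.edge k1 = segment ℝ V A := by
    unfold edge
    rcases hk1 with ⟨e1, e2⟩ | ⟨e1, e2⟩
    · rw [e1, e2]
    · rw [e1, e2, segment_symm]
  have hAb : A ∈ Q.body :=
    Or.inl (mem_iUnion.mpr ⟨k1, by rw [h1]; exact right_mem_segment ℝ _ _⟩)
  have hBb : B ∈ Q.body :=
    Or.inl (mem_iUnion.mpr ⟨k2, by rw [h2]; exact right_mem_segment ℝ _ _⟩)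
  have hfA := hsup A hAb
  have hfB := hsup B hBb
  have hA2 := sq_pos_of_ne hA
  have hB2 := sq_pos_of_ne hB
  obtain ⟨a0, ha0⟩ : ∃ a0, a0 = A 0 - V 0 := ⟨_, rfl⟩
  obtain ⟨a1, ha1⟩ : ∃ a1, a1 = A 1 - V 1 := ⟨_, rfl⟩
  obtain ⟨b0, hb0⟩ : ∃ b0, b0 = B 0 - V 0 := ⟨_, rfl⟩
  obtain ⟨b1, hb1⟩ : ∃ b1, b1 = B 1 - V 1 := ⟨_, rfl⟩
  rw [← ha0, ← ha1] at hfA hA2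
  rw [← hb0, ← hb1] at hfB hB2
  rw [← ha0, ← ha1, ← hb0, ← hb1] at hor
  have hcr : 0 ≤ a0 * b1 - a1 * b0 := by
    rcases hor with h | ⟨t, ht, e0, e1, -⟩
    · exact h.le
    · rw [e0, e1]; apply le_of_eq; ring
  -- boundary points in the ball
  have hbd : ∀ z ∈ ball V ε, z ∈ Q.bdry → 0 ≤ crs a0 a1 V z ∧ 0 ≤ crs (-b0) (-b1) V z ∧
      (crs a0 a1 V z = 0 ∨ crs (-b0) (-b1) V z = 0) := by
    intro z hz hzb
    obtain ⟨k, hk⟩ := mem_iUnion.mp hzb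
    have hcase : z ∈ segment ℝ V A ∨ z ∈ segment ℝ V B := by
      by_cases e1 : k = k1
      · left; rw [← h1, ← e1]; exact hk
      · by_cases e2 : k = k2
        · right; rw [← h2, ← e2]; exact hk
        · exact absurd hk (hoth k e1 e2 z hz)
    rcases hcase with h | h
    · rw [segment_eq_image'] at h
      obtain ⟨s, ⟨hs, -⟩, rfl⟩ := h
      have e1 : crs a0 a1 V (V + s • (A - V)) = 0 := by
        simp [crs, ← ha0, ← ha1]; ring
      have e2 : crs (-b0) (-b1) V (V + s • (A - V)) = s * (a0 * b1 - a1 * b0) := by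
        simp [crs, ← ha0, ← ha1]; ring
      exact ⟨e1.ge, by rw [e2]; exact mul_nonneg hs hcr, Or.inl e1⟩
    · rw [segment_eq_image'] at h
      obtain ⟨s, ⟨hs, -⟩, rfl⟩ := h
      have e1 : crs a0 a1 V (V + s • (B - V)) = s * (a0 * b1 - a1 * b0) := by
        simp [crs, ← hb0, ← hb1]; ring
      have e2 : crs (-b0) (-b1) V (V + s • (B - V)) = 0 := by
        simp [crs, ← hb0, ← hb1]; ring
      exact ⟨by rw [e1]; exact mul_nonneg hs hcr, e2.ge, Or.inr e2⟩
  have hga : f0 * a0 + f1 * a1 < 0 ∨ 0 < f0 * a1 - f1 * a0 := by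
    rcases hor with h | ⟨t, ht, e0, e1, hg⟩
    · by_contra hno
      push Not at hno
      have z1 : f0 * a0 + f1 * a1 = 0 := le_antisymm hfA hno.1
      have i1 : (f0 * b0 + f1 * b1) * (a0 ^ 2 + a1 ^ 2)
          = (f0 * a0 + f1 * a1) * (a0 * b0 + a1 * b1)
            - (f0 * a1 - f1 * a0) * (a0 * b1 - a1 * b0) := by ring
      have i2 : (f0 ^ 2 + f1 ^ 2) * (a0 ^ 2 + a1 ^ 2)
          = (f0 * a0 + f1 * a1) ^ 2 + (f0 * a1 - f1 * a0) ^ 2 := by ring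
      have p1 := mul_pos hf hA2
      have p2 := mul_nonpos_of_nonpos_of_nonneg hfB hA2.le
      rw [i1, z1, zero_mul, zero_sub] at p2
      rw [i2, z1] at p1
      have hneg : f0 * a1 - f1 * a0 < 0 := lt_of_le_of_ne hno.2 (fun h => by rw [h] at p1; simp at p1)
      have := mul_pos (neg_pos.mpr hneg) h
      linarith
    · exact Or.inr hg
  have hgb : f1 * b1 + f0 * b0 < 0 ∨ 0 < f1 * b0 - f0 * b1 := by
    rcases hor with h | ⟨t, ht, e0, e1, hg⟩
    · by_contra hno
      push Not at hno
      have z1 : f0 * b0 + f1 * b1 = 0 := le_antisymm hfB (by linarith [hno.1])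
      have i1 : (f0 * a0 + f1 * a1) * (b0 ^ 2 + b1 ^ 2)
          = (f0 * b0 + f1 * b1) * (a0 * b0 + a1 * b1)
            - (f1 * b0 - f0 * b1) * (a0 * b1 - a1 * b0) := by ring
      have i2 : (f0 ^ 2 + f1 ^ 2) * (b0 ^ 2 + b1 ^ 2)
          = (f0 * b0 + f1 * b1) ^ 2 + (f1 * b0 - f0 * b1) ^ 2 := by ring
      have p1 := mul_pos hf hB2
      have p2 := mul_nonpos_of_nonpos_of_nonneg hfA hB2.le
      rw [i1, z1, zero_mul, zero_sub] at p2
      rw [i2, z1] at p1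
      have hneg : f1 * b0 - f0 * b1 < 0 := lt_of_le_of_ne hno.2 (fun h => by rw [h] at p1; simp at p1)
      have := mul_pos (neg_pos.mpr hneg) h
      linarith
    · right
      rw [e0, e1]
      have := mul_pos ht hg
      linarith
  -- points outside the closed cone
  have hneg_crs : ∀ p q z, crs (-p) (-q) V z = - crs p q V z := by
    intro p q z; unfold crs; ring
  have hout1 : ∀ z ∈ ball V ε, crs a0 a1 V z < 0 → z ∉ Q.body := by
    intro z hz hz1
    refine notMem_body_of Q V ε hε (-a0) (-a1) f0 f1 hsup ?_ ?_ z hz ?_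
    · intro u hu hu1 hub
      rw [hneg_crs] at hu1
      linarith [(hbd u hu hub).1]
    · obtain ⟨x, y, q1, q2⟩ := exw a0 a1 f0 f1 hA2 hf hga
      exact ⟨x, y, by linarith, q2⟩
    · rw [hneg_crs]; linarith
  have hout2 : ∀ z ∈ ball V ε, crs (-b0) (-b1) V z < 0 → z ∉ Q.body := by
    intro z hz hz1
    refine notMem_body_of Q V ε hε b0 b1 f0 f1 hsup ?_ ?_ z hz ?_
    · intro u hu hu1 hub
      have := (hbd u hu hub).2.1
      rw [hneg_crs] at this
      linarith
    · obtain ⟨x, y, q1, q2⟩ := exw b1 b0 f1 f0 (by linarith) (by linarith) hgb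
      exact ⟨y, x, by linarith, by linarith⟩
    · rw [hneg_crs] at hz1; linarith
  -- points of the open cone
  have hin : ∀ z ∈ ball V ε, 0 < crs a0 a1 V z → 0 < crs (-b0) (-b1) V z → z ∈ Q.body := by
    intro z hz hz1 hz2
    by_contra hzb
    have hWz := W_eq_zero_of_notMem hzb
    set D := ball V ε ∩ ({z | 0 < crs a0 a1 V z} ∩ {z | 0 < crs (-b0) (-b1) V z}) with hD
    have hDc : IsPreconnected D := ((convex_ball V ε).inter
      ((convex_crs_pos a0 a1 V).inter (convex_crs_pos (-b0) (-b1) V))).isPreconnected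
    have hDs : D ⊆ Q.bdryᶜ := by
      intro u hu hub
      obtain ⟨q1, q2, q3⟩ := hu
      have q2 : 0 < crs a0 a1 V u := q2
      have q3 : 0 < crs (-b0) (-b1) V u := q3
      rcases (hbd u q1 hub).2.2 with h | h <;> linarith
    have hWD : ∀ u ∈ D, Q.W u = 0 := by
      intro u hu
      rw [← hWz]
      exact W_const hDc hDs hu ⟨hz, hz1, hz2⟩
    have hex : ∃ s : ℝ, 0 < s ∧ s < 1 ∧ V + s • (A - V) ∈ ball V ε := by
      have hc : Continuous fun t : ℝ => V + t • (A - V) := by fun_prop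
      have hev : ∀ᶠ t : ℝ in nhdsWithin 0 (Ioi 0), V + t • (A - V) ∈ ball V ε := by
        apply nhdsWithin_le_nhds
        apply hc.tendsto 0
        apply isOpen_ball.mem_nhds
        simpa using hε
      have hev1 : ∀ᶠ t : ℝ in nhdsWithin 0 (Ioi 0), t < 1 :=
        nhdsWithin_le_nhds (gt_mem_nhds one_pos)
      obtain ⟨t, ⟨q1, q2⟩, q3⟩ := ((hev.and hev1).and self_mem_nhdsWithin).exists
      exact ⟨t, q3, q2, q1⟩
    obtain ⟨s, hs0, hs1, hsb⟩ := hex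
    have hc : Continuous fun δ : ℝ => V + s • (A - V) + δ • rot (A - V) := by fun_prop
    have hball : ∀ᶠ δ : ℝ in nhds 0, V + s • (A - V) + δ • rot (A - V) ∈ ball V ε := by
      apply hc.tendsto 0
      apply isOpen_ball.mem_nhds
      simpa using hsb
    have c1 : ∀ δ : ℝ, crs a0 a1 V (V + s • (A - V) + δ • rot (A - V))
        = δ * (a0 ^ 2 + a1 ^ 2) := by
      intro δ
      simp [crs, rot, ← ha0, ← ha1]; ring
    have c2 : ∀ δ : ℝ, crs (-b0) (-b1) V (V + s • (A - V) + δ • rot (A - V))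
        = s * (a0 * b1 - a1 * b0) - δ * (a0 * b0 + a1 * b1) := by
      intro δ
      simp [crs, rot, ← ha0, ← ha1]; ring
    refine jump' Q k1 V A hk1 s hs0 hs1 ?_ ?_ ?_
    · intro j hj hmem
      by_cases e2 : j = k2
      · have : V + s • (A - V) ∈ Q.edge k1 ∩ Q.edge k2 := by
          refine ⟨?_, by rw [← e2]; exact hmem⟩
          rw [h1, segment_eq_image']
          exact ⟨s, ⟨hs0.le, hs1.le⟩, rfl⟩
        rw [hint] at this
        have h3 : s • (A - V) = 0 := by simpa using this
        rcases smul_eq_zero.mp h3 with h | h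
        · linarith
        · exact hA (sub_eq_zero.mp h)
      · exact hoth j hj e2 _ hsb hmem
    · have hpos2 : ∀ᶠ δ : ℝ in nhdsWithin 0 (Ioi 0),
          0 < s * (a0 * b1 - a1 * b0) - δ * (a0 * b0 + a1 * b1) := by
        rcases hor with h | ⟨t, ht, e0, e1, -⟩
        · apply nhdsWithin_le_nhds
          have hcc : Continuous fun δ : ℝ =>
            s * (a0 * b1 - a1 * b0) - δ * (a0 * b0 + a1 * b1) := by fun_prop
          refine hcc.tendsto 0 (lt_mem_nhds ?_)
          simpa using mul_pos hs0 h
        · filter_upwards [self_mem_nhdsWithin] with δ hδ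
          have hδ : 0 < δ := hδ
          rw [e0, e1]
          have := mul_pos (mul_pos hδ ht) hA2
          linarith
      filter_upwards [nhdsWithin_le_nhds hball, hpos2, self_mem_nhdsWithin] with δ q1 q2 q3
      apply hWD
      refine ⟨q1, ?_, ?_⟩
      · change 0 < crs a0 a1 V _
        rw [c1]; exact mul_pos q3 hA2
      · change 0 < crs (-b0) (-b1) V _
        rw [c2]; exact q2
    · filter_upwards [nhdsWithin_le_nhds hball, self_mem_nhdsWithin] with δ q1 q3
      apply W_eq_zero_of_notMem
      apply hout1 _ q1
      rw [c1]
      exact mul_neg_of_neg_of_pos q3 hA2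
  -- points on the rays
  have hray : ∀ z ∈ ball V ε, 0 ≤ crs a0 a1 V z → 0 ≤ crs (-b0) (-b1) V z →
      (crs a0 a1 V z = 0 ∨ crs (-b0) (-b1) V z = 0) → z ∈ Q.body := by
    intro z hz hz1 hz2 hz3
    have hdA : dist z V < dist A V := lt_of_lt_of_le hz hεA
    have hdB : dist z V < dist B V := lt_of_lt_of_le hz hεB
    suffices h : z ∈ segment ℝ V A ∨ z ∈ segment ℝ V B by
      rcases h with h | h
      · exact Or.inl (mem_iUnion.mpr ⟨k1, by rw [h1]; exact h⟩)
      · exact Or.inl (mem_iUnion.mpr ⟨k2, by rw [h2]; exact h⟩)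
    obtain ⟨x, hx⟩ : ∃ x, x = z 0 - V 0 := ⟨_, rfl⟩
    obtain ⟨y, hy⟩ : ∃ y, y = z 1 - V 1 := ⟨_, rfl⟩
    simp only [crs, ← hx, ← hy] at hz1 hz2 hz3
    rcases hz3 with h | h
    · obtain ⟨s, hs⟩ : ∃ s, s * (a0 ^ 2 + a1 ^ 2) = x * a0 + y * a1 :=
        ⟨_, div_mul_cancel₀ _ hA2.ne'⟩
      have ex : x = s * a0 := by
        apply mul_right_cancel₀ hA2.ne'
        linear_combination (-a0) * hs - a1 * h
      have ey : y = s * a1 := by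
        apply mul_right_cancel₀ hA2.ne'
        linear_combination (-a1) * hs + a0 * h
      rcases le_or_gt 0 s with h0 | h0
      · left
        exact mem_seg_s12 h0 (by rw [← hx, ← ha0, ex]) (by rw [← hy, ← ha1, ey]) hdA
      · right
        rcases hor with hc | ⟨t, ht, e0, e1, -⟩
        · exfalso
          rw [ex, ey] at hz2
          have := mul_pos (neg_pos.mpr h0) hc
          linarith
        · refine mem_seg_s12 (s := -s / t) (div_nonneg (by linarith) ht.le) ?_ ?_ hdB
          · rw [← hx, ← hb0, ex, e0]; field_simp
          · rw [← hy, ← hb1, ey, e1]; field_simp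
    · obtain ⟨s, hs⟩ : ∃ s, s * (b0 ^ 2 + b1 ^ 2) = x * b0 + y * b1 :=
        ⟨_, div_mul_cancel₀ _ hB2.ne'⟩
      have ex : x = s * b0 := by
        apply mul_right_cancel₀ hB2.ne'
        linear_combination (-b0) * hs + b1 * h
      have ey : y = s * b1 := by
        apply mul_right_cancel₀ hB2.ne'
        linear_combination (-b1) * hs - b0 * h
      rcases le_or_gt 0 s with h0 | h0
      · right
        exact mem_seg_s12 h0 (by rw [← hx, ← hb0, ex]) (by rw [← hy, ← hb1, ey]) hdB
      · left
        rcases hor with hc | ⟨t, ht, e0, e1, -⟩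
        · exfalso
          rw [ex, ey] at hz1
          have := mul_pos (neg_pos.mpr h0) hc
          linarith
        · refine mem_seg_s12 (s := -s * t) (mul_nonneg (by linarith) ht.le) ?_ ?_ hdA
          · rw [← hx, ← ha0, ex, e0]; ring
          · rw [← hy, ← ha1, ey, e1]; ring
  have heq : Q.body ∩ ball V ε =
      ({z | 0 ≤ crs a0 a1 V z} ∩ {z | 0 ≤ crs (-b0) (-b1) V z}) ∩ ball V ε := by
    ext z
    constructor
    · rintro ⟨q1, q2⟩
      refine ⟨⟨?_, ?_⟩, q2⟩
      · by_contra hc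
        exact hout1 z q2 (not_le.mp hc) q1
      · by_contra hc
        exact hout2 z q2 (not_le.mp hc) q1
    · rintro ⟨⟨q1, q2⟩, q3⟩
      refine ⟨?_, q3⟩
      have q1 : 0 ≤ crs a0 a1 V z := q1
      have q2 : 0 ≤ crs (-b0) (-b1) V z := q2
      rcases q1.eq_or_lt with h | h
      · exact hray z q3 q1 q2 (Or.inl h.symm)
      · rcases q2.eq_or_lt with h' | h'
        · exact hray z q3 q1 q2 (Or.inr h'.symm)
        · exact hin z q3 h h'
  rw [heq]
  exact ((convex_crs_nonneg a0 a1 V).inter (convex_crs_nonneg (-b0) (-b1) V)).inter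
    (convex_ball V ε)

/-- A supporting functional at a point of a set that is not interior to the convex hull. -/
lemma exists_support (K : Set Pt) (V : Pt) (hV : V ∈ K) (h : V ∉ interior (convexHull ℝ K)) :
    ∃ f : Pt →ₗ[ℝ] ℝ, f ≠ 0 ∧ ∀ z ∈ K, f z ≤ f V := by
  by_cases hne : (interior (convexHull ℝ K)).Nonempty
  · obtain ⟨f, hf⟩ := geometric_hahn_banach_open_point
      (convex_convexHull ℝ K).interior isOpen_interior h
    refine ⟨f.toLinearMap, ?_, ?_⟩
    · intro h0
      obtain ⟨w, hw⟩ := hne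
      have h1 : ∀ z, f z = 0 := fun z => congrArg (fun g : Pt →ₗ[ℝ] ℝ => g z) h0
      have := hf w hw
      rw [h1, h1] at this
      exact lt_irrefl _ this
    · intro z hz
      have hzc : z ∈ closure (interior (convexHull ℝ K)) := by
        rw [(convex_convexHull ℝ K).closure_interior_eq_closure_of_nonempty_interior hne]
        exact subset_closure (subset_convexHull ℝ K hz)
      have hcl : IsClosed {z | f z ≤ f V} := isClosed_le f.continuous continuous_const
      exact closure_minimal (fun w hw => (hf w hw).le) hcl hzc
  · rw [interior_convexHull_nonempty_iff_affineSpan_eq_top] at hne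
    have hdir : (affineSpan ℝ K).direction < ⊤ := by
      rw [lt_top_iff_ne_top]
      intro hd
      apply hne
      exact (AffineSubspace.direction_eq_top_iff_of_nonempty
        ⟨V, subset_affineSpan ℝ K hV⟩).mp hd
    obtain ⟨f, hf0, hf⟩ := Submodule.exists_le_ker_of_lt_top _ hdir
    refine ⟨f, hf0, fun z hz => ?_⟩
    have := hf (AffineSubspace.vsub_mem_direction (subset_affineSpan ℝ K hz)
      (subset_affineSpan ℝ K hV))
    rw [LinearMap.mem_ker, vsub_eq_sub, map_sub] at this
    linarith

lemma locallyConvex_of_support (Q : SimplePolygon) (i : Fin Q.n)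
    (h : Q.v i ∉ interior (convexHull ℝ Q.body)) : Q.LocallyConvexAt i := by
  obtain ⟨j, hj⟩ := nxt_bijective.2 i
  set V := Q.v i with hV
  set A := Q.v (nxt i) with hAdef
  set B := Q.v j with hBdef
  have hji : j ≠ i := by
    intro e; rw [e] at hj; exact nxt_ne Q.hn i hj
  have hA : A ≠ V := fun e => nxt_ne Q.hn i (Q.inj e)
  have hB : B ≠ V := fun e => hji (Q.inj e)
  have hVb : V ∈ Q.body :=
    Or.inl (mem_iUnion.mpr ⟨i, left_mem_segment ℝ _ _⟩)
  have hei : Q.edge i = segment ℝ V A := rfl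
  have hej' : Q.edge j = segment ℝ B V := by unfold edge; rw [hj]
  have hej : Q.edge j = segment ℝ V B := by rw [hej', segment_symm]
  have hint : Q.edge j ∩ Q.edge i = {V} := by
    have := Q.adj j
    rw [hj] at this
    rw [hei, hej']; exact this
  have hVoth : ∀ k, k ≠ i → k ≠ j → V ∉ Q.edge k := by
    intro k hki hkj hmem
    have hVi : V ∈ Q.edge i := left_mem_segment ℝ _ _
    by_cases e : k = nxt i
    · have := Q.adj i
      rw [← e] at this
      have hm : V ∈ ({Q.v k} : Set Pt) := by
        rw [← this]
        exact ⟨by rw [e]; exact hVi, hmem⟩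
      rw [e] at hm
      exact hA hm.symm
    · have := Q.nonadj i k (Ne.symm hki) e (fun e' => hkj (nxt_injective (by rw [hj]; exact e'.symm)))
      have hm : V ∈ (∅ : Set Pt) := by
        rw [← this]
        exact ⟨hVi, hmem⟩
      exact hm
  obtain ⟨ε, hε, hεA, hεB, hoth⟩ : ∃ ε > 0, ε ≤ dist A V ∧ ε ≤ dist B V ∧
      ∀ k, k ≠ i → k ≠ j → ∀ z ∈ ball V ε, z ∉ Q.edge k := by
    have hev : ∀ᶠ z in nhds V, ∀ k, k ≠ i → k ≠ j → z ∉ Q.edge k := by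
      rw [Filter.eventually_all]
      intro k
      by_cases hki : k = i
      · exact Filter.Eventually.of_forall fun z h1 => absurd hki h1
      by_cases hkj : k = j
      · exact Filter.Eventually.of_forall fun z _ h1 => absurd hkj h1
      have hcl : IsClosed (Q.edge k) := by
        unfold edge
        rw [← convexHull_pair]
        exact ((Set.toFinite _).isCompact_convexHull (𝕜 := ℝ)).isClosed
      filter_upwards [hcl.isOpen_compl.mem_nhds (hVoth k hki hkj)] with z hz _ _
      exact hz
    obtain ⟨ε, hε, hb⟩ := Metric.eventually_nhds_iff_ball.mp hev
    refine ⟨min ε (min (dist A V) (dist B V)), ?_, ?_, ?_, ?_⟩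
    · exact lt_min hε (lt_min (dist_pos.mpr hA) (dist_pos.mpr hB))
    · exact (min_le_right _ _).trans (min_le_left _ _)
    · exact (min_le_right _ _).trans (min_le_right _ _)
    · intro k h1 h2 z hz
      exact hb z (ball_subset_ball (min_le_left _ _) hz) k h1 h2
  obtain ⟨f, hf0, hf⟩ := exists_support Q.body V hVb h
  obtain ⟨f0, hf0'⟩ : ∃ r, r = f (EuclideanSpace.single 0 1) := ⟨_, rfl⟩
  obtain ⟨f1, hf1'⟩ : ∃ r, r = f (EuclideanSpace.single 1 1) := ⟨_, rfl⟩
  have hfz : ∀ z : Pt, f z = f0 * z 0 + f1 * z 1 := by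
    intro z
    have : z = z 0 • EuclideanSpace.single 0 (1 : ℝ) + z 1 • EuclideanSpace.single 1 (1 : ℝ) := by
      apply pt_ext <;> simp
    conv_lhs => rw [this]
    rw [map_add, map_smul, map_smul, ← hf0', ← hf1', smul_eq_mul, smul_eq_mul]
    ring
  have hfpos : 0 < f0 ^ 2 + f1 ^ 2 := by
    by_contra hc
    apply hf0
    have z0 : f0 = 0 := by nlinarith [sq_nonneg f0, sq_nonneg f1]
    have z1 : f1 = 0 := by nlinarith [sq_nonneg f0, sq_nonneg f1]
    ext1 z
    rw [hfz, z0, z1]; simp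
  have hsup : ∀ z ∈ Q.body, f0 * (z 0 - V 0) + f1 * (z 1 - V 1) ≤ 0 := by
    intro z hz
    have := hf z hz
    rw [hfz, hfz] at this
    linarith
  have hAb : A ∈ Q.body :=
    Or.inl (mem_iUnion.mpr ⟨i, by rw [hei]; exact right_mem_segment ℝ _ _⟩)
  have hBb : B ∈ Q.body :=
    Or.inl (mem_iUnion.mpr ⟨j, by rw [hej]; exact right_mem_segment ℝ _ _⟩)
  have hfA := hsup A hAb
  have hfB := hsup B hBb
  have hA2 := sq_pos_of_ne hA
  have hB2 := sq_pos_of_ne hB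
  have use1 := core Q V A B i j (Or.inl ⟨rfl, rfl⟩) hej (by rw [inter_comm]; exact hint) hA hB
    ε hε hoth hεA hεB f0 f1 hfpos hsup
  have use2 := core Q V B A j i (Or.inr ⟨rfl, by rw [hj]⟩) hei hint hB hA
    ε hε (fun k h1 h2 => hoth k h2 h1) hεB hεA f0 f1 hfpos hsup
  refine ⟨ε, hε, ?_⟩
  rcases lt_trichotomy 0 ((A 0 - V 0) * (B 1 - V 1) - (A 1 - V 1) * (B 0 - V 0)) with hc | hc | hc
  · exact use1 (Or.inl hc)
  · -- collinear case
    have hopp : ∃ t > 0, B 0 - V 0 = -t * (A 0 - V 0) ∧ B 1 - V 1 = -t * (A 1 - V 1) := by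
      obtain ⟨s, hs⟩ : ∃ s, s * ((A 0 - V 0) ^ 2 + (A 1 - V 1) ^ 2)
          = (B 0 - V 0) * (A 0 - V 0) + (B 1 - V 1) * (A 1 - V 1) :=
        ⟨_, div_mul_cancel₀ _ hA2.ne'⟩
      have ex : B 0 - V 0 = s * (A 0 - V 0) := by
        apply mul_right_cancel₀ hA2.ne'
        linear_combination (-(A 0 - V 0)) * hs + (A 1 - V 1) * hc
      have ey : B 1 - V 1 = s * (A 1 - V 1) := by
        apply mul_right_cancel₀ hA2.ne'
        linear_combination (-(A 1 - V 1)) * hs - (A 0 - V 0) * hc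
      refine ⟨-s, ?_, by rw [neg_neg]; exact ex, by rw [neg_neg]; exact ey⟩
      rw [gt_iff_lt, neg_pos]
      by_contra hs0
      push Not at hs0
      -- the nearer of `A`, `B` lies on both edges
      rcases lt_or_ge (dist B V) (dist A V) with hd | hd
      · have hm : B ∈ Q.edge j ∩ Q.edge i := by
          refine ⟨by rw [hej]; exact right_mem_segment ℝ _ _, ?_⟩
          rw [hei]
          exact mem_seg_s12 hs0 ex ey hd
        rw [hint] at hm
        exact hB hm
      · have hBA : B = V + s • (A - V) := by
          apply pt_ext <;> simp <;> linarith
        have hs1 : 1 ≤ s := by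
          rw [hBA, dist_eq_norm, dist_eq_norm, add_sub_cancel_left, norm_smul, Real.norm_eq_abs,
            abs_of_nonneg hs0] at hd
          have : 0 < ‖A - V‖ := norm_pos_iff.mpr (sub_ne_zero.mpr hA)
          by_contra hcc
          push Not at hcc
          nlinarith
        have hm : A ∈ Q.edge j ∩ Q.edge i := by
          refine ⟨?_, by rw [hei]; exact right_mem_segment ℝ _ _⟩
          rw [hej, segment_eq_image']
          refine ⟨s⁻¹, ⟨by positivity, inv_le_one_of_one_le₀ hs1⟩, ?_⟩
          have : s ≠ 0 := by linarith
          simp only [hBA, add_sub_cancel_left, smul_smul, inv_mul_cancel₀ this, one_smul]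
          abel
        rw [hint] at hm
        exact hA hm
    obtain ⟨t, ht, e0, e1⟩ := hopp
    have hz : f0 * (A 0 - V 0) + f1 * (A 1 - V 1) = 0 := by
      apply le_antisymm hfA
      rw [e0, e1] at hfB
      by_contra hcc
      push Not at hcc
      have := mul_pos ht (neg_pos.mpr hcc)
      linarith
    have i2 : (f0 ^ 2 + f1 ^ 2) * ((A 0 - V 0) ^ 2 + (A 1 - V 1) ^ 2)
          = (f0 * (A 0 - V 0) + f1 * (A 1 - V 1)) ^ 2
            + (f0 * (A 1 - V 1) - f1 * (A 0 - V 0)) ^ 2 := by ring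
    have p1 := mul_pos hfpos hA2
    rw [i2, hz] at p1
    rcases lt_trichotomy 0 (f0 * (A 1 - V 1) - f1 * (A 0 - V 0)) with hg | hg | hg
    · exact use1 (Or.inr ⟨t, ht, e0, e1, hg⟩)
    · rw [← hg] at p1; simp at p1
    · refine use2 (Or.inr ⟨t⁻¹, inv_pos.mpr ht, ?_, ?_, ?_⟩)
      · rw [e0]; field_simp
      · rw [e1]; field_simp
      · rw [e0, e1]
        have := mul_pos ht (neg_pos.mpr hg)
        linarith
  · exact use2 (Or.inl (by linarith))

end SimplePolygon

/-- Every reflex vertex lies in the interior of the convex hull of the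
polygon body; in particular it is not an extreme point of the hull. -/
theorem stmt_12 (Q : SimplePolygon) (hcomp : IsCompact Q.body)
    (i : Fin Q.n) (hr : Q.IsReflex i) :
    Q.v i ∈ interior (convexHull ℝ Q.body) ∧
    Q.v i ∉ Set.extremePoints ℝ (convexHull ℝ Q.body) := by
  have h : Q.v i ∈ interior (convexHull ℝ Q.body) := by
    by_contra hc
    exact hr (Q.locallyConvex_of_support i hc)
  exact ⟨h, fun h' => Set.disjoint_left.mp (disjoint_interior_extremePoints _) h h'⟩
end
end
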